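/- arXiv:2008.12222 — 5 statements merged into one kernel-verified Lean document; each statement's English description precedes it below -/
import Mathlib

section
/- Let γ > 0 and let H be a 3-graph on n vertices (n sufficiently large in terms of γ) with degree sequence d₁ ≤ … ≤ dₙ such that, for some t with 1 ≤ t ≤ n/(3√2), dᵢ ≥ (1/3 + 4γ)·C(n,2) + i·t for 1 ≤ i ≤ t, dᵢ ≥ (4/9 + 4γ)·C(n,2) for t < i ≤ n/3, and dᵢ ≥ (5/9 + 4γ)·C(n,2) for i > n/3. Suppose M is a matching in H such that |M| < ⌊(n − γn)/3⌋ and |L(M) ∩ V_{5/9}| > 2γn/75. Then there exists a matching M* in H with |M*| ≥ |M| + 1. -/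
open Finset
open scoped Classical

noncomputable section

/-- The degree of a vertex `v` in a `3`-graph `H` on `Fin n`. -/
def deg {n : ℕ} (H : Finset (Finset (Fin n))) (v : Fin n) : ℕ :=
  (H.filter fun e => v ∈ e).card

/-- `H` is a `3`-graph: every edge has exactly three vertices. -/
def Is3Graph (n : ℕ) (H : Finset (Finset (Fin n))) : Prop :=
  ∀ e ∈ H, e.card = 3

/-- `M` is a matching in `H`. -/
def IsMatching {n : ℕ} (H M : Finset (Finset (Fin n))) : Prop :=
  M ⊆ H ∧ ∀ e ∈ M, ∀ f ∈ M, e ≠ f → Disjoint e f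

/-- The set of vertices covered by a collection `M` of edges. -/
def cover {n : ℕ} (M : Finset (Finset (Fin n))) : Finset (Fin n) :=
  M.biUnion id

/-- The leave of `M`: the vertices not covered by `M`. -/
def leave {n : ℕ} (M : Finset (Finset (Fin n))) : Finset (Fin n) :=
  univ \ cover M

/-- `v` is a big (5/9th) vertex: `deg v ≥ (5/9 + γ)·C(n,2)`. -/
def big {n : ℕ} (γ : ℝ) (H : Finset (Finset (Fin n))) (v : Fin n) : Prop :=
  ((5 : ℝ)/9 + γ) * (n.choose 2) ≤ (deg H v : ℝ)

/-- `V_{5/9}`: the set of big vertices. -/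
def V59 {n : ℕ} (γ : ℝ) (H : Finset (Finset (Fin n))) : Finset (Fin n) :=
  univ.filter fun v => big γ H v

/-- `σ` witnesses the degree sequence condition of Theorem `almostmainthm`
(with `4γ` error terms): `σ` is a monotone-degree ordering of the vertices and,
writing `dᵢ = deg (σ i)` for the `i`-th smallest degree (1-based),
`dᵢ ≥ (1/3 + 4γ)·C(n,2) + i·t` for `1 ≤ i ≤ t`,
`dᵢ ≥ (4/9 + 4γ)·C(n,2)` for `t < i ≤ n/3`, and
`dᵢ ≥ (5/9 + 4γ)·C(n,2)` for `i > n/3`. -/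
def DegSeq4 {n : ℕ} (γ : ℝ) (t : ℕ) (H : Finset (Finset (Fin n)))
    (σ : Fin n ≃ Fin n) : Prop :=
  Monotone (fun i => deg H (σ i)) ∧
  ∀ i : Fin n,
    ((i : ℕ) + 1 ≤ t →
      ((1 : ℝ)/3 + 4*γ) * (n.choose 2) + ((i : ℕ) + 1) * t ≤ (deg H (σ i) : ℝ)) ∧
    (t < (i : ℕ) + 1 → 3 * ((i : ℕ) + 1) ≤ n →
      ((4 : ℝ)/9 + 4*γ) * (n.choose 2) ≤ (deg H (σ i) : ℝ)) ∧
    (n < 3 * ((i : ℕ) + 1) →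
      ((5 : ℝ)/9 + 4*γ) * (n.choose 2) ≤ (deg H (σ i) : ℝ))

/-- A pair `s` is good for `B` if at least twelve vertices of `B` extend it to an edge of `H`. -/
def IsGood {n : ℕ} (H : Finset (Finset (Fin n))) (B s : Finset (Fin n)) : Prop :=
  s.card = 2 ∧ 12 ≤ (B.filter fun v => v ∉ s ∧ insert v s ∈ H).card

/-- Few disjoint good pairs extend greedily to a matching. -/
lemma exists_matching_of_good {n : ℕ} {H : Finset (Finset (Fin n))} {B : Finset (Fin n)}
    (l : List (Finset (Fin n))) (F : Finset (Fin n)) (hgood : ∀ s ∈ l, IsGood H B s)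
    (hF : ∀ s ∈ l, s ⊆ F) (hl : l.Pairwise Disjoint) (hcard : F.card + l.length ≤ 12) :
    ∃ N, IsMatching H N ∧ N.card = l.length ∧
      ∀ e ∈ N, ∃ s ∈ l, ∃ v ∈ B, v ∉ F ∧ e = insert v s := by
  induction l generalizing F with
  | nil => exact ⟨∅, ⟨by simp, by simp⟩, by simp, by simp⟩
  | cons s l ih =>
    rw [List.pairwise_cons] at hl
    simp only [List.mem_cons, forall_eq_or_imp] at hgood hF
    rw [List.length_cons] at hcard
    obtain ⟨v, hv, hvF⟩ : ∃ v ∈ B.filter (fun v => v ∉ s ∧ insert v s ∈ H), v ∉ F :=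
      Finset.exists_mem_notMem_of_card_lt_card (by have := hgood.1.2; omega)
    rw [Finset.mem_filter] at hv
    obtain ⟨N, hN, hNcard, hNe⟩ := ih (insert v F) hgood.2
      (fun s' hs' => (hF.2 s' hs').trans (Finset.subset_insert _ _)) hl.2
      (by have := Finset.card_insert_le v F; omega)
    have hdisj : ∀ e ∈ N, Disjoint (insert v s) e := by
      intro e he
      obtain ⟨s', hs', v', -, hv'F, rfl⟩ := hNe e he
      rw [Finset.mem_insert, not_or] at hv'F
      rw [Finset.disjoint_insert_left, Finset.disjoint_insert_right, Finset.mem_insert]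
      exact ⟨fun h => h.elim (fun h => hv'F.1 h.symm) (fun h => hvF (hF.2 s' hs' h)),
        fun h => hv'F.2 (hF.1 h), hl.1 s' hs'⟩
    have hnot : insert v s ∉ N := fun h => by
      have := hdisj _ h
      rw [disjoint_self] at this
      exact Finset.insert_ne_empty v s this
    refine ⟨insert (insert v s) N, ⟨?_, ?_⟩, ?_, ?_⟩
    · exact Finset.insert_subset hv.2.2 hN.1
    · intro e he f hf hne
      rw [Finset.mem_insert] at he hf
      rcases he with rfl | he <;> rcases hf with rfl | hf
      · exact absurd rfl hne
      · exact hdisj f hf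
      · exact (hdisj e he).symm
      · exact hN.2 e he f hf hne
    · rw [Finset.card_insert_of_notMem hnot, hNcard, List.length_cons]
    · intro e he
      rw [Finset.mem_insert] at he
      rcases he with rfl | he
      · exact ⟨s, by simp, v, hv.1, hvF, rfl⟩
      · obtain ⟨s', hs', v', hv', hv'F, rfl⟩ := hNe e he
        exact ⟨s', by simp [hs'], v', hv', fun h => hv'F (Finset.mem_insert_of_mem h), rfl⟩

/-- No family of `k ≤ 4` disjoint `R`-pairs fits into the leave of `M` together with
fewer than `k` edges of `M`. -/
def Unaugmentable {n : ℕ} (M : Finset (Finset (Fin n))) (R : Fin n → Fin n → Prop) : Prop :=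
  ∀ T ⊆ M, ∀ l : List (Fin n × Fin n), l.length ≤ 4 →
    (∀ p ∈ l, R p.1 p.2 ∧ p.1 ∈ cover T ∪ leave M ∧ p.2 ∈ cover T ∪ leave M) →
    l.Pairwise (fun p q => p.1 ≠ q.1 ∧ p.1 ≠ q.2 ∧ p.2 ≠ q.1 ∧ p.2 ≠ q.2) →
    l.length ≤ T.card

lemma card_foldr_union_le {α : Type*} [DecidableEq α] (l : List (Finset α)) (k : ℕ)
    (h : ∀ s ∈ l, s.card ≤ k) : (l.foldr (· ∪ ·) ∅).card ≤ l.length * k := by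
  induction l with
  | nil => simp
  | cons s l ih =>
    simp only [List.mem_cons, forall_eq_or_imp] at h
    rw [List.foldr_cons, List.length_cons]
    have := Finset.card_union_le s (l.foldr (· ∪ ·) ∅)
    have := ih h.2
    nlinarith [h.1]

lemma subset_foldr_union {α : Type*} [DecidableEq α] (l : List (Finset α)) :
    ∀ s ∈ l, s ⊆ l.foldr (· ∪ ·) ∅ := by
  induction l with
  | nil => simp
  | cons s l ih =>
    simp only [List.mem_cons, forall_eq_or_imp, List.foldr_cons]
    exact ⟨Finset.subset_union_left,
      fun s' hs' => (ih s' hs').trans Finset.subset_union_right⟩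

lemma mem_leave_iff {n : ℕ} {M : Finset (Finset (Fin n))} {v : Fin n} :
    v ∈ leave M ↔ ∀ e ∈ M, v ∉ e := by
  simp [leave, cover]

lemma mem_cover_iff {n : ℕ} {M : Finset (Finset (Fin n))} {v : Fin n} :
    v ∈ cover M ↔ ∃ e ∈ M, v ∈ e := by
  simp [cover]

/-- A maximum matching is unaugmentable with respect to the good pairs. -/
lemma unaugmentable_of_maximum {n : ℕ} {H M : Finset (Finset (Fin n))} {B : Finset (Fin n)}
    (h3 : Is3Graph n H) (hM : IsMatching H M) (hB : B ⊆ leave M)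
    (hmax : ∀ N, IsMatching H N → N.card ≤ M.card) :
    Unaugmentable M (fun x y => IsGood H B {x, y}) := by
  intro T hT l hl hmem hpw
  set l' : List (Finset (Fin n)) := l.map fun p => {p.1, p.2} with hl'
  have hlen : l'.length = l.length := by simp [hl']
  have hgood : ∀ s ∈ l', IsGood H B s := by
    intro s hs
    obtain ⟨p, hp, rfl⟩ := List.mem_map.1 hs
    exact (hmem p hp).1
  have hsub : ∀ s ∈ l', s ⊆ cover T ∪ leave M := by
    intro s hs
    obtain ⟨p, hp, rfl⟩ := List.mem_map.1 hs
    rw [Finset.insert_subset_iff, Finset.singleton_subset_iff]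
    exact (hmem p hp).2
  have hpw' : l'.Pairwise Disjoint := by
    rw [hl', List.pairwise_map]
    refine hpw.imp ?_
    rintro ⟨a, b⟩ ⟨c, d⟩ ⟨h1, h2, h3, h4⟩
    simp_all [Finset.disjoint_left]
  have hFcard := card_foldr_union_le l' 2 fun s hs => (hgood s hs).1.le
  obtain ⟨N, hN, hNcard, hNe⟩ := exists_matching_of_good l' (l'.foldr (· ∪ ·) ∅) hgood
    (subset_foldr_union l') hpw' (by omega)
  have hNsub : ∀ e ∈ N, e ⊆ cover T ∪ leave M := by
    intro e he
    obtain ⟨s, hs, v, hv, -, rfl⟩ := hNe e he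
    exact Finset.insert_subset (Finset.mem_union_right _ (hB hv)) (hsub s hs)
  have hdisj : ∀ e ∈ M \ T, ∀ f ∈ N, Disjoint e f := by
    intro e he f hf
    rw [Finset.mem_sdiff] at he
    rw [Finset.disjoint_left]
    intro x hxe hxf
    rcases Finset.mem_union.1 (hNsub f hf hxf) with hx | hx
    · obtain ⟨g, hg, hxg⟩ := mem_cover_iff.1 hx
      have hne : e ≠ g := by
        rintro rfl
        exact he.2 hg
      exact Finset.disjoint_left.1 (hM.2 e he.1 g (hT hg) hne) hxe hxg
    · exact mem_leave_iff.1 hx e he.1 hxe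
  have hdisj' : Disjoint (M \ T) N := by
    rw [Finset.disjoint_left]
    intro e he heN
    have h := hdisj e he e heN
    rw [disjoint_self] at h
    have := h3 e (hN.1 heN)
    simp [h] at this
  have hnew : IsMatching H ((M \ T) ∪ N) := by
    refine ⟨Finset.union_subset (Finset.sdiff_subset.trans hM.1) hN.1, ?_⟩
    intro e he f hf hne
    rw [Finset.mem_union] at he hf
    rcases he with he | he <;> rcases hf with hf | hf
    · exact hM.2 e (Finset.sdiff_subset he) f (Finset.sdiff_subset hf) hne
    · exact hdisj e he f hf
    · exact (hdisj f hf e he).symm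
    · exact hN.2 e he f hf hne
  have := hmax _ hnew
  rw [Finset.card_union_of_disjoint hdisj', Finset.card_sdiff_of_subset hT] at this
  have := Finset.card_le_card hT
  omega

/-- A symmetric integer matrix with entries at most `1`, in which two ones in a row force a
negative entry between their columns, has nonpositive total. -/
lemma sum_matrix_nonpos {ι : Type*} [Fintype ι] (s : ι → ι → ℤ) (hsymm : ∀ x y, s x y = s y x)
    (hle : ∀ x y, s x y ≤ 1) (hneg : ∀ x y z, s x y = 1 → s x z = 1 → s y z ≤ -1) :
    ∑ x, ∑ y, s x y ≤ 0 := by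
  set d : ι → ℝ := fun x => ∑ y, if s x y = 1 then 1 else 0 with hd
  set F : ι → ι → ℝ := fun x u => if s x u = 1 then 1 - d u / d x else 0 with hF
  have hd_nonneg : ∀ x, 0 ≤ d x := fun x => Finset.sum_nonneg fun y _ => by split_ifs <;> norm_num
  have hd_pos : ∀ x u, s x u = 1 → 0 < d x := by
    intro x u h
    refine Finset.sum_pos' (fun y _ => by split_ifs <;> norm_num) ⟨u, Finset.mem_univ u, ?_⟩
    simp [h]
  have hrow : ∀ x u, s x u = 1 → ((∑ y, s x y : ℤ) : ℝ) ≤ d x - d u := by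
    intro x u hxu
    rw [hd, ← Finset.sum_sub_distrib, Int.cast_sum]
    refine Finset.sum_le_sum fun y _ => ?_
    by_cases huy : s u y = 1
    · have h1 := hneg u x y (by rw [hsymm, hxu]) huy
      have h2 : s x y ≠ 1 := by omega
      simp only [huy, h2, if_true, if_false]
      have : (s x y : ℝ) ≤ (-1 : ℤ) := by exact_mod_cast h1
      simpa using this
    · by_cases hxy : s x y = 1
      · simp [huy, hxy]
      · have h1 : s x y ≤ 0 := by have := hle x y; omega
        simp only [huy, hxy, if_false, sub_zero]
        exact_mod_cast h1
  have hrowF : ∀ x, ((∑ y, s x y : ℤ) : ℝ) ≤ ∑ u, F x u := by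
    intro x
    by_cases hx : ∃ u, s x u = 1
    · obtain ⟨u₀, hu₀⟩ := hx
      have hpos := hd_pos x u₀ hu₀
      refine le_of_mul_le_mul_left ?_ hpos
      have : d x * ((∑ y, s x y : ℤ) : ℝ) =
          ∑ u, (if s x u = 1 then 1 else 0) * ((∑ y, s x y : ℤ) : ℝ) := by
        rw [← Finset.sum_mul]
      rw [this, Finset.mul_sum]
      refine Finset.sum_le_sum fun u _ => ?_
      by_cases hu : s x u = 1
      · simp only [hF, hu, if_true, one_mul]
        refine (hrow x u hu).trans (le_of_eq ?_)
        field_simp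
      · simp [hF, hu]
    · push Not at hx
      have h1 : ∑ u, F x u = 0 := Finset.sum_eq_zero fun u _ => by simp [hF, hx u]
      rw [h1]
      have h2 : ∑ y, s x y ≤ 0 := Finset.sum_nonpos fun y _ => by
        have := hle x y
        have := hx y
        omega
      exact_mod_cast h2
  have hFF : ∀ x u, F x u + F u x ≤ 0 := by
    intro x u
    by_cases h : s x u = 1
    · have h' : s u x = 1 := by rw [hsymm, h]
      have hx := hd_pos x u h
      have hu := hd_pos u x h'
      simp only [hF, h, h', if_true]
      have : 2 ≤ d u / d x + d x / d u := by
        rw [div_add_div _ _ hx.ne' hu.ne', le_div_iff₀ (by positivity)]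
        nlinarith [sq_nonneg (d u - d x)]
      linarith
    · have h' : s u x ≠ 1 := by rwa [hsymm]
      simp [hF, h, h']
  have hsum : ((∑ x, ∑ y, s x y : ℤ) : ℝ) ≤ ∑ x, ∑ u, F x u := by
    rw [Int.cast_sum]
    exact Finset.sum_le_sum fun x _ => hrowF x
  have hswap : ∑ x, ∑ u, F x u = ∑ x, ∑ u, F u x := Finset.sum_comm
  have htwo : ∑ x, ∑ u, F x u + ∑ x, ∑ u, F u x ≤ 0 := by
    simp only [← Finset.sum_add_distrib]
    exact Finset.sum_nonpos fun x _ => Finset.sum_nonpos fun u _ => hFF x u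
  have : ((∑ x, ∑ y, s x y : ℤ) : ℝ) ≤ 0 := by linarith
  exact_mod_cast this

set_option maxRecDepth 100000 in
set_option maxHeartbeats 4000000 in
lemma exists_perm_or_star_of_six_le (A : Fin 3 → Fin 3 → Bool) :
    6 ≤ ∑ i, ∑ j, (A i j).toNat →
      (∃ i j k : Fin 3, i ≠ j ∧ i ≠ k ∧ j ≠ k ∧ A 0 i ∧ A 1 j ∧ A 2 k) ∨
      (∑ i, ∑ j, (A i j).toNat = 6 ∧
        ((∃ c, ∀ i, i ≠ c → ∀ j, A i j) ∨ (∃ c, ∀ j, j ≠ c → ∀ i, A i j))) := by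
  revert A
  decide

set_option maxRecDepth 100000 in
set_option maxHeartbeats 4000000 in
lemma exists_two_of_five_le (A : Fin 3 → Fin 3 → Bool) :
    5 ≤ ∑ i, ∑ j, (A i j).toNat →
      ∃ i i' j j' : Fin 3, i ≠ i' ∧ j ≠ j' ∧ A i j ∧ A i' j' := by
  revert A
  decide
/-- The number of pairs in `A × B` satisfying `R`. -/
def pairCount {n : ℕ} (R : Fin n → Fin n → Prop) (A B : Finset (Fin n)) : ℕ :=
  ∑ x ∈ A, ∑ y ∈ B, if R x y then 1 else 0

lemma pairCount_comm {n : ℕ} {R : Fin n → Fin n → Prop} (hR : ∀ ⦃x y⦄, R x y → R y x)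
    (A B : Finset (Fin n)) : pairCount R A B = pairCount R B A := by
  unfold pairCount
  rw [Finset.sum_comm]
  refine Finset.sum_congr rfl fun x _ => Finset.sum_congr rfl fun y _ => ?_
  simp only [show R x y ↔ R y x from ⟨fun h => hR h, fun h => hR h⟩]

lemma pairCount_eq_card {n : ℕ} (R : Fin n → Fin n → Prop) (A B : Finset (Fin n)) :
    pairCount R A B = ((A ×ˢ B).filter fun p => R p.1 p.2).card := by
  rw [Finset.card_filter, Finset.sum_product, pairCount]

lemma pairCount_le_of_subset {n : ℕ} {R : Fin n → Fin n → Prop} {A B : Finset (Fin n)}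
    (S : Finset (Fin n × Fin n)) (h : ∀ x ∈ A, ∀ y ∈ B, R x y → (x, y) ∈ S) :
    pairCount R A B ≤ S.card := by
  rw [pairCount_eq_card]
  refine Finset.card_le_card ?_
  rintro ⟨x, y⟩ hxy
  rw [Finset.mem_filter, Finset.mem_product] at hxy
  exact h x hxy.1.1 y hxy.1.2 hxy.2

lemma exists_enum {n : ℕ} {e : Finset (Fin n)} (he : e.card = 3) :
    ∃ α : Fin 3 → Fin n, Function.Injective α ∧ e = univ.image α := by
  refine ⟨fun i => e.orderIsoOfFin he i, ?_, ?_⟩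
  · exact Subtype.val_injective.comp (e.orderIsoOfFin he).injective
  · ext x
    simp only [Finset.mem_image, Finset.mem_univ, true_and]
    exact ⟨fun hx => ⟨(e.orderIsoOfFin he).symm ⟨x, hx⟩, by simp⟩,
      fun ⟨i, hi⟩ => hi ▸ (e.orderIsoOfFin he i).2⟩

lemma eq_triple {n : ℕ} {e : Finset (Fin n)} (he : e.card = 3) {a b c : Fin n} (ha : a ∈ e)
    (hb : b ∈ e) (hc : c ∈ e) (hab : a ≠ b) (hac : a ≠ c) (hbc : b ≠ c) : e = {a, b, c} := by
  refine (Finset.eq_of_subset_of_card_le ?_ ?_).symm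
  · simp [Finset.insert_subset_iff, ha, hb, hc]
  · rw [he, Finset.card_eq_three.2 ⟨a, b, c, hab, hac, hbc, rfl⟩]

lemma exists_third {n : ℕ} {e : Finset (Fin n)} (he : e.card = 3) (a b : Fin n) :
    ∃ c ∈ e, c ≠ a ∧ c ≠ b := by
  obtain ⟨c, hc, hcab⟩ : ∃ c ∈ e, c ∉ ({a, b} : Finset (Fin n)) :=
    Finset.exists_mem_notMem_of_card_lt_card (by have := Finset.card_le_two (a := a) (b := b); omega)
  simp only [Finset.mem_insert, Finset.mem_singleton, not_or] at hcab
  exact ⟨c, hc, hcab⟩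

/-- Two vertices of `e` are `R`-adjacent to all of `f`. -/
def Dominates {n : ℕ} (R : Fin n → Fin n → Prop) (e f : Finset (Fin n)) : Prop :=
  ∃ a ∈ e, ∃ b ∈ e, ∃ c ∈ e, a ≠ b ∧ a ≠ c ∧ b ≠ c ∧ ∀ y ∈ f, R a y ∧ R b y

lemma pairCount_image {n : ℕ} (R : Fin n → Fin n → Prop) {α β : Fin 3 → Fin n}
    (hα : Function.Injective α) (hβ : Function.Injective β) :
    pairCount R (univ.image α) (univ.image β) =
      ∑ i, ∑ j, (decide (R (α i) (β j))).toNat := by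
  unfold pairCount
  rw [Finset.sum_image hα.injOn]
  refine Finset.sum_congr rfl fun i _ => ?_
  rw [Finset.sum_image hβ.injOn]
  refine Finset.sum_congr rfl fun j _ => ?_
  by_cases h : R (α i) (β j) <;> simp [h]

lemma exists_three_or_dominates {n : ℕ} {R : Fin n → Fin n → Prop} (hR : ∀ ⦃x y⦄, R x y → R y x)
    {e f : Finset (Fin n)} (he : e.card = 3) (hf : f.card = 3) (h : 6 ≤ pairCount R e f) :
    (∃ x₀ ∈ e, ∃ x₁ ∈ e, ∃ x₂ ∈ e, ∃ y₀ ∈ f, ∃ y₁ ∈ f, ∃ y₂ ∈ f, x₀ ≠ x₁ ∧ x₀ ≠ x₂ ∧ x₁ ≠ x₂ ∧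
      y₀ ≠ y₁ ∧ y₀ ≠ y₂ ∧ y₁ ≠ y₂ ∧ R x₀ y₀ ∧ R x₁ y₁ ∧ R x₂ y₂) ∨
    (pairCount R e f = 6 ∧ (Dominates R e f ∨ Dominates R f e)) := by
  obtain ⟨α, hα, rfl⟩ := exists_enum he
  obtain ⟨β, hβ, rfl⟩ := exists_enum hf
  have hothers : ∀ c : Fin 3, ∃ i j : Fin 3, i ≠ j ∧ i ≠ c ∧ j ≠ c := by decide
  rw [pairCount_image R hα hβ] at h ⊢
  rcases exists_perm_or_star_of_six_le _ h with ⟨i, j, k, hij, hik, hjk, h0, h1, h2⟩ | ⟨h6, hstar⟩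
  · left
    simp only [decide_eq_true_eq] at h0 h1 h2
    exact ⟨α 0, by simp, α 1, by simp, α 2, by simp, β i, by simp, β j, by simp, β k, by simp,
      hα.ne (by decide), hα.ne (by decide), hα.ne (by decide), hβ.ne hij, hβ.ne hik, hβ.ne hjk,
      h0, h1, h2⟩
  · right
    refine ⟨h6, ?_⟩
    simp only [decide_eq_true_eq] at hstar
    rcases hstar with ⟨c, hc⟩ | ⟨c, hc⟩ <;> obtain ⟨i, j, hij, hic, hjc⟩ := hothers c
    · left
      refine ⟨α i, by simp, α j, by simp, α c, by simp, hα.ne hij, hα.ne hic, hα.ne hjc, ?_⟩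
      intro y hy
      obtain ⟨k, -, rfl⟩ := Finset.mem_image.1 hy
      exact ⟨hc i hic k, hc j hjc k⟩
    · right
      refine ⟨β i, by simp, β j, by simp, β c, by simp, hβ.ne hij, hβ.ne hic, hβ.ne hjc, ?_⟩
      intro y hy
      obtain ⟨k, -, rfl⟩ := Finset.mem_image.1 hy
      exact ⟨hR (hc i hic k), hR (hc j hjc k)⟩

lemma exists_two_disjoint {n : ℕ} {R : Fin n → Fin n → Prop}
    {e f : Finset (Fin n)} (he : e.card = 3) (hf : f.card = 3) (h : 5 ≤ pairCount R e f) :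
    ∃ x₀ ∈ e, ∃ x₁ ∈ e, ∃ y₀ ∈ f, ∃ y₁ ∈ f, x₀ ≠ x₁ ∧ y₀ ≠ y₁ ∧ R x₀ y₀ ∧ R x₁ y₁ := by
  obtain ⟨α, hα, rfl⟩ := exists_enum he
  obtain ⟨β, hβ, rfl⟩ := exists_enum hf
  rw [pairCount_image R hα hβ] at h
  obtain ⟨i, i', j, j', hi, hj, h1, h2⟩ := exists_two_of_five_le _ h
  simp only [decide_eq_true_eq] at h1 h2
  exact ⟨α i, by simp, α i', by simp, β j, by simp, β j', by simp, hα.ne hi, hβ.ne hj, h1, h2⟩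

lemma mem_cover_union {n : ℕ} {T : Finset (Finset (Fin n))} {e L : Finset (Fin n)} (he : e ∈ T)
    {x : Fin n} (hx : x ∈ e) : x ∈ cover T ∪ L :=
  Finset.mem_union_left _ (mem_cover_iff.2 ⟨e, he, hx⟩)

lemma Unaugmentable.not_leave {n : ℕ} {M : Finset (Finset (Fin n))} {R : Fin n → Fin n → Prop}
    (hU : Unaugmentable M R) {x y : Fin n} (hx : x ∈ leave M) (hy : y ∈ leave M) : ¬ R x y := by
  intro h
  have := hU ∅ (by simp) [(x, y)] (by simp) (by simp [h, hx, hy]) (by simp)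
  simp at this

lemma Unaugmentable.not_two {n : ℕ} {M : Finset (Finset (Fin n))} {R : Fin n → Fin n → Prop}
    (hU : Unaugmentable M R) {e : Finset (Fin n)} (he : e ∈ M) {x₀ x₁ y₀ y₁ : Fin n}
    (hx₀ : x₀ ∈ e) (hx₁ : x₁ ∈ e) (hy₀ : y₀ ∈ leave M) (hy₁ : y₁ ∈ leave M)
    (hx : x₀ ≠ x₁) (hy : y₀ ≠ y₁) (h₀ : R x₀ y₀) (h₁ : R x₁ y₁) : False := by
  have hc : ∀ x ∈ e, x ∈ cover {e} ∪ leave M := fun x => mem_cover_union (by simp)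
  have hL : ∀ y ∈ leave M, y ∈ cover {e} ∪ leave M := fun y => Finset.mem_union_right _
  have hne : ∀ x ∈ e, ∀ y ∈ leave M, x ≠ y := by
    rintro x hx y hy rfl
    exact mem_leave_iff.1 hy e he hx
  have := hU {e} (by simpa) [(x₀, y₀), (x₁, y₁)] (by simp) (by simp_all)
    (by simp [hx, hy, hne x₀ hx₀ y₁ hy₁, (hne x₁ hx₁ y₀ hy₀).symm])
  simp at this

lemma Unaugmentable.not_three {n : ℕ} {M : Finset (Finset (Fin n))} {R : Fin n → Fin n → Prop}
    (hU : Unaugmentable M R) {e f : Finset (Fin n)} (he : e ∈ M) (hf : f ∈ M) (hef : Disjoint e f)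
    {x₀ x₁ x₂ y₀ y₁ y₂ : Fin n} (hx₀ : x₀ ∈ e) (hx₁ : x₁ ∈ e) (hx₂ : x₂ ∈ e)
    (hy₀ : y₀ ∈ f) (hy₁ : y₁ ∈ f) (hy₂ : y₂ ∈ f) (hx₀₁ : x₀ ≠ x₁) (hx₀₂ : x₀ ≠ x₂)
    (hx₁₂ : x₁ ≠ x₂) (hy₀₁ : y₀ ≠ y₁) (hy₀₂ : y₀ ≠ y₂) (hy₁₂ : y₁ ≠ y₂)
    (h₀ : R x₀ y₀) (h₁ : R x₁ y₁) (h₂ : R x₂ y₂) : False := by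
  have hce : ∀ x ∈ e, x ∈ cover {e, f} ∪ leave M := fun x => mem_cover_union (by simp)
  have hcf : ∀ x ∈ f, x ∈ cover {e, f} ∪ leave M := fun x => mem_cover_union (by simp)
  have hne : ∀ x ∈ e, ∀ y ∈ f, x ≠ y := Finset.disjoint_iff_ne.1 hef
  have := hU {e, f} (by simp [Finset.insert_subset_iff, he, hf])
    [(x₀, y₀), (x₁, y₁), (x₂, y₂)] (by simp) (by simp_all)
    (by
      simp only [List.pairwise_cons, List.mem_cons, forall_eq_or_imp, List.not_mem_nil]
      simp [*, hne _ hx₀ _ hy₁, hne _ hx₀ _ hy₂,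
        hne _ hx₁ _ hy₂, (hne _ hx₁ _ hy₀).symm, (hne _ hx₂ _ hy₀).symm,
        (hne _ hx₂ _ hy₁).symm])
  have h2 := Finset.card_le_two (a := e) (b := f)
  simp only [List.length_cons, List.length_nil] at this
  omega

lemma Unaugmentable.not_four {n : ℕ} {M : Finset (Finset (Fin n))} {R : Fin n → Fin n → Prop}
    (hU : Unaugmentable M R) {e f g : Finset (Fin n)} (he : e ∈ M) (hf : f ∈ M) (hg : g ∈ M)
    (hef : Disjoint e f) (heg : Disjoint e g) (hfg : Disjoint f g)
    {x₀ x₁ x₂ y₀ y₁ y₂ z₀ z₁ : Fin n} (hx₀ : x₀ ∈ e) (hx₁ : x₁ ∈ e) (hx₂ : x₂ ∈ e)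
    (hy₀ : y₀ ∈ f) (hy₁ : y₁ ∈ f) (hy₂ : y₂ ∈ f) (hz₀ : z₀ ∈ g) (hz₁ : z₁ ∈ g)
    (hx₀₁ : x₀ ≠ x₁) (hx₀₂ : x₀ ≠ x₂) (hx₁₂ : x₁ ≠ x₂)
    (hy₀₁ : y₀ ≠ y₁) (hy₀₂ : y₀ ≠ y₂) (hy₁₂ : y₁ ≠ y₂) (hz : z₀ ≠ z₁)
    (h₀ : R x₀ y₀) (h₁ : R x₁ y₁) (h₂ : R x₂ z₀) (h₃ : R y₂ z₁) : False := by
  have hce : ∀ x ∈ e, x ∈ cover {e, f, g} ∪ leave M := fun x => mem_cover_union (by simp)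
  have hcf : ∀ x ∈ f, x ∈ cover {e, f, g} ∪ leave M := fun x => mem_cover_union (by simp)
  have hcg : ∀ x ∈ g, x ∈ cover {e, f, g} ∪ leave M := fun x => mem_cover_union (by simp)
  have hne : ∀ x ∈ e, ∀ y ∈ f, x ≠ y := Finset.disjoint_iff_ne.1 hef
  have hne' : ∀ x ∈ e, ∀ y ∈ g, x ≠ y := Finset.disjoint_iff_ne.1 heg
  have hne'' : ∀ x ∈ f, ∀ y ∈ g, x ≠ y := Finset.disjoint_iff_ne.1 hfg
  have := hU {e, f, g} (by simp [Finset.insert_subset_iff, he, hf, hg])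
    [(x₀, y₀), (x₁, y₁), (x₂, z₀), (y₂, z₁)] (by simp) (by simp_all)
    (by
      simp only [List.pairwise_cons, List.mem_cons, forall_eq_or_imp, List.not_mem_nil]
      simp [*, hne _ hx₀ _ hy₁, hne _ hx₀ _ hy₂, hne _ hx₁ _ hy₂, hne _ hx₂ _ hy₂,
        hne' _ hx₀ _ hz₀, hne' _ hx₀ _ hz₁, hne' _ hx₁ _ hz₀, hne' _ hx₁ _ hz₁,
        hne' _ hx₂ _ hz₁, hne'' _ hy₀ _ hz₀, hne'' _ hy₀ _ hz₁, hne'' _ hy₁ _ hz₀,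
        hne'' _ hy₁ _ hz₁, (hne'' _ hy₂ _ hz₀).symm, (hne _ hx₁ _ hy₀).symm,
        (hne _ hx₂ _ hy₀).symm, (hne _ hx₂ _ hy₁).symm])
  have h2 := Finset.card_le_three (a := e) (b := f) (c := g)
  simp only [List.length_cons, List.length_nil] at this
  omega

/-- Out-star: `e` dominates both `f` and `g`. -/
lemma Unaugmentable.pairCount_le_of_out_star {n : ℕ} {M : Finset (Finset (Fin n))}
    {R : Fin n → Fin n → Prop} (hU : Unaugmentable M R) (hR : ∀ ⦃x y⦄, R x y → R y x)
    (hcard : ∀ e ∈ M, e.card = 3) {e f g : Finset (Fin n)} (he : e ∈ M) (hf : f ∈ M) (hg : g ∈ M)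
    (hef : Disjoint e f) (heg : Disjoint e g) (hfg : Disjoint f g)
    (h₁ : Dominates R e f) (h₂ : Dominates R e g) : pairCount R f g ≤ 4 := by
  by_contra! h
  obtain ⟨y₀, hy₀, y₁, hy₁, z₀, hz₀, z₁, hz₁, hy, hz, h0, h1⟩ :=
    exists_two_disjoint (hcard f hf) (hcard g hg) h
  obtain ⟨y₂, hy₂, hy₂₀, hy₂₁⟩ := exists_third (hcard f hf) y₀ y₁
  obtain ⟨z₂, hz₂, hz₂₀, hz₂₁⟩ := exists_third (hcard g hg) z₀ z₁
  obtain ⟨a, ha, b, hb, c, hc, hab, hac, hbc, hD⟩ := h₁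
  obtain ⟨p, hp, q, hq, r, hr, hpq, hpr, hqr, hD'⟩ := h₂
  obtain ⟨x, hx, hxa, hRx⟩ : ∃ x ∈ e, a ≠ x ∧ R x z₂ := by
    by_cases hap : a = p
    · exact ⟨q, hq, hap ▸ hpq, (hD' _ hz₂).2⟩
    · exact ⟨p, hp, hap, (hD' _ hz₂).1⟩
  exact hU.not_four hf hg he hfg hef.symm heg.symm hy₀ hy₁ hy₂ hz₀ hz₁ hz₂ ha hx hy hy₂₀.symm
    hy₂₁.symm hz hz₂₀.symm hz₂₁.symm hxa h0 h1 (hR (hD _ hy₂).1) (hR hRx)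

/-- Path: `f` dominates `e`, which dominates `g`. -/
lemma Unaugmentable.pairCount_le_of_path {n : ℕ} {M : Finset (Finset (Fin n))}
    {R : Fin n → Fin n → Prop} (hU : Unaugmentable M R) (hR : ∀ ⦃x y⦄, R x y → R y x)
    (hcard : ∀ e ∈ M, e.card = 3) {e f g : Finset (Fin n)} (he : e ∈ M) (hf : f ∈ M) (hg : g ∈ M)
    (hef : Disjoint e f) (heg : Disjoint e g) (hfg : Disjoint f g)
    (h₁ : Dominates R f e) (h₂ : Dominates R e g) : pairCount R f g ≤ 4 := by
  obtain ⟨a, ha, b, hb, c, hc, hab, hac, hbc, hD⟩ := h₁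
  obtain ⟨p, hp, q, hq, r, hr, hpq, hpr, hqr, hD'⟩ := h₂
  have key : ∀ a ∈ f, ∀ b ∈ f, a ≠ b → (∀ y ∈ e, R a y) → ∀ z ∈ g, ¬ R b z := by
    intro a ha b hb hab hD z hz hbz
    obtain ⟨z₁, hz₁, hz₁z, -⟩ := exists_third (hcard g hg) z z
    obtain ⟨z₂, hz₂, hz₂z, hz₂₁⟩ := exists_third (hcard g hg) z z₁
    exact hU.not_four he hg hf heg hef hfg.symm hp hq hr hz₁ hz₂ hz ha hb hpq hpr hqr hz₂₁.symm
      hz₁z hz₂z hab (hD' _ hz₁).1 (hD' _ hz₂).2 (hR (hD _ hr)) (hR hbz)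
  have ha' := key b hb a ha hab.symm (fun y hy => (hD y hy).2)
  have hb' := key a ha b hb hab (fun y hy => (hD y hy).1)
  refine (pairCount_le_of_subset ({c} ×ˢ g) ?_).trans ?_
  · intro x hx y hy hxy
    rw [eq_triple (hcard f hf) ha hb hc hab hac hbc] at hx
    simp only [Finset.mem_insert, Finset.mem_singleton] at hx
    rcases hx with rfl | rfl | rfl
    · exact absurd hxy (ha' y hy)
    · exact absurd hxy (hb' y hy)
    · simp [hy]
  · simp [hcard g hg]

/-- In-star: `f` and `g` both dominate `e`. -/
lemma Unaugmentable.pairCount_le_of_in_star {n : ℕ} {M : Finset (Finset (Fin n))}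
    {R : Fin n → Fin n → Prop} (hU : Unaugmentable M R) (hR : ∀ ⦃x y⦄, R x y → R y x)
    (hcard : ∀ e ∈ M, e.card = 3) {e f g : Finset (Fin n)} (he : e ∈ M) (hf : f ∈ M) (hg : g ∈ M)
    (hef : Disjoint e f) (heg : Disjoint e g) (hfg : Disjoint f g)
    (h₁ : Dominates R f e) (h₂ : Dominates R g e) : pairCount R f g ≤ 4 := by
  have key : ∀ f ∈ M, ∀ g ∈ M, Disjoint e f → Disjoint e g → Disjoint f g →
      ∀ a ∈ f, ∀ b ∈ f, ∀ c ∈ f, a ≠ b → a ≠ c → b ≠ c → (∀ y ∈ e, R a y ∧ R b y) →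
      Dominates R g e → ∀ z ∈ g, ¬ R c z := by
    intro f hf g hg hef heg hfg a ha b hb c hc hab hac hbc hD h₂ z hz hcz
    obtain ⟨p, hp, q, hq, r, hr, hpq, hpr, hqr, hD'⟩ := h₂
    obtain ⟨α, hα, heα⟩ := exists_enum (hcard e he)
    have hmem : ∀ i, α i ∈ e := fun i => by simp [heα]
    obtain ⟨x, hx, hxz, hRx⟩ : ∃ x ∈ g, z ≠ x ∧ R x (α 2) := by
      by_cases hzp : z = p
      · exact ⟨q, hq, hzp ▸ hpq, (hD' _ (hmem 2)).2⟩
      · exact ⟨p, hp, hzp, (hD' _ (hmem 2)).1⟩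
    exact hU.not_four hf he hg hef.symm hfg heg ha hb hc (hmem 0) (hmem 1) (hmem 2) hz hx hab hac
      hbc (hα.ne (by decide)) (hα.ne (by decide)) (hα.ne (by decide)) hxz (hD _ (hmem 0)).1
      (hD _ (hmem 1)).2 hcz (hR hRx)
  obtain ⟨a, ha, b, hb, c, hc, hab, hac, hbc, hD⟩ := id h₁
  obtain ⟨p, hp, q, hq, r, hr, hpq, hpr, hqr, hD'⟩ := id h₂
  have hc' := key f hf g hg hef heg hfg a ha b hb c hc hab hac hbc hD h₂
  have hr' := key g hg f hf heg hef hfg.symm p hp q hq r hr hpq hpr hqr hD' h₁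
  refine (pairCount_le_of_subset ({a, b} ×ˢ {p, q}) ?_).trans ?_
  · intro x hx y hy hxy
    have hx' := hx
    have hy' := hy
    rw [eq_triple (hcard f hf) ha hb hc hab hac hbc] at hx'
    rw [eq_triple (hcard g hg) hp hq hr hpq hpr hqr] at hy'
    have hxc : x ≠ c := by
      rintro rfl
      exact hc' y hy hxy
    have hyr : y ≠ r := by
      rintro rfl
      exact hr' x hx (hR hxy)
    simp only [Finset.mem_insert, Finset.mem_singleton, hxc, hyr, or_false] at hx' hy'
    simp [hx', hy']
  · rw [Finset.card_product]
    exact Nat.mul_le_mul Finset.card_le_two Finset.card_le_two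

lemma Unaugmentable.pairCount_le_six {n : ℕ} {M : Finset (Finset (Fin n))}
    {R : Fin n → Fin n → Prop} (hU : Unaugmentable M R) (hR : ∀ ⦃x y⦄, R x y → R y x)
    (hcard : ∀ e ∈ M, e.card = 3) {e f : Finset (Fin n)} (he : e ∈ M) (hf : f ∈ M)
    (hef : Disjoint e f) :
    pairCount R e f ≤ 6 ∧ (pairCount R e f = 6 → Dominates R e f ∨ Dominates R f e) := by
  by_cases h : 6 ≤ pairCount R e f
  · rcases exists_three_or_dominates hR (hcard e he) (hcard f hf) h with
      ⟨x₀, hx₀, x₁, hx₁, x₂, hx₂, y₀, hy₀, y₁, hy₁, y₂, hy₂, h1, h2, h3, h4, h5, h6, h7, h8, h9⟩ |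
      ⟨h6, hdom⟩
    · exact (hU.not_three he hf hef hx₀ hx₁ hx₂ hy₀ hy₁ hy₂ h1 h2 h3 h4 h5 h6 h7 h8 h9).elim
    · exact ⟨h6.le, fun _ => hdom⟩
  · exact ⟨by omega, fun h' => by omega⟩

lemma Unaugmentable.pairCount_le_four {n : ℕ} {M : Finset (Finset (Fin n))}
    {R : Fin n → Fin n → Prop} (hU : Unaugmentable M R) (hR : ∀ ⦃x y⦄, R x y → R y x)
    (hcard : ∀ e ∈ M, e.card = 3) {e f g : Finset (Fin n)} (he : e ∈ M) (hf : f ∈ M) (hg : g ∈ M)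
    (hef : Disjoint e f) (heg : Disjoint e g) (hfg : Disjoint f g)
    (h₁ : pairCount R e f = 6) (h₂ : pairCount R e g = 6) : pairCount R f g ≤ 4 := by
  rcases (hU.pairCount_le_six hR hcard he hf hef).2 h₁ with h₁ | h₁ <;>
    rcases (hU.pairCount_le_six hR hcard he hg heg).2 h₂ with h₂ | h₂
  · exact hU.pairCount_le_of_out_star hR hcard he hf hg hef heg hfg h₁ h₂
  · rw [pairCount_comm hR]
    exact hU.pairCount_le_of_path hR hcard he hg hf heg hef hfg.symm h₂ h₁
  · exact hU.pairCount_le_of_path hR hcard he hf hg hef heg hfg h₁ h₂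
  · exact hU.pairCount_le_of_in_star hR hcard he hf hg hef heg hfg h₁ h₂

/-- The number of ordered `R`-pairs inside the cover. -/
lemma Unaugmentable.sum_pairCount_le {n : ℕ} {M : Finset (Finset (Fin n))}
    {R : Fin n → Fin n → Prop} (hU : Unaugmentable M R) (hR : ∀ ⦃x y⦄, R x y → R y x)
    (hcard : ∀ e ∈ M, e.card = 3) (hdisj : ∀ e ∈ M, ∀ f ∈ M, e ≠ f → Disjoint e f) :
    ∑ e ∈ M, ∑ f ∈ M, pairCount R e f ≤ 5 * M.card ^ 2 + 5 * M.card := by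
  set s : M → M → ℤ := fun e f => if e = f then -1 else (pairCount R e f : ℤ) - 5 with hs
  have hdisj' : ∀ e f : M, e ≠ f → Disjoint (e : Finset (Fin n)) f :=
    fun e f hne => hdisj e e.2 f f.2 fun h => hne (Subtype.ext h)
  have hone : ∀ e f, s e f = 1 → e ≠ f ∧ pairCount R (e : Finset (Fin n)) f = 6 := by
    intro e f h
    simp only [hs] at h
    split_ifs at h with hef
    exact ⟨hef, by omega⟩
  have hnonpos : ∑ e, ∑ f, s e f ≤ 0 := by
    refine sum_matrix_nonpos s ?_ ?_ ?_
    · intro e f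
      simp only [hs, pairCount_comm hR (e : Finset (Fin n)) f, eq_comm (a := e)]
    · intro e f
      simp only [hs]
      split_ifs with hef
      · norm_num
      · have := (hU.pairCount_le_six hR hcard e.2 f.2 (hdisj' e f hef)).1
        omega
    · intro e f g hef heg
      obtain ⟨hef, h1⟩ := hone e f hef
      obtain ⟨heg, h2⟩ := hone e g heg
      simp only [hs]
      split_ifs with hfg
      · norm_num
      · have := hU.pairCount_le_four hR hcard e.2 f.2 g.2 (hdisj' e f hef) (hdisj' e g heg)
          (hdisj' f g hfg) h1 h2
        omega
  have hterm : ∀ e f : M, (pairCount R (e : Finset (Fin n)) f : ℤ) ≤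
      s e f + (5 + if e = f then 5 else 0) := by
    intro e f
    simp only [hs]
    split_ifs with hef
    · have := pairCount_le_of_subset (R := R) ((e : Finset (Fin n)) ×ˢ (f : Finset (Fin n)))
        (fun x hx y hy _ => Finset.mem_product.2 ⟨hx, hy⟩)
      rw [Finset.card_product, hcard e e.2, hcard f f.2] at this
      omega
    · omega
  have hsum : ∑ e : M, ∑ f : M, (pairCount R (e : Finset (Fin n)) f : ℤ) ≤
      ∑ e, ∑ f, s e f + (5 * M.card ^ 2 + 5 * M.card) := by
    refine (Finset.sum_le_sum fun e _ => Finset.sum_le_sum fun f _ => hterm e f).trans (le_of_eq ?_)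
    simp only [Finset.sum_add_distrib, Finset.sum_ite_eq, Finset.mem_univ, if_true,
      Finset.sum_const, Finset.card_univ, Fintype.card_coe, nsmul_eq_mul]
    ring
  have hcoe : ∑ e ∈ M, ∑ f ∈ M, pairCount R e f =
      ∑ e : M, ∑ f : M, pairCount R (e : Finset (Fin n)) f := by
    rw [← Finset.sum_coe_sort M]
    exact Finset.sum_congr rfl fun e _ => (Finset.sum_coe_sort M _).symm
  rw [hcoe]
  zify
  linarith

lemma Unaugmentable.pairCount_leave_le {n : ℕ} {M : Finset (Finset (Fin n))}
    {R : Fin n → Fin n → Prop} (hU : Unaugmentable M R)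
    (hcard : ∀ e ∈ M, e.card = 3) {e : Finset (Fin n)} (he : e ∈ M) :
    pairCount R e (leave M) ≤ (leave M).card + 3 := by
  by_cases h : ∃ x ∈ e, ∃ y ∈ leave M, R x y
  · obtain ⟨x, hx, y, hy, hxy⟩ := h
    refine (pairCount_le_of_subset ({x} ×ˢ leave M ∪ e ×ˢ {y}) ?_).trans ?_
    · intro x' hx' y' hy' hxy'
      simp only [Finset.mem_union, Finset.mem_product, Finset.mem_singleton]
      by_contra! hcon
      exact hU.not_two he hx hx' hy hy' (fun h => hcon.1 h.symm hy')
        (fun h => hcon.2 hx' h.symm) hxy hxy'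
    · refine (Finset.card_union_le _ _).trans ?_
      simp [hcard e he]
  · push Not at h
    exact (pairCount_le_of_subset ∅ fun x hx y hy hxy => absurd hxy (h x hx y hy)).trans (by simp)

lemma pairCount_union_left {n : ℕ} (R : Fin n → Fin n → Prop) {A A' : Finset (Fin n)}
    (h : Disjoint A A') (B : Finset (Fin n)) :
    pairCount R (A ∪ A') B = pairCount R A B + pairCount R A' B :=
  Finset.sum_union h

lemma pairCount_cover_left {n : ℕ} (R : Fin n → Fin n → Prop) {M : Finset (Finset (Fin n))}
    (hdisj : ∀ e ∈ M, ∀ f ∈ M, e ≠ f → Disjoint e f) (B : Finset (Fin n)) :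
    pairCount R (cover M) B = ∑ e ∈ M, pairCount R e B :=
  Finset.sum_biUnion hdisj

/-- An unaugmentable symmetric relation has at most about `5 / 9 * n ^ 2` ordered pairs. -/
lemma Unaugmentable.pairCount_univ_le {n : ℕ} {M : Finset (Finset (Fin n))}
    {R : Fin n → Fin n → Prop} (hU : Unaugmentable M R) (hR : ∀ ⦃x y⦄, R x y → R y x)
    (hcard : ∀ e ∈ M, e.card = 3) (hdisj : ∀ e ∈ M, ∀ f ∈ M, e ≠ f → Disjoint e f) :
    9 * pairCount R univ univ ≤ 5 * n ^ 2 + 33 * n := by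
  have hCL : Disjoint (cover M) (leave M) := Finset.disjoint_sdiff
  have huniv : (univ : Finset (Fin n)) = cover M ∪ leave M := by simp [leave]
  have hcover : (cover M).card = 3 * M.card := by
    rw [cover, Finset.card_biUnion (t := id) hdisj, mul_comm]
    exact Finset.sum_const_nat hcard
  have hn : 3 * M.card + (leave M).card = n := by
    rw [← hcover, ← Finset.card_union_of_disjoint hCL, ← huniv, Finset.card_univ, Fintype.card_fin]
  have hLL : pairCount R (leave M) (leave M) = 0 :=
    Nat.le_zero.1 (pairCount_le_of_subset ∅ fun x hx y hy hxy =>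
      absurd hxy (hU.not_leave hx hy))
  have hMM : pairCount R (cover M) (cover M) ≤ 5 * M.card ^ 2 + 5 * M.card := by
    rw [pairCount_cover_left R hdisj]
    refine (Finset.sum_le_sum fun e _ => le_of_eq ?_).trans (hU.sum_pairCount_le hR hcard hdisj)
    rw [pairCount_comm hR, pairCount_cover_left R hdisj]
    exact Finset.sum_congr rfl fun f _ => pairCount_comm hR _ _
  have hML : pairCount R (cover M) (leave M) ≤ M.card * ((leave M).card + 3) := by
    rw [pairCount_cover_left R hdisj]
    exact Finset.sum_le_card_nsmul _ _ _ fun e he => hU.pairCount_leave_le hcard he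
  have htotal : pairCount R univ univ = pairCount R (cover M) (cover M) +
      2 * pairCount R (cover M) (leave M) + pairCount R (leave M) (leave M) := by
    rw [huniv, pairCount_union_left R hCL, pairCount_comm hR (cover M),
      pairCount_comm hR (leave M), pairCount_union_left R hCL, pairCount_union_left R hCL,
      pairCount_comm hR (leave M) (cover M)]
    ring
  rw [htotal, hLL]
  have hsq : n ^ 2 = (3 * M.card + (leave M).card) ^ 2 := by rw [hn]
  rw [hsq]
  nlinarith [Nat.zero_le (M.card * (leave M).card), Nat.zero_le ((leave M).card ^ 2)]

/-- The degree of `v` counts the pairs that extend `v` to an edge. -/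
lemma deg_eq_card_pairs {n : ℕ} {H : Finset (Finset (Fin n))} (h3 : Is3Graph n H) (v : Fin n) :
    deg H v = ((powersetCard 2 univ).filter fun s => v ∉ s ∧ insert v s ∈ H).card := by
  refine Finset.card_bij' (fun e _ => e.erase v) (fun s _ => insert v s) ?_ ?_ ?_ ?_
  · intro e he
    rw [Finset.mem_filter] at he
    simp [Finset.mem_powersetCard, Finset.card_erase_of_mem he.2, h3 e he.1,
      Finset.insert_erase he.2, he.1]
  · intro s hs
    rw [Finset.mem_filter] at hs
    simp [hs.2.2]
  · intro e he
    exact Finset.insert_erase (Finset.mem_filter.1 he).2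
  · intro s hs
    exact Finset.erase_insert (Finset.mem_filter.1 hs).2.1

lemma sum_deg_le {n : ℕ} {H : Finset (Finset (Fin n))} (h3 : Is3Graph n H)
    (B : Finset (Fin n)) :
    ∑ v ∈ B, deg H v ≤
      B.card * ((powersetCard 2 univ).filter (IsGood H B)).card + 11 * n.choose 2 := by
  have hswap : ∑ v ∈ B, deg H v =
      ∑ s ∈ powersetCard 2 univ, (B.filter fun v => v ∉ s ∧ insert v s ∈ H).card := by
    simp only [deg_eq_card_pairs h3, Finset.card_filter]
    exact Finset.sum_comm
  have hchoose : n.choose 2 = (powersetCard 2 (univ : Finset (Fin n))).card := by simp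
  rw [hswap, hchoose, Finset.card_filter, Finset.mul_sum, mul_comm 11, ← smul_eq_mul,
    ← Finset.sum_const, ← Finset.sum_add_distrib]
  refine Finset.sum_le_sum fun s hs => ?_
  have hle := Finset.card_filter_le B fun v => v ∉ s ∧ insert v s ∈ H
  split_ifs with hgood
  · omega
  · have : ¬ 12 ≤ (B.filter fun v => v ∉ s ∧ insert v s ∈ H).card :=
      fun h => hgood ⟨(Finset.mem_powersetCard.1 hs).2, h⟩
    omega

lemma two_mul_card_good_le {n : ℕ} (H : Finset (Finset (Fin n))) (B : Finset (Fin n)) :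
    2 * ((powersetCard 2 univ).filter (IsGood H B)).card ≤
      pairCount (fun x y => IsGood H B {x, y}) univ univ := by
  rw [pairCount_eq_card]
  refine Finset.mul_card_image_le_card_of_maps_to
    (f := fun p : Fin n × Fin n => ({p.1, p.2} : Finset (Fin n))) ?_ 2 ?_
  · intro p hp
    have hgood : IsGood H B {p.1, p.2} := (Finset.mem_filter.1 hp).2
    exact Finset.mem_filter.2 ⟨by simp [Finset.mem_powersetCard, hgood.1], hgood⟩
  · intro s hs
    have hgood : IsGood H B s := (Finset.mem_filter.1 hs).2
    obtain ⟨x, y, hxy, rfl⟩ := Finset.card_eq_two.1 hgood.1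
    have hne : (x, y) ≠ (y, x) := fun h => hxy (Prod.ext_iff.1 h).1
    rw [← Finset.card_pair hne]
    refine Finset.card_le_card ?_
    simp [Finset.insert_subset_iff, hgood, Finset.pair_comm y x]

/-- Lemma `largermatchlem`: for `γ > 0` and `n` sufficiently large, if `H` is a `3`-graph
on `n` vertices satisfying the degree sequence condition (for some `t` with
`1 ≤ t ≤ n/(3√2)`), and `M` is a matching in `H` with `|M| < ⌊(n − γn)/3⌋` and
`|L(M) ∩ V_{5/9}| > 2γn/75`, then there is a matching `M*` with `|M*| ≥ |M| + 1`. -/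
theorem larger_matching (γ : ℝ) (hγ : 0 < γ) :
    ∃ n₀ : ℕ, ∀ n : ℕ, n₀ ≤ n →
      ∀ t : ℕ, 1 ≤ t → (t : ℝ) ≤ (n : ℝ) / (3 * Real.sqrt 2) →
      ∀ H : Finset (Finset (Fin n)), Is3Graph n H →
      (∃ σ : Fin n ≃ Fin n, DegSeq4 γ t H σ) →
      ∀ M : Finset (Finset (Fin n)), IsMatching H M →
        M.card < ⌊((n : ℝ) - γ * n) / 3⌋₊ →
        2 * γ * n / 75 < ((leave M ∩ V59 γ H).card : ℝ) →
        ∃ Mstar, IsMatching H Mstar ∧ M.card + 1 ≤ Mstar.card := by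
  refine ⟨⌈825 / γ ^ 2 + 9 / γ + 2⌉₊, ?_⟩
  intro n hn t _ _ H h3 _ M hM _ hleave
  by_contra! hno
  have hmax : ∀ N, IsMatching H N → N.card ≤ M.card := fun N hN => by
    have := hno N hN
    omega
  set B := leave M ∩ V59 γ H with hB
  have hU := unaugmentable_of_maximum (B := B) h3 hM Finset.inter_subset_left hmax
  have hR : ∀ ⦃x y : Fin n⦄, IsGood H B {x, y} → IsGood H B {y, x} := fun x y h => by
    rwa [Finset.pair_comm]
  have hupper := hU.pairCount_univ_le hR (fun e he => h3 e (hM.1 he)) hM.2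
  have hgood := two_mul_card_good_le H B
  have hdeg := sum_deg_le h3 B
  set G := ((powersetCard 2 univ).filter (IsGood H B)).card
  have hG : (18 : ℝ) * G ≤ 5 * n ^ 2 + 33 * n := by
    have : 18 * G ≤ 5 * n ^ 2 + 33 * n := by omega
    exact_mod_cast this
  have hlower : (B.card : ℝ) * ((5 / 9 + γ) * n.choose 2) ≤ B.card * G + 11 * n.choose 2 := by
    have h1 : (B.card : ℝ) * ((5 / 9 + γ) * n.choose 2) ≤ ∑ v ∈ B, (deg H v : ℝ) := by
      rw [← nsmul_eq_mul]
      refine Finset.card_nsmul_le_sum _ _ _ fun v hv => ?_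
      exact (Finset.mem_filter.1 (Finset.mem_inter.1 hv).2).2
    exact h1.trans (by exact_mod_cast hdeg)
  have hn' : 825 / γ ^ 2 + 9 / γ + 2 ≤ (n : ℝ) := Nat.ceil_le.1 hn
  have h825 : 825 ≤ γ ^ 2 * n := by
    have : 825 / γ ^ 2 ≤ (n : ℝ) := by
      have : 0 < 9 / γ := by positivity
      linarith
    rwa [div_le_iff₀ (by positivity), mul_comm] at this
  have h9 : 9 ≤ γ * (n - 1) := by
    have : 9 / γ ≤ (n : ℝ) - 1 := by
      have : 0 < 825 / γ ^ 2 := by positivity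
      linarith
    rwa [div_le_iff₀ hγ, mul_comm] at this
  have hn0 : (0 : ℝ) < n := by
    have : 0 < 825 / γ ^ 2 + 9 / γ + 2 := by positivity
    linarith
  have hBγ : 22 ≤ B.card * γ := by nlinarith
  have hBpos : (0 : ℝ) < B.card := by
    have : 0 < 2 * γ * n / 75 := by positivity
    linarith
  have hC : (0 : ℝ) ≤ n.choose 2 := Nat.cast_nonneg _
  have hGlower : (5 / 9 + γ / 2) * n.choose 2 ≤ (G : ℝ) := by
    refine le_of_mul_le_mul_left ?_ hBpos
    nlinarith [mul_le_mul_of_nonneg_right hBγ hC]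
  rw [Nat.cast_choose_two] at hGlower
  nlinarith [mul_le_mul_of_nonneg_left h9 hn0.le]
end
end

section
/- Let γ > 0 and let H be a 3-graph on n vertices (n sufficiently large in terms of γ) with degree sequence d₁ ≤ … ≤ dₙ such that, for some t with 1 ≤ t ≤ n/(3√2), dᵢ ≥ (1/3 + 4γ)·C(n,2) + i·t for 1 ≤ i ≤ t, dᵢ ≥ (4/9 + 4γ)·C(n,2) for t < i ≤ n/3, and dᵢ ≥ (5/9 + 4γ)·C(n,2) for i > n/3. Let M be a matching of H with |M| ≤ ⌊(n − γn)/3⌋. Then there exists a matching N in H such that |N| ≥ |M| and |L(N) ∩ V_{5/9}| > 2γn/75. -/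
open Finset
open scoped Classical

noncomputable section

/-- The indicator that `{v, x, y}` is an edge. -/
def link {n : ℕ} (H : Finset (Finset (Fin n))) (v x y : Fin n) : ℕ :=
  if ({v, x, y} : Finset (Fin n)) ∈ H then 1 else 0

/-- The total weight of the vertices in the edges of `M`. -/
def weight {n : ℕ} (φ : Fin n → ℕ) (M : Finset (Finset (Fin n))) : ℕ :=
  ∑ e ∈ M, ∑ x ∈ e, φ x

/-- `M` has the least weight among all matchings of the same size. -/
def IsMinMatching {n : ℕ} (φ : Fin n → ℕ) (H M : Finset (Finset (Fin n))) : Prop :=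
  IsMatching H M ∧ ∀ N, IsMatching H N → N.card = M.card → weight φ M ≤ weight φ N

section

variable {n : ℕ} {H M : Finset (Finset (Fin n))} {φ : Fin n → ℕ}

theorem link_le_one (v x y : Fin n) : link H v x y ≤ 1 := by
  unfold link; split_ifs <;> simp

theorem link_comm (v x y : Fin n) : link H v x y = link H v y x := by
  unfold link; rw [Finset.pair_comm]

theorem two_mul_deg_le (h3 : Is3Graph n H) (v : Fin n) :
    2 * deg H v ≤ ∑ x, ∑ y, link H v x y := by
  have h1 : ∑ x, ∑ y, link H v x y =
      ((univ : Finset (Fin n × Fin n)).filter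
        fun p => ({v, p.1, p.2} : Finset (Fin n)) ∈ H).card := by
    rw [Finset.card_filter, ← Finset.univ_product_univ, Finset.sum_product]
    rfl
  rw [h1, deg, mul_comm]
  rw [Finset.card_eq_sum_card_fiberwise (f := fun p : Fin n × Fin n => ({v, p.1, p.2} : Finset _))
    (t := H.filter fun e => v ∈ e) (by intro p hp; simpa using hp), ← smul_eq_mul]
  refine Finset.card_nsmul_le_sum _ _ _ fun e he => ?_
  rw [mem_filter] at he
  have hc : (e.erase v).card = 2 := by rw [card_erase_of_mem he.2, h3 e he.1]
  obtain ⟨x, y, hxy, hexy⟩ := card_eq_two.1 hc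
  have he' : e = {v, x, y} := by rw [← insert_erase he.2, hexy]
  have he'' : e = {v, y, x} := by rw [he', Finset.pair_comm]
  rw [← Finset.card_pair (a := (x, y)) (b := (y, x)) (by simp [hxy])]
  refine Finset.card_le_card fun p hp => ?_
  have hH := he.1
  rcases mem_insert.1 hp with rfl | hp
  · simp only [mem_filter, mem_univ, true_and]
    exact ⟨he' ▸ hH, he'.symm⟩
  · rw [mem_singleton] at hp
    subst hp
    simp only [mem_filter, mem_univ, true_and]
    exact ⟨he'' ▸ hH, he''.symm⟩

theorem IsMinMatching.swap (h3 : Is3Graph n H) (hM : IsMinMatching φ H M)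
    {R A : Finset (Finset (Fin n))} (hR : R ⊆ M) (hA : A ⊆ H) (hc : A.card = R.card)
    (hAA : ∀ a ∈ A, ∀ b ∈ A, a ≠ b → Disjoint a b)
    (hAM : ∀ a ∈ A, ∀ e ∈ M, e ∉ R → Disjoint a e) :
    weight φ R ≤ weight φ A := by
  have hd : Disjoint (M \ R) A := by
    rw [Finset.disjoint_left]
    intro e he hea
    rw [mem_sdiff] at he
    have := hAM e hea e he.1 he.2
    rw [disjoint_self] at this
    have h := h3 e (hA hea)
    simp [this] at h
  have hcR := Finset.card_sdiff_add_card_eq_card hR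
  have hmin := hM.2 ((M \ R) ∪ A) ⟨?_, ?_⟩ ?_
  · have h1 : weight φ (M \ R ∪ A) = weight φ (M \ R) + weight φ A := Finset.sum_union hd
    have h2 : weight φ (M \ R) + weight φ R = weight φ M := Finset.sum_sdiff hR
    omega
  · exact union_subset (sdiff_subset.trans hM.1.1) hA
  · intro e he f hf hef
    rw [mem_union, mem_sdiff] at he hf
    rcases he with he | he <;> rcases hf with hf | hf
    · exact hM.1.2 e he.1 f hf.1 hef
    · exact (hAM f hf e he.1 he.2).symm
    · exact hAM e he f hf.1 hf.2
    · exact hAA e he f hf hef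
  · rw [card_union_of_disjoint hd]; omega

theorem IsMatching.eq_of_mem (hM : IsMatching H M) {e f : Finset (Fin n)} {x : Fin n}
    (he : e ∈ M) (hf : f ∈ M) (hxe : x ∈ e) (hxf : x ∈ f) : e = f := by
  by_contra h
  exact Finset.disjoint_left.1 (hM.2 e he f hf h) hxe hxf

theorem mem_leave {x : Fin n} : x ∈ leave M ↔ ∀ e ∈ M, x ∉ e := by
  simp [leave, cover]

theorem sum_cover (hM : IsMatching H M) (F : Fin n → ℕ) :
    ∑ x ∈ cover M, F x = ∑ e ∈ M, ∑ x ∈ e, F x :=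
  Finset.sum_biUnion fun e he f hf hef => hM.2 e he f hf hef

theorem bool_toNat_add_le :
    ∀ a₀ a₁ a₂ b₀ b₁ b₂ c₀ c₁ c₂ g₀ g₁ g₂ : Bool,
      (a₀ && b₁ || a₁ && b₀ || a₀ && c₁ || a₁ && c₀ || b₀ && c₁ || b₁ && c₀) ≤ g₂ →
      (a₀ && b₂ || a₂ && b₀ || a₀ && c₂ || a₂ && c₀ || b₀ && c₂ || b₂ && c₀) ≤ g₁ →
      (a₁ && b₂ || a₂ && b₁ || a₁ && c₂ || a₂ && c₁ || b₁ && c₂ || b₂ && c₁) ≤ g₀ →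
      a₀.toNat + a₁.toNat + a₂.toNat + (b₀.toNat + b₁.toNat + b₂.toNat) +
        (c₀.toNat + c₁.toNat + c₂.toNat) ≤ 3 + 3 * (g₀.toNat + g₁.toNat + g₂.toNat) := by
  decide

/-- In a perfect matching of `K_{3,3}`, take three families such that any two distinct edges
from different families force the remaining edge into `G`. -/
theorem card_add_card_add_card_le (A B C G : Finset (Fin 3))
    (h : ∀ p q r : Fin 3, p ≠ q → r ≠ p → r ≠ q →
      (p ∈ A ∧ q ∈ B ∨ p ∈ A ∧ q ∈ C ∨ p ∈ B ∧ q ∈ C) → r ∈ G) :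
    A.card + B.card + C.card ≤ 3 + 3 * G.card := by
  have key (S : Finset (Fin 3)) : S.card = (decide (0 ∈ S)).toNat + (decide (1 ∈ S)).toNat +
      (decide (2 ∈ S)).toNat := by
    revert S; decide
  have h₁ := h 0 1 2 (by decide) (by decide) (by decide)
  have h₂ := h 1 0 2 (by decide) (by decide) (by decide)
  have h₃ := h 0 2 1 (by decide) (by decide) (by decide)
  have h₄ := h 2 0 1 (by decide) (by decide) (by decide)
  have h₅ := h 1 2 0 (by decide) (by decide) (by decide)
  have h₆ := h 2 1 0 (by decide) (by decide) (by decide)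
  rw [key A, key B, key C, key G]
  apply bool_toNat_add_le <;>
    simp only [Bool.le_iff_imp, Bool.or_eq_true, Bool.and_eq_true, decide_eq_true_eq]
  · clear h₃ h₄ h₅ h₆; tauto
  · clear h₁ h₂ h₅ h₆; tauto
  · clear h₁ h₂ h₃ h₄; tauto

theorem sum_mul_sum_le {e f : Finset (Fin n)} (he : e.card = 3) (hf : f.card = 3)
    (A B C G : Fin n → Fin n → Prop) [∀ x y, Decidable (A x y)] [∀ x y, Decidable (B x y)]
    [∀ x y, Decidable (C x y)] [∀ x y, Decidable (G x y)]
    (h : ∀ x ∈ e, ∀ x' ∈ e, ∀ x'' ∈ e, ∀ y ∈ f, ∀ y' ∈ f, ∀ y'' ∈ f,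
      x ≠ x' → x'' ≠ x → x'' ≠ x' → y ≠ y' → y'' ≠ y → y'' ≠ y' →
      (A x y ∧ B x' y' ∨ A x y ∧ C x' y' ∨ B x y ∧ C x' y') → G x'' y'') :
    ∑ x ∈ e, ∑ y ∈ f, ((if A x y then 1 else 0) + (if B x y then 1 else 0) +
      (if C x y then 1 else 0)) ≤ 9 + 3 * ∑ x ∈ e, ∑ y ∈ f, if G x y then 1 else 0 := by
  obtain ⟨p⟩ : Nonempty (Fin 3 ≃ e) := ⟨(Fintype.equivFinOfCardEq (by simpa using he)).symm⟩
  obtain ⟨q⟩ : Nonempty (Fin 3 ≃ f) := ⟨(Fintype.equivFinOfCardEq (by simpa using hf)).symm⟩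
  have key (F : Fin n → Fin n → ℕ) : ∑ x ∈ e, ∑ y ∈ f, F x y =
      ∑ k : Fin 3, ∑ i : Fin 3, F (p i) (q (i + k)) := by
    have h1 : ∑ x ∈ e, ∑ y ∈ f, F x y = ∑ i : Fin 3, ∑ j : Fin 3, F (p i) (q j) := by
      rw [← Finset.sum_coe_sort e, ← p.sum_comp]
      refine Finset.sum_congr rfl fun i _ => ?_
      rw [← Finset.sum_coe_sort f, ← q.sum_comp]
    rw [h1, Finset.sum_comm (s := univ (α := Fin 3)) (t := univ (α := Fin 3))
      (f := fun k i => F (p i) (q (i + k)))]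
    refine Finset.sum_congr rfl fun i _ => ?_
    exact (Equiv.sum_comp (Equiv.addLeft i) fun k => F (p i) (q k)).symm
  rw [key, key, Finset.mul_sum]
  have hk (k : Fin 3) := card_add_card_add_card_le
    (univ.filter fun i => A (p i) (q (i + k))) (univ.filter fun i => B (p i) (q (i + k)))
    (univ.filter fun i => C (p i) (q (i + k))) (univ.filter fun i => G (p i) (q (i + k))) (by
      intro i j l hij hli hlj hh
      simp only [mem_filter, mem_univ, true_and] at hh ⊢
      have hp {a b : Fin 3} (hab : a ≠ b) : (p a : Fin n) ≠ p b := by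
        simpa [Subtype.coe_inj] using hab
      have hq {a b : Fin 3} (hab : a ≠ b) : (q (a + k) : Fin n) ≠ q (b + k) := by
        simpa [Subtype.coe_inj] using hab
      exact h _ (p i).2 _ (p j).2 _ (p l).2 _ (q _).2 _ (q _).2 _ (q _).2
        (hp hij) (hp hli) (hp hlj) (hq hij) (hq hli) (hq hlj) hh)
  calc _ ≤ ∑ k : Fin 3, (3 + 3 * ∑ i : Fin 3, if G (p i) (q (i + k)) then 1 else 0) := by
        refine Finset.sum_le_sum fun k _ => ?_
        simpa only [Finset.sum_add_distrib, Finset.card_filter] using hk k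
    _ = _ := by rw [Finset.sum_add_distrib]; simp

theorem sum_triple_le (φ : Fin n → ℕ) (x y z : Fin n) :
    ∑ a ∈ ({x, y, z} : Finset (Fin n)), φ a ≤ φ x + φ y + φ z := by
  have h (a : Fin n) (s : Finset (Fin n)) : ∑ b ∈ insert a s, φ b ≤ φ a + ∑ b ∈ s, φ b := by
    by_cases ha : a ∈ s
    · rw [insert_eq_of_mem ha]; omega
    · rw [sum_insert ha]
  have h₁ := h x {y, z}
  have h₂ := h y {z}
  rw [sum_singleton] at h₂
  omega

theorem IsMinMatching.sum_le_of_inter (h3 : Is3Graph n H) (hM : IsMinMatching φ H M)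
    {e : Finset (Fin n)} (he : e ∈ M) {x y z : Fin n} (hxyz : {x, y, z} ∈ H)
    (hx : x ∈ leave M ∨ x ∈ e) (hy : y ∈ leave M ∨ y ∈ e) (hz : z ∈ leave M ∨ z ∈ e) :
    ∑ a ∈ e, φ a ≤ φ x + φ y + φ z := by
  have hd {u : Fin n} (hu : u ∈ leave M ∨ u ∈ e) {f : Finset (Fin n)} (hf : f ∈ M)
      (hfe : f ≠ e) : u ∉ f := by
    rcases hu with hu | hu
    · exact mem_leave.1 hu f hf
    · exact fun huf => hfe (hM.1.eq_of_mem hf he huf hu)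
  have := hM.swap h3 (R := {e}) (A := {{x, y, z}}) (by simpa) (by simpa) (by simp)
    (by simp) (by
      intro a ha f hf hfe
      rw [mem_singleton] at ha hfe
      subst ha
      simp [hd hx hf hfe, hd hy hf hfe, hd hz hf hfe])
  simp only [weight, sum_singleton] at this
  exact this.trans (sum_triple_le φ x y z)

theorem IsMinMatching.sum_add_sum_le (h3 : Is3Graph n H) (hM : IsMinMatching φ H M)
    {e f : Finset (Fin n)} (he : e ∈ M) (hf : f ∈ M) (hef : e ≠ f)
    {v v' x x' y y' : Fin n} (hv : v ∈ leave M) (hv' : v' ∈ leave M) (hvv : v ≠ v')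
    (hx : x ∈ e) (hx' : x' ∈ e) (hxx : x ≠ x') (hy : y ∈ f) (hy' : y' ∈ f) (hyy : y ≠ y')
    (h : {v, x, y} ∈ H) (h' : {v', x', y'} ∈ H) :
    ∑ a ∈ e, φ a + ∑ a ∈ f, φ a ≤ (φ v + φ x + φ y) + (φ v' + φ x' + φ y') := by
  have hxy {a b : Fin n} (ha : a ∈ e) (hb : b ∈ f) : a ≠ b := fun hab =>
    hef (hM.1.eq_of_mem he hf ha (hab ▸ hb))
  have hvm {u a : Fin n} (hu : u ∈ leave M) {g : Finset (Fin n)} (hg : g ∈ M) (ha : a ∈ g) :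
      u ≠ a := fun hua => mem_leave.1 hu g hg (hua ▸ ha)
  have hdis : Disjoint ({v, x, y} : Finset (Fin n)) {v', x', y'} := by
    have := hvm hv he hx'
    have := hvm hv hf hy'
    have := hvm hv' he hx
    have := hvm hv' hf hy
    have := hxy hx hy'
    have := hxy hx' hy
    simp only [Finset.disjoint_left, mem_insert, mem_singleton]
    grind
  have hne : ({v, x, y} : Finset (Fin n)) ≠ {v', x', y'} := by
    intro hh
    rw [hh, disjoint_self] at hdis
    simp at hdis
  have hd {a b c : Fin n} (ha : a ∈ leave M) (hb : b ∈ e) (hc : c ∈ f) {g : Finset (Fin n)}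
      (hg : g ∈ M) (hge : g ≠ e) (hgf : g ≠ f) : Disjoint ({a, b, c} : Finset (Fin n)) g := by
    have h₁ := mem_leave.1 ha g hg
    have h₂ : b ∉ g := fun hbg => hge (hM.1.eq_of_mem hg he hbg hb)
    have h₃ : c ∉ g := fun hcg => hgf (hM.1.eq_of_mem hg hf hcg hc)
    simp [h₁, h₂, h₃]
  have := hM.swap h3 (R := {e, f}) (A := {{v, x, y}, {v', x', y'}})
    (by simp [insert_subset_iff, he, hf]) (by simp [insert_subset_iff, h, h'])
    (by rw [card_pair hef, card_pair hne])
    (by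
      intro a ha b hb hab
      simp only [mem_insert, mem_singleton] at ha hb
      rcases ha with rfl | rfl <;> rcases hb with rfl | rfl
      · exact absurd rfl hab
      · exact hdis
      · exact hdis.symm
      · exact absurd rfl hab)
    (by
      intro a ha g hg hgR
      simp only [mem_insert, mem_singleton, not_or] at ha hgR
      rcases ha with rfl | rfl
      · exact hd hv hx hy hg hgR.1 hgR.2
      · exact hd hv' hx' hy' hg hgR.1 hgR.2)
  simp only [weight] at this
  rw [sum_pair hef, sum_pair hne] at this
  exact this.trans (add_le_add (sum_triple_le φ v x y) (sum_triple_le φ v' x' y'))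

theorem sum_eq_of_card_eq_three {e : Finset (Fin n)} (he : e.card = 3) {x y z : Fin n}
    (hx : x ∈ e) (hy : y ∈ e) (hz : z ∈ e) (hxy : x ≠ y) (hzx : z ≠ x) (hzy : z ≠ y)
    (φ : Fin n → ℕ) : ∑ a ∈ e, φ a = φ x + φ y + φ z := by
  have : ({x, y, z} : Finset (Fin n)) = e := by
    apply Finset.eq_of_subset_of_card_le
    · simp [insert_subset_iff, hx, hy, hz]
    · rw [he, card_eq_three.2 ⟨x, y, z, hxy, hzx.symm, hzy.symm, rfl⟩]
  rw [← this, sum_insert (by simp [hxy, hzx.symm]), sum_pair hzy.symm]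
  ring

/-- Pairs of covered vertices in the links of three uncovered vertices. -/
theorem IsMinMatching.sum_cover_link_le (h3 : Is3Graph n H) (hM : IsMinMatching φ H M)
    {u v w : Fin n} (hu : u ∈ leave M) (hv : v ∈ leave M) (hw : w ∈ leave M)
    (huv : u ≠ v) (huw : u ≠ w) (hvw : v ≠ w) {T : ℕ}
    (hT : φ u + φ v ≤ T ∧ φ u + φ w ≤ T ∧ φ v + φ w ≤ T) :
    ∑ x ∈ cover M, ∑ y ∈ cover M, (link H u x y + link H v x y + link H w x y) ≤
      27 * M.card + 9 * M.card ^ 2 +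
        3 * ∑ x ∈ cover M, ∑ y ∈ cover M, if φ x + φ y ≤ T then 1 else 0 := by
  have hcov (F : Fin n → Fin n → ℕ) : ∑ x ∈ cover M, ∑ y ∈ cover M, F x y =
      ∑ e ∈ M, ∑ f ∈ M, ∑ x ∈ e, ∑ y ∈ f, F x y := by
    rw [sum_cover hM.1]
    refine Finset.sum_congr rfl fun e _ => ?_
    rw [Finset.sum_comm]
    simp_rw [sum_cover hM.1]
    refine Finset.sum_congr rfl fun f _ => ?_
    rw [Finset.sum_comm]
  rw [hcov, hcov]
  have hpair : ∀ e ∈ M, ∀ f ∈ M,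
      ∑ x ∈ e, ∑ y ∈ f, (link H u x y + link H v x y + link H w x y) ≤
        (if e = f then 27 else 0) + 9 +
          3 * ∑ x ∈ e, ∑ y ∈ f, if φ x + φ y ≤ T then 1 else 0 := by
    intro e he f hf
    have hce := h3 e (hM.1.1 he)
    have hcf := h3 f (hM.1.1 hf)
    by_cases hef : e = f
    · rw [if_pos hef]
      calc _ ≤ ∑ x ∈ e, ∑ y ∈ f, 3 := by
            refine Finset.sum_le_sum fun x _ => Finset.sum_le_sum fun y _ => ?_
            linarith [link_le_one (H := H) u x y, link_le_one (H := H) v x y,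
              link_le_one (H := H) w x y]
        _ = 27 := by simp [hce, hcf]
        _ ≤ _ := by omega
    · rw [if_neg hef, zero_add]
      have hK := sum_mul_sum_le hce hcf (fun x y => {u, x, y} ∈ H) (fun x y => {v, x, y} ∈ H)
        (fun x y => {w, x, y} ∈ H) (fun x y => φ x + φ y ≤ T)
      refine hK ?_
      clear hK
      intro x hx x' hx' x'' hx'' y hy y' hy' y'' hy'' hxx hxx₁ hxx₂ hyy hyy₁ hyy₂ h
      have h₁ := sum_eq_of_card_eq_three hce hx hx' hx'' hxx hxx₁ hxx₂ φ
      have h₂ := sum_eq_of_card_eq_three hcf hy hy' hy'' hyy hyy₁ hyy₂ φ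
      rcases h with h | h | h
      · have := hM.sum_add_sum_le h3 he hf hef hu hv huv hx hx' hxx hy hy' hyy h.1 h.2
        omega
      · have := hM.sum_add_sum_le h3 he hf hef hu hw huw hx hx' hxx hy hy' hyy h.1 h.2
        omega
      · have := hM.sum_add_sum_le h3 he hf hef hv hw hvw hx hx' hxx hy hy' hyy h.1 h.2
        omega
  refine (Finset.sum_le_sum fun e he => Finset.sum_le_sum fun f hf => hpair e he f hf).trans ?_
  simp only [Finset.sum_add_distrib, ← Finset.mul_sum, Finset.sum_ite_eq]
  simp only [Finset.sum_ite_mem, inter_self, sum_const, smul_eq_mul]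
  apply le_of_eq
  ring

/-- The link of a pair of light uncovered vertices meets the cover in few vertices. -/
theorem IsMinMatching.sum_cover_link_le_card (h3 : Is3Graph n H) (hM : IsMinMatching φ H M)
    {B : Finset (Fin n)} (hB : ∀ x ∈ B, φ x = 3 * n) (hBc : ∀ x ∉ B, φ x < n)
    {v w : Fin n} (hv : v ∈ leave M \ B) (hw : w ∈ leave M \ B) :
    ∑ x ∈ cover M, link H v w x ≤ (cover M \ B).card := by
  have hcard : (cover M \ B).card = ∑ x ∈ cover M, if x ∈ B then 0 else 1 := by
    rw [← Finset.filter_notMem_eq_sdiff, Finset.card_filter]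
    simp only [ite_not]
  rw [mem_sdiff] at hv hw
  rw [hcard, sum_cover hM.1, sum_cover hM.1]
  refine Finset.sum_le_sum fun e he => ?_
  have hce := h3 e (hM.1.1 he)
  obtain ⟨x, y, z, hxy, hxz, hyz, rfl⟩ := card_eq_three.1 hce
  have hsum (F : Fin n → ℕ) : ∑ a ∈ {x, y, z}, F a = F x + F y + F z :=
    sum_eq_of_card_eq_three hce (by simp) (by simp) (by simp) hxy hxz.symm hyz.symm F
  have key (a : Fin n) (ha : a ∈ ({x, y, z} : Finset (Fin n))) (hH : {v, w, a} ∈ H) :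
      φ x + φ y + φ z ≤ φ v + φ w + φ a :=
    (hsum φ).symm.le.trans
      (hM.sum_le_of_inter h3 he hH (Or.inl hv.1) (Or.inl hw.1) (Or.inr ha))
  have hx := key x (by simp)
  have hy := key y (by simp)
  have hz := key z (by simp)
  have hφv := hBc v hv.2
  have hφw := hBc w hw.2
  have hBx := hB x
  have hBy := hB y
  have hBz := hB z
  rw [hsum, hsum]
  unfold link
  clear key hsum hcard hB hBc
  split_ifs <;> simp_all <;> omega


theorem IsMinMatching.link_eq_zero (h3 : Is3Graph n H) (hM : IsMinMatching φ H M)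
    {B : Finset (Fin n)} (hB : ∀ x ∈ B, φ x = 3 * n) (hBc : ∀ x ∉ B, φ x < n)
    (hMB : (cover M ∩ B).Nonempty) {u v w : Fin n} (hu : u ∈ leave M \ B)
    (hv : v ∈ leave M \ B) (hw : w ∈ leave M \ B) : link H u v w = 0 := by
  rw [mem_sdiff] at hu hv hw
  obtain ⟨b, hb⟩ := hMB
  rw [mem_inter] at hb
  obtain ⟨e, he, hbe⟩ := mem_biUnion.1 hb.1
  unfold link
  rw [if_neg]
  intro hH
  have h₁ := hM.sum_le_of_inter h3 he hH (Or.inl hu.1) (Or.inl hv.1) (Or.inl hw.1)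
  have h₂ : φ b ≤ ∑ a ∈ e, φ a := Finset.single_le_sum (fun _ _ => Nat.zero_le _) hbe
  have := hB b hb.2
  have := hBc u hu.2
  have := hBc v hv.2
  have := hBc w hw.2
  omega

theorem sum_univ_eq (B : Finset (Fin n)) (F : Fin n → ℕ) :
    ∑ x, F x = ∑ x ∈ cover M, F x + ∑ x ∈ leave M \ B, F x + ∑ x ∈ leave M ∩ B, F x := by
  rw [← Finset.sum_sdiff (subset_univ (cover M)), ← leave, add_comm, add_assoc,
    ← Finset.sum_inter_add_sum_sdiff (leave M) B, add_comm (∑ x ∈ leave M ∩ B, F x)]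

theorem IsMinMatching.sum_link_le (h3 : Is3Graph n H) (hM : IsMinMatching φ H M)
    {B : Finset (Fin n)} (hB : ∀ x ∈ B, φ x = 3 * n) (hBc : ∀ x ∉ B, φ x < n)
    (hMB : (cover M ∩ B).Nonempty) {v : Fin n} (hv : v ∈ leave M \ B) :
    ∑ x, ∑ y, link H v x y ≤ ∑ x ∈ cover M, ∑ y ∈ cover M, link H v x y +
      2 * ((leave M \ B).card * (cover M \ B).card) + 2 * ((leave M ∩ B).card * n) := by
  have hLL : ∑ x ∈ leave M \ B, ∑ y ∈ leave M \ B, link H v x y = 0 :=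
    Finset.sum_eq_zero fun x hx => Finset.sum_eq_zero fun y hy =>
      hM.link_eq_zero h3 hB hBc hMB hv hx hy
  have hLC : ∑ x ∈ leave M \ B, ∑ y ∈ cover M, link H v x y ≤
      (leave M \ B).card * (cover M \ B).card := by
    rw [← smul_eq_mul]
    exact Finset.sum_le_card_nsmul _ _ _ fun x hx => hM.sum_cover_link_le_card h3 hB hBc hv hx
  have hCL : ∑ x ∈ cover M, ∑ y ∈ leave M \ B, link H v x y ≤
      (leave M \ B).card * (cover M \ B).card := by
    rw [Finset.sum_comm]
    simp_rw [link_comm v _ _] at hLC ⊢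
    simpa only [link_comm v _ _] using hLC
  have hB₁ : ∑ x ∈ leave M ∩ B, ∑ y, link H v x y ≤ (leave M ∩ B).card * n := by
    rw [← smul_eq_mul]
    refine Finset.sum_le_card_nsmul _ _ _ fun x _ => ?_
    refine (Finset.sum_le_card_nsmul _ _ 1 fun y _ => link_le_one v x y).trans ?_
    simp
  have hB₂ : ∑ x, ∑ y ∈ leave M ∩ B, link H v x y ≤ (leave M ∩ B).card * n := by
    rw [Finset.sum_comm]
    simpa only [link_comm v _ _] using hB₁
  have h₁ := sum_univ_eq (M := M) B fun x => ∑ y, link H v x y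
  have h₂ := sum_univ_eq (M := M) B fun x => ∑ y ∈ leave M ∩ B, link H v x y
  have h₃ (S : Finset (Fin n)) : ∑ x ∈ S, ∑ y, link H v x y =
      ∑ x ∈ S, ∑ y ∈ cover M, link H v x y + ∑ x ∈ S, ∑ y ∈ leave M \ B, link H v x y +
        ∑ x ∈ S, ∑ y ∈ leave M ∩ B, link H v x y := by
    rw [← Finset.sum_add_distrib, ← Finset.sum_add_distrib]
    exact Finset.sum_congr rfl fun x _ => sum_univ_eq (M := M) B fun y => link H v x y
  have h₄ := h₃ (cover M)
  have h₅ := h₃ (leave M \ B)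
  omega

theorem IsMinMatching.two_mul_deg_add_le (h3 : Is3Graph n H) (hM : IsMinMatching φ H M)
    {B : Finset (Fin n)} (hB : ∀ x ∈ B, φ x = 3 * n) (hBc : ∀ x ∉ B, φ x < n)
    (hMB : (cover M ∩ B).Nonempty) {u v w : Fin n} (hu : u ∈ leave M \ B)
    (hv : v ∈ leave M \ B) (hw : w ∈ leave M \ B) (huv : u ≠ v) (huw : u ≠ w) (hvw : v ≠ w)
    {T : ℕ} (hT : φ u + φ v ≤ T ∧ φ u + φ w ≤ T ∧ φ v + φ w ≤ T) :
    2 * (deg H u + deg H v + deg H w) ≤ 27 * M.card + 9 * M.card ^ 2 +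
      3 * (∑ x ∈ cover M, ∑ y ∈ cover M, if φ x + φ y ≤ T then 1 else 0) +
      6 * ((leave M \ B).card * (cover M \ B).card) + 6 * ((leave M ∩ B).card * n) := by
  have h := hM.sum_cover_link_le h3 (mem_sdiff.1 hu).1 (mem_sdiff.1 hv).1 (mem_sdiff.1 hw).1
    huv huw hvw hT
  simp only [Finset.sum_add_distrib] at h
  have hu₁ := hM.sum_link_le h3 hB hBc hMB hu
  have hv₁ := hM.sum_link_le h3 hB hBc hMB hv
  have hw₁ := hM.sum_link_le h3 hB hBc hMB hw
  have hu₂ := two_mul_deg_le h3 u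
  have hv₂ := two_mul_deg_le h3 v
  have hw₂ := two_mul_deg_le h3 w
  omega

theorem sum_ite_le_card_sq {B : Finset (Fin n)} (hB : ∀ x ∈ B, φ x = 3 * n) {T : ℕ}
    (hT : T < 3 * n) : (∑ x ∈ cover M, ∑ y ∈ cover M, if φ x + φ y ≤ T then 1 else 0) ≤
      (cover M \ B).card ^ 2 := by
  rw [← Finset.sum_product', ← Finset.card_filter, sq, ← Finset.card_product]
  refine Finset.card_le_card fun p hp => ?_
  simp only [mem_filter, mem_product, mem_sdiff] at hp ⊢
  refine ⟨⟨hp.1.1, fun h => ?_⟩, ⟨hp.1.2, fun h => ?_⟩⟩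
  · have := hB _ h; omega
  · have := hB _ h; omega

theorem two_mul_sum_ite_le {B : Finset (Fin n)} (hB : ∀ x ∈ B, φ x = 3 * n)
    (hφ : Set.InjOn φ (Bᶜ : Finset (Fin n))) {T : ℕ} (hT : T < 3 * n) :
    2 * (∑ x ∈ cover M, ∑ y ∈ cover M, if φ x + φ y ≤ T then 1 else 0) ≤
      (T + 1) * (T + 2) := by
  have hgauss (N : ℕ) : 2 * ∑ k ∈ range N, (k + 1) = N * (N + 1) := by
    induction N with
    | zero => simp
    | succ N ih => rw [Finset.sum_range_succ, mul_add, ih]; ring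
  rw [← hgauss (T + 1), ← Finset.sum_product', ← Finset.card_filter]
  refine Nat.mul_le_mul_left _ ?_
  calc _ ≤ ((range (T + 1)).biUnion fun k => antidiagonal k).card := by
        refine Finset.card_le_card_of_injOn (fun p => (φ p.1, φ p.2)) ?_ ?_
        · intro p hp
          simp only [coe_filter, mem_product, Set.mem_ofPred_eq] at hp
          simp only [coe_biUnion, Set.mem_iUnion, mem_coe, mem_range,
            HasAntidiagonal.mem_antidiagonal]
          exact ⟨_, Nat.lt_succ_of_le hp.2, rfl⟩
        · intro p hp q hq hpq
          simp only [coe_filter, mem_product, Set.mem_ofPred_eq] at hp hq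
          rw [Prod.mk.injEq] at hpq
          have hmem {a : Fin n} (ha : φ a ≤ T) : a ∈ ((Bᶜ : Finset (Fin n)) : Set (Fin n)) := by
            rw [mem_coe, mem_compl]
            intro h
            have := hB a h
            omega
          exact Prod.ext (hφ (hmem (by omega)) (hmem (by omega)) hpq.1)
            (hφ (hmem (by omega)) (hmem (by omega)) hpq.2)
    _ ≤ ∑ k ∈ range (T + 1), (antidiagonal k).card := Finset.card_biUnion_le
    _ = _ := by simp

theorem exists_isMinMatching (φ : Fin n → ℕ) (hM : IsMatching H M) :
    ∃ N, IsMinMatching φ H N ∧ N.card = M.card := by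
  obtain ⟨N, hN, hmin⟩ := Finset.exists_min_image
    (univ.filter fun N => IsMatching H N ∧ N.card = M.card) (weight φ) ⟨M, by simp [hM]⟩
  simp only [mem_filter, mem_univ, true_and] at hN hmin
  exact ⟨N, ⟨hN.1, fun N' h₁ h₂ => hmin N' ⟨h₁, h₂.trans hN.2⟩⟩, hN.2⟩

theorem exists_three_close {α : Type*} {S : Finset α} (g : α → ℕ) {K N : ℕ} (hK : 0 < K)
    (hg : ∀ x ∈ S, g x < N) (hS : 2 * (N / K + 1) < S.card) :
    ∃ x ∈ S, ∃ y ∈ S, ∃ z ∈ S, x ≠ y ∧ x ≠ z ∧ y ≠ z ∧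
      g x ≤ g y ∧ g x ≤ g z ∧ g y ≤ g x + K ∧ g z ≤ g x + K := by
  obtain ⟨k, -, hk⟩ := Finset.exists_lt_card_fiber_of_mul_lt_card_of_maps_to
    (s := S) (t := range (N / K + 1)) (f := fun x => g x / K) (n := 2)
    (fun x hx => mem_range.2 (Nat.lt_succ_of_le (Nat.div_le_div_right (hg x hx).le)))
    (by rw [card_range]; omega)
  set F := S.filter fun x => g x / K = k
  have hne : F.Nonempty := card_pos.1 (by omega)
  obtain ⟨x, hx, hmin⟩ := Finset.exists_min_image F g hne
  have hc : 1 < (F.erase x).card := by rw [card_erase_of_mem hx]; omega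
  obtain ⟨y, hy, z, hz, hyz⟩ := one_lt_card.1 hc
  rw [mem_erase] at hy hz
  have hclose {y : α} (hy : y ∈ F) : g y ≤ g x + K := by
    have h₁ := (mem_filter.1 hx).2
    have h₂ := (mem_filter.1 hy).2
    have h₃ := Nat.div_add_mod (g x) K
    have h₄ := Nat.div_add_mod (g y) K
    have h₅ := Nat.mod_lt (g y) hK
    rw [h₁] at h₃
    rw [h₂] at h₄
    omega
  exact ⟨x, (mem_filter.1 hx).1, y, (mem_filter.1 hy.2).1, z, (mem_filter.1 hz.2).1,
    hy.1.symm, hz.1.symm, hyz, hmin y hy.2, hmin z hz.2, hclose hy.2, hclose hz.2⟩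

theorem card_cover (h3 : Is3Graph n H) (hM : IsMatching H M) : (cover M).card = 3 * M.card := by
  rw [card_eq_sum_ones, sum_cover hM, Finset.sum_congr rfl (g := fun _ => 3), sum_const,
    smul_eq_mul, mul_comm]
  intro e he
  rw [← card_eq_sum_ones, h3 e (hM.1 he)]

theorem IsMinMatching.exists_deg_le (h3 : Is3Graph n H) (hM : IsMinMatching φ H M)
    {B : Finset (Fin n)} (hB : ∀ x ∈ B, φ x = 3 * n) (hBc : ∀ x ∉ B, φ x < n)
    (hinj : Set.InjOn φ (Bᶜ : Finset (Fin n)))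
    (hdeg : ∀ x ∉ B, ∀ y ∉ B, φ x ≤ φ y → deg H x ≤ deg H y)
    (hMB : (cover M ∩ B).Nonempty) {K : ℕ} (hK : 0 < K)
    (hl : 2 * (n / K + 1) < (leave M \ B).card) :
    ∃ x ∉ B, ∃ c g : ℕ, c < n ∧ c ≤ φ x + K ∧ g ≤ (cover M \ B).card ^ 2 ∧
      2 * g ≤ (2 * c + 1) * (2 * c + 2) ∧
      6 * deg H x ≤ 27 * M.card + 9 * M.card ^ 2 + 3 * g +
        6 * ((leave M \ B).card * (cover M \ B).card) + 6 * ((leave M ∩ B).card * n) := by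
  obtain ⟨x, hx, y, hy, z, hz, hxy, hxz, hyz, hφxy, hφxz, hφy, hφz⟩ :=
    exists_three_close φ hK (fun x hx => hBc x (mem_sdiff.1 hx).2) hl
  have hxB := (mem_sdiff.1 hx).2
  have hyB := (mem_sdiff.1 hy).2
  have hzB := (mem_sdiff.1 hz).2
  obtain ⟨c, hc⟩ : ∃ c, c = max (φ y) (φ z) := ⟨_, rfl⟩
  have hyc : φ y ≤ c := hc ▸ le_max_left _ _
  have hzc : φ z ≤ c := hc ▸ le_max_right _ _
  have hcn : c < n := hc ▸ max_lt (hBc y hyB) (hBc z hzB)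
  have hsum := hM.two_mul_deg_add_le h3 hB hBc hMB hx hy hz hxy hxz hyz (T := 2 * c)
    ⟨by omega, by omega, by omega⟩
  have hdy := hdeg x hxB y hyB hφxy
  have hdz := hdeg x hxB z hzB hφxz
  exact ⟨x, hxB, c, _, hcn, hc ▸ max_le hφy hφz, sum_ite_le_card_sq hB (by omega),
    two_mul_sum_ite_le hB hinj (by omega), le_trans (by omega) hsum⟩

theorem card_bound_of_deg {γ d n m l s b g : ℝ} (hn : 0 ≤ n) (hm : 0 ≤ m) (hl : 0 ≤ l)
    (hb : 0 ≤ b) (hbγ : b ≤ 2 * γ * n / 75) (hsum : l + b + 3 * m = n) (hs : 3 * (s + l) ≤ n)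
    (hd : 6 * d ≤ 27 * m + 9 * m ^ 2 + 3 * g + 6 * (l * s) + 6 * (b * n)) :
    2 * d ≤ n ^ 2 / 3 + 3 * n + g + 4 * γ * n ^ 2 / 75 := by
  have h₁ : 9 * m ^ 2 ≤ (n - l) ^ 2 := by nlinarith
  have h₂ : l * s ≤ l * (n / 3 - l) := by
    apply mul_le_mul_of_nonneg_left _ hl; linarith
  have h₃ : b * n ≤ 2 * γ * n / 75 * n := mul_le_mul_of_nonneg_right hbγ hn
  nlinarith [sq_nonneg l]

theorem four_ninths_bound_false {γ n s g d : ℝ} (hγ : 0 < γ) (hn : 2 ≤ n)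
    (hγn : 10 + 4 * γ ≤ γ * n) (hs : 0 ≤ s) (hsn : 3 * s ≤ n) (hg : g ≤ s ^ 2)
    (hub : 2 * d ≤ n ^ 2 / 3 + 3 * n + g + 4 * γ * n ^ 2 / 75)
    (hlb : (4 / 9 + 4 * γ) * (n * (n - 1) / 2) ≤ d) : False := by
  have hs2 : 9 * s ^ 2 ≤ n ^ 2 := by nlinarith
  nlinarith

theorem one_third_bound_false {γ n K a c t g d : ℝ} (hγ : 0 < γ) (hn : 2 ≤ n) (hK : 0 ≤ K)
    (hγn : 10 + 4 * K + 4 * γ ≤ γ * n) (ha : 0 ≤ a) (han : a ≤ n) (hc : 0 ≤ c) (hcn : c ≤ n)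
    (hca : c ≤ a + K) (hat : a + 1 ≤ t) (hg : 2 * g ≤ (2 * c + 1) * (2 * c + 2))
    (hub : 2 * d ≤ n ^ 2 / 3 + 3 * n + g + 4 * γ * n ^ 2 / 75)
    (hlb : (1 / 3 + 4 * γ) * (n * (n - 1) / 2) + (a + 1) * t ≤ d) : False := by
  have hsq : c ^ 2 ≤ a ^ 2 + 2 * K * n := by
    rcases le_total c a with h | h <;> nlinarith [mul_nonneg hK (by linarith : 0 ≤ n)]
  have hat2 : a ^ 2 + 2 * a + 1 ≤ (a + 1) * t := by nlinarith
  have hmul : (10 + 4 * K + 4 * γ) * n ≤ γ * n * n :=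
    mul_le_mul_of_nonneg_right hγn (by linarith)
  nlinarith

end

/-- Lemma `betterdegreelem`: for `γ > 0` and `n` sufficiently large, if `H` is a `3`-graph
on `n` vertices satisfying the degree sequence condition (for some `t` with
`1 ≤ t ≤ n/(3√2)`), and `M` is a matching in `H` with `|M| ≤ ⌊(n − γn)/3⌋`, then there is
a matching `N` with `|N| ≥ |M|` and `|L(N) ∩ V_{5/9}| > 2γn/75`. -/
theorem better_degree (γ : ℝ) (hγ : 0 < γ) :
    ∃ n₀ : ℕ, ∀ n : ℕ, n₀ ≤ n →
      ∀ t : ℕ, 1 ≤ t → (t : ℝ) ≤ (n : ℝ) / (3 * Real.sqrt 2) →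
      ∀ H : Finset (Finset (Fin n)), Is3Graph n H →
      (∃ σ : Fin n ≃ Fin n, DegSeq4 γ t H σ) →
      ∀ M : Finset (Finset (Fin n)), IsMatching H M →
        M.card ≤ ⌊((n : ℝ) - γ * n) / 3⌋₊ →
        ∃ N, IsMatching H N ∧ M.card ≤ N.card ∧
          2 * γ * n / 75 < ((leave N ∩ V59 γ H).card : ℝ) := by
  obtain ⟨n₀, hn₀⟩ := exists_nat_ge ((10 + 4 * (⌈4 / γ⌉₊ : ℝ) + 4 * γ) / γ)
  refine ⟨n₀ + 2, fun n hn t _ _ H h3 ⟨σ, hmono, hσ⟩ M hM hMc => ?_⟩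
  set K := ⌈4 / γ⌉₊
  have hK4 : 4 / γ ≤ K := Nat.le_ceil _
  have hK0 : 0 < K := Nat.ceil_pos.2 (by positivity)
  have hn2 : (2 : ℝ) ≤ n := by exact_mod_cast (by omega : 2 ≤ n)
  have hγn : 10 + 4 * (K : ℝ) + 4 * γ ≤ γ * n := by
    rw [div_le_iff₀ hγ] at hn₀
    have : (n₀ : ℝ) ≤ n := by exact_mod_cast (by omega : n₀ ≤ n)
    nlinarith
  have hKn : (n : ℝ) / K ≤ γ * n / 4 := by
    rw [div_le_iff₀ hγ] at hK4
    rw [div_le_iff₀ (by exact_mod_cast hK0)]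
    nlinarith
  have hchoose : ((n.choose 2 : ℕ) : ℝ) = n * (n - 1) / 2 := Nat.cast_choose_two ℝ n
  have hγ1 : γ ≤ 1 := by
    have h₁ := (hσ ⟨n - 1, by omega⟩).2.2 (by simp only; omega)
    have h₂ : 2 * deg H (σ ⟨n - 1, by omega⟩) ≤ n * n := by
      refine (two_mul_deg_le h3 _).trans ((Finset.sum_le_sum fun x _ =>
        Finset.sum_le_sum fun y _ => link_le_one _ x y).trans ?_)
      simp
    have h₃ : 2 * (deg H (σ ⟨n - 1, by omega⟩) : ℝ) ≤ n * n := by exact_mod_cast h₂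
    rw [hchoose] at h₁
    by_contra! hlt
    nlinarith
  by_contra! hcon
  set B := V59 γ H
  set φ : Fin n → ℕ := fun x => if x ∈ B then 3 * n else (σ.symm x : ℕ)
  obtain ⟨N, hN, hNM⟩ := exists_isMinMatching φ hM
  have hβ := hcon N hN.1 hNM.ge
  have hB : ∀ x ∈ B, φ x = 3 * n := fun x hx => if_pos hx
  have hBn : ∀ x ∉ B, φ x = (σ.symm x : ℕ) := fun x hx => if_neg hx
  have hBc : ∀ x ∉ B, φ x < n := fun x hx => by rw [hBn x hx]; exact (σ.symm x).2
  have hB3 : ∀ x ∉ B, 3 * (φ x + 1) ≤ n := by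
    intro x hx
    by_contra! hlt
    rw [hBn x hx] at hlt
    have h₁ := (hσ (σ.symm x)).2.2 hlt
    rw [Equiv.apply_symm_apply] at h₁
    apply hx
    refine mem_filter.2 ⟨mem_univ x, le_trans ?_ h₁⟩
    gcongr
    linarith
  have hinj : Set.InjOn φ (Bᶜ : Finset (Fin n)) := by
    intro x hx y hy hxy
    rw [mem_coe, mem_compl] at hx hy
    rw [hBn x hx, hBn y hy] at hxy
    exact σ.symm.injective (Fin.ext hxy)
  have hcompl : 3 * (Bᶜ : Finset (Fin n)).card ≤ n := by
    have := Finset.card_le_card_of_injOn (s := (Bᶜ : Finset (Fin n))) (t := range (n / 3)) φ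
      (fun x hx => by
        have := hB3 x (mem_compl.1 hx)
        simp only [coe_range, Set.mem_Iio]
        omega) hinj
    rw [card_range] at this
    omega
  have hpart : (cover N).card + (leave N \ B).card + (leave N ∩ B).card = n := by
    have := sum_univ_eq (M := N) B fun _ => 1
    simpa using this.symm
  have hsl : (cover N \ B).card + (leave N \ B).card ≤ (Bᶜ : Finset (Fin n)).card := by
    rw [← card_union_of_disjoint]
    · refine Finset.card_le_card fun x hx => ?_
      rw [mem_union, mem_sdiff, mem_sdiff] at hx
      rw [mem_compl]
      tauto
    · rw [Finset.disjoint_left]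
      intro x hx hx'
      rw [leave, sdiff_sdiff_comm] at hx'
      simp_all
  have hcov := card_cover h3 hN.1
  have hcovB : (cover N ∩ B).card + (cover N \ B).card = (cover N).card :=
    Finset.card_inter_add_card_sdiff _ _
  set l := (leave N \ B).card
  set s := (cover N \ B).card
  set b := (leave N ∩ B).card
  set m := N.card
  have hpartR : (l : ℝ) + b + 3 * m = n := by exact_mod_cast (by omega : l + b + 3 * m = n)
  have hslR : 3 * ((s : ℝ) + l) ≤ n := by exact_mod_cast (by omega : 3 * (s + l) ≤ n)
  have hmR : 3 * (m : ℝ) ≤ n - γ * n := by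
    have h₁ : (m : ℝ) ≤ ((n : ℝ) - γ * n) / 3 := by
      rw [← hNM] at hMc
      refine (Nat.cast_le.2 hMc).trans (Nat.floor_le ?_)
      have : γ * n ≤ n := by nlinarith
      linarith
    linarith
  have hMB : (cover N ∩ B).Nonempty := by
    rw [← card_pos]
    have : (s : ℝ) < 3 * m := by nlinarith [Nat.cast_nonneg (α := ℝ) l]
    have : s < 3 * m := by exact_mod_cast this
    omega
  have hlarge : 2 * (n / K + 1) < l := by
    have h₁ : ((n / K : ℕ) : ℝ) ≤ n / K := Nat.cast_div_le
    have h₂ : (2 : ℝ) * (((n / K : ℕ) : ℝ) + 1) < l := by linarith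
    exact_mod_cast h₂
  have hdeg : ∀ x ∉ B, ∀ y ∉ B, φ x ≤ φ y → deg H x ≤ deg H y := by
    intro x hx y hy hxy
    rw [hBn x hx, hBn y hy] at hxy
    have := hmono (show σ.symm x ≤ σ.symm y from hxy)
    simpa using this
  obtain ⟨x, hxB, c, g, hcn, hcK, hg₁, hg₂, hd⟩ :=
    hN.exists_deg_le h3 hB hBc hinj hdeg hMB hK0 hlarge
  have hd' := (Nat.cast_le (α := ℝ)).2 hd
  push_cast at hd'
  have hub := card_bound_of_deg (by positivity) (by positivity) (by positivity) (by positivity)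
    hβ hpartR hslR hd'
  have hidx := hσ (σ.symm x)
  rw [Equiv.apply_symm_apply, ← hBn x hxB, hchoose] at hidx
  rcases le_or_gt (φ x + 1) t with ht | ht
  · exact one_third_bound_false hγ hn2 (Nat.cast_nonneg K) hγn (Nat.cast_nonneg (φ x))
      (by exact_mod_cast (hBc x hxB).le) (Nat.cast_nonneg c) (by exact_mod_cast hcn.le)
      (by exact_mod_cast hcK) (by exact_mod_cast ht) (by exact_mod_cast hg₂) hub (hidx.1 ht)
  · exact four_ninths_bound_false hγ hn2 (by linarith [Nat.cast_nonneg (α := ℝ) K])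
      (Nat.cast_nonneg s) (by linarith [Nat.cast_nonneg (α := ℝ) l]) (by exact_mod_cast hg₁)
      hub (hidx.2.1 ht (hB3 x hxB))
end
end

section
/- Let γ > 0 and let H be a 3-graph on n vertices (n sufficiently large in terms of γ) with degree sequence d₁ ≤ … ≤ dₙ such that, for some t with 1 ≤ t ≤ n/(3√2), dᵢ ≥ (1/3 + 4γ)·C(n,2) + i·t for 1 ≤ i ≤ t, dᵢ ≥ (4/9 + 4γ)·C(n,2) for t < i ≤ n/3, and dᵢ ≥ (5/9 + 4γ)·C(n,2) for i > n/3. Then there exists a matching M* in H such that |M*| = ⌊(n − γn)/3⌋ and |L(M*) ∩ V_{5/9}| > 2γn/75. -/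
open Finset
open scoped Classical

noncomputable section

/-- The `c`-coloured box `e` is hole-free for `R` if any choice of an `ε`-proportion of each of its
three colour classes spans a tuple in `R`. -/
def HoleFree {V κ : Type*} [Fintype V] (R : (Fin 3 → V) → Prop) (ε : ℝ) (c : V → κ)
    (e : Fin 3 → κ) : Prop :=
  ∀ A : Fin 3 → Finset V, (∀ a, ∀ v ∈ A a, c v = e a) →
    (∀ a, ε * #{v | c v = e a} ≤ #(A a)) → ∃ τ ∈ Fintype.piFinset A, R τ

/-- The tuples lying in a box that contains no tuple of `R`. -/
def emptyTuples {V κ : Type*} [Fintype V] (R : (Fin 3 → V) → Prop) (c : V → κ) :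
    Finset (Fin 3 → V) :=
  {τ | ∀ τ', c ∘ τ' = c ∘ τ → ¬ R τ'}

/-- The tuples lying in a box that meets `R` but is not hole-free. -/
def holeTuples {V κ : Type*} [Fintype V] (R : (Fin 3 → V) → Prop) (ε : ℝ) (c : V → κ) :
    Finset (Fin 3 → V) :=
  {τ | (∃ τ', c ∘ τ' = c ∘ τ ∧ R τ') ∧ ¬ HoleFree R ε c (c ∘ τ)}

theorem mem_holeTuples {V κ : Type*} [Fintype V] {R : (Fin 3 → V) → Prop} {ε : ℝ} {c : V → κ}
    {τ : Fin 3 → V} : τ ∈ holeTuples R ε c ↔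
      (∃ τ', c ∘ τ' = c ∘ τ ∧ R τ') ∧ ¬ HoleFree R ε c (c ∘ τ) := by
  simp [holeTuples]

theorem exists_refinement {V κ : Type*} [Fintype V] [Fintype κ] (R : (Fin 3 → V) → Prop)
    {ε : ℝ} (hε : 0 < ε) (c : V → κ) :
    ∃ c' : V → κ × ((Fin 3 → κ) → Fin 3 → Bool),
      (#(emptyTuples R c) : ℝ) + ε ^ 3 * #(holeTuples R ε c) ≤ #(emptyTuples R c') := by
  have key : ∀ e : Fin 3 → κ, ∃ A : Fin 3 → Finset V, (∀ a, ∀ v ∈ A a, c v = e a) ∧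
      (¬ HoleFree R ε c e → (∀ a, ε * #{v | c v = e a} ≤ #(A a)) ∧
        ∀ τ ∈ Fintype.piFinset A, ¬ R τ) := by
    intro e
    by_cases h : HoleFree R ε c e
    · exact ⟨fun _ => ∅, by simp, fun h' => absurd h h'⟩
    · have h' := h
      unfold HoleFree at h'
      push Not at h'
      obtain ⟨A, h1, h2, h3⟩ := h'
      exact ⟨A, h1, fun _ => ⟨h2, h3⟩⟩
  choose A hA hA' using key
  set X : Finset (Fin 3 → V) := {τ ∈ holeTuples R ε c | τ ∈ Fintype.piFinset (A (c ∘ τ))} with hX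
  have hcard : ε ^ 3 * #(holeTuples R ε c) ≤ (#X : ℝ) := by
    rw [card_eq_sum_card_fiberwise (f := fun τ => c ∘ τ) (t := univ) (s := holeTuples R ε c)
        (fun _ _ => by simp),
      card_eq_sum_card_fiberwise (f := fun τ => c ∘ τ) (t := univ) (s := X) (fun _ _ => by simp)]
    push_cast
    rw [mul_sum]
    refine sum_le_sum fun e _ => ?_
    rcases eq_empty_or_nonempty {τ ∈ holeTuples R ε c | c ∘ τ = e} with h0 | ⟨τ₀, h0⟩
    · rw [h0]; simp
    · simp only [holeTuples, mem_filter, mem_univ, true_and] at h0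
      obtain ⟨⟨⟨τ₁, h1, h1'⟩, h2⟩, rfl⟩ := h0
      obtain ⟨hs, -⟩ := hA' _ h2
      have hle : #{τ ∈ holeTuples R ε c | c ∘ τ = c ∘ τ₀} ≤
          ∏ a, #{v | c v = (c ∘ τ₀) a} := by
        rw [← Fintype.card_piFinset]
        refine card_le_card fun τ hτ => ?_
        simp only [mem_filter] at hτ
        simp only [Fintype.mem_piFinset, mem_filter, mem_univ, true_and]
        exact fun a => congrFun hτ.2 a
      have hge : ∏ a, #(A (c ∘ τ₀) a) ≤ #{τ ∈ X | c ∘ τ = c ∘ τ₀} := by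
        rw [← Fintype.card_piFinset]
        refine card_le_card fun τ hτ => ?_
        have hc : c ∘ τ = c ∘ τ₀ :=
          funext fun a => hA _ a _ (Fintype.mem_piFinset.1 hτ a)
        simp only [hX, holeTuples, mem_filter, mem_univ, true_and, hc]
        exact ⟨⟨⟨⟨τ₁, h1, h1'⟩, h2⟩, hτ⟩, trivial⟩
      calc ε ^ 3 * (#{τ ∈ holeTuples R ε c | c ∘ τ = c ∘ τ₀} : ℝ)
          ≤ ε ^ 3 * ∏ a, (#{v | c v = (c ∘ τ₀) a} : ℝ) := by
            gcongr; exact_mod_cast hle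
        _ = ∏ a, (ε * #{v | c v = (c ∘ τ₀) a} : ℝ) := by
            rw [prod_mul_distrib]; simp
        _ ≤ ∏ a, (#(A (c ∘ τ₀) a) : ℝ) :=
            prod_le_prod (fun a _ => by positivity) fun a _ => hs a
        _ ≤ _ := by exact_mod_cast hge
  refine ⟨fun v => (c v, fun e a => decide (v ∈ A e a)), ?_⟩
  refine (add_le_add_right hcard _).trans ?_
  rw [← Nat.cast_add, Nat.cast_le]
  have hdisj : Disjoint (emptyTuples R c) X := by
    rw [disjoint_left]
    intro τ h1 h2
    simp only [emptyTuples, hX, holeTuples, mem_filter, mem_univ, true_and] at h1 h2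
    obtain ⟨⟨⟨τ', h3, h4⟩, -⟩, -⟩ := h2
    exact h1 τ' h3 h4
  rw [← card_union_of_disjoint hdisj]
  refine card_le_card fun τ hτ => ?_
  simp only [emptyTuples, mem_filter, mem_univ, true_and]
  intro τ' h hR
  have hc : c ∘ τ' = c ∘ τ := funext fun a => congrArg Prod.fst (congrFun h a)
  rcases mem_union.1 hτ with hτ | hτ
  · simp only [emptyTuples, mem_filter, mem_univ, true_and] at hτ
    exact hτ τ' hc hR
  · simp only [hX, holeTuples, mem_filter, mem_univ, true_and] at hτ
    refine (hA' _ hτ.1.2).2 τ' ?_ hR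
    rw [Fintype.mem_piFinset]
    intro a
    have := congrFun (congrFun (congrArg Prod.snd (congrFun h a)) (c ∘ τ)) a
    simpa [Fintype.mem_piFinset.1 hτ.2 a] using this

theorem exists_coloring_or_large {ε δ : ℝ} (hε : 0 < ε) (j : ℕ) :
    ∃ K : ℕ, ∀ (V : Type) [Fintype V] (R : (Fin 3 → V) → Prop),
      ∃ (κ : Type) (_ : Fintype κ) (c : V → κ), Fintype.card κ ≤ K ∧
        ((#(holeTuples R ε c) : ℝ) ≤ δ * Fintype.card V ^ 3 ∨
          j * (ε ^ 3 * δ * Fintype.card V ^ 3) ≤ (#(emptyTuples R c) : ℝ)) := by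
  induction j with
  | zero =>
    exact ⟨1, fun V _ R => ⟨Unit, inferInstance, fun _ => (), by simp, Or.inr (by simp)⟩⟩
  | succ j ih =>
    obtain ⟨K, hK⟩ := ih
    refine ⟨K * (2 ^ 3) ^ K ^ 3, fun V _ R => ?_⟩
    obtain ⟨κ, _, c, hc, h⟩ := hK V R
    by_cases hgood : (#(holeTuples R ε c) : ℝ) ≤ δ * Fintype.card V ^ 3
    · refine ⟨κ, inferInstance, c, hc.trans (Nat.le_mul_of_pos_right _ (by positivity)),
        Or.inl hgood⟩
    · obtain ⟨c', hc'⟩ := exists_refinement R hε c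
      refine ⟨_, inferInstance, c', ?_, Or.inr ?_⟩
      · simp only [Fintype.card_prod, Fintype.card_fun, Fintype.card_bool, Fintype.card_fin]
        gcongr
        norm_num
      · have h := h.resolve_left hgood
        push Not at hgood
        refine le_trans ?_ hc'
        have := mul_le_mul_of_nonneg_left hgood.le (pow_pos hε 3).le
        push_cast
        nlinarith

/-- One-sided weak regularity: few tuples lie in boxes that meet `R` but are not hole-free. -/
theorem exists_regular_coloring {ε δ : ℝ} (hε : 0 < ε) (hδ : 0 < δ) :
    ∃ K : ℕ, ∀ (V : Type) [Fintype V] (R : (Fin 3 → V) → Prop),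
      ∃ (κ : Type) (_ : Fintype κ) (c : V → κ), Fintype.card κ ≤ K ∧
        (#(holeTuples R ε c) : ℝ) ≤ δ * Fintype.card V ^ 3 := by
  obtain ⟨j, hj⟩ := exists_nat_gt (1 / (ε ^ 3 * δ))
  obtain ⟨K, hK⟩ := exists_coloring_or_large (δ := δ) hε j
  refine ⟨K, fun V _ R => ?_⟩
  obtain ⟨κ, hκ, c, hc, h | h⟩ := hK V R
  · exact ⟨κ, hκ, c, hc, h⟩
  · refine ⟨κ, hκ, c, hc, ?_⟩
    have hle : ∀ s : Finset (Fin 3 → V), (#s : ℝ) ≤ Fintype.card V ^ 3 := fun s => by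
      have := card_le_univ s
      rw [Fintype.card_fun, Fintype.card_fin] at this
      exact_mod_cast this
    rw [div_lt_iff₀ (by positivity)] at hj
    have h1 := hle (emptyTuples R c)
    have h2 := hle (holeTuples R ε c)
    have h3 : (0 : ℝ) ≤ (Fintype.card V : ℝ) ^ 3 := by positivity
    rcases h3.eq_or_lt with h0 | h0
    · rw [← h0] at h2 ⊢; simpa using h2
    · nlinarith

theorem exists_isMin_cover {κ : Type*} [Fintype κ] (s : κ → ℝ) (hs : ∀ i, 0 ≤ s i)
    (E : Finset (Fin 3 → κ)) :
    ∃ w : κ → ℝ, (∀ i, 0 ≤ w i) ∧ (∀ e ∈ E, 1 ≤ ∑ a, w (e a)) ∧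
      ∀ w' : κ → ℝ, (∀ i, 0 ≤ w' i) → (∀ e ∈ E, 1 ≤ ∑ a, w' (e a)) →
        ∑ i, w i * s i ≤ ∑ i, w' i * s i := by
  have hcomp : IsCompact (Set.Icc (0 : κ → ℝ) 1 ∩ ⋂ e ∈ E, {w | 1 ≤ ∑ a, w (e a)}) := by
    refine isCompact_Icc.inter_right (isClosed_biInter fun e _ => ?_)
    exact isClosed_le continuous_const (by fun_prop)
  have hne : (Set.Icc (0 : κ → ℝ) 1 ∩ ⋂ e ∈ E, {w | 1 ≤ ∑ a, w (e a)}).Nonempty :=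
    ⟨1, by simp, by simp⟩
  obtain ⟨w, ⟨⟨hw0, -⟩, hwE⟩, hmin⟩ := hcomp.exists_isMinOn hne
    (f := fun w => ∑ i, w i * s i) (by fun_prop)
  simp only [Set.mem_iInter] at hwE
  refine ⟨w, hw0, hwE, fun w' h0 hE => ?_⟩
  have hmem : (fun i => min (w' i) 1) ∈
      Set.Icc (0 : κ → ℝ) 1 ∩ ⋂ e ∈ E, {w | 1 ≤ ∑ a, w (e a)} := by
    refine ⟨⟨fun i => le_min (h0 i) zero_le_one, fun i => min_le_right _ _⟩, ?_⟩
    simp only [Set.mem_iInter]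
    intro e he
    have hnn : ∀ a ∈ univ, 0 ≤ min (w' (e a)) 1 := fun a _ => le_min (h0 _) zero_le_one
    by_cases h : ∃ a, 1 ≤ w' (e a)
    · obtain ⟨a, ha⟩ := h
      have := single_le_sum hnn (mem_univ a)
      rw [min_eq_right ha] at this
      exact this
    · push Not at h
      have : ∑ a, min (w' (e a)) 1 = ∑ a, w' (e a) :=
        sum_congr rfl fun a _ => min_eq_left (h a).le
      change 1 ≤ ∑ a, min (w' (e a)) 1
      rw [this]
      exact hE e he
  refine (hmin hmem).trans (sum_le_sum fun i _ => ?_)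
  exact mul_le_mul_of_nonneg_right (min_le_left _ _) (hs i)

/-- The load that the weighting `x` of triples puts on `i`. -/
def load {κ : Type*} [Fintype κ] (x : (Fin 3 → κ) → ℝ) (i : κ) : ℝ :=
  ∑ e, x e * ∑ a, if e a = i then 1 else 0

theorem sum_mul_load {κ : Type*} [Fintype κ] (x : (Fin 3 → κ) → ℝ) (g : κ → ℝ) :
    ∑ i, g i * load x i = ∑ e, x e * ∑ a, g (e a) := by
  simp only [load, mul_sum]
  rw [sum_comm]
  refine sum_congr rfl fun e _ => ?_
  rw [sum_comm]
  refine sum_congr rfl fun a _ => ?_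
  rw [sum_eq_single (e a)] <;> simp +contextual [mul_comm, eq_comm]

/-- Strong duality between fractional matchings and fractional covers. -/
theorem exists_fractional_matching_cover {κ : Type*} [Fintype κ] (s : κ → ℝ) (hs : ∀ i, 0 ≤ s i)
    (E : Finset (Fin 3 → κ)) :
    ∃ (w : κ → ℝ) (x : (Fin 3 → κ) → ℝ), (∀ i, 0 ≤ w i) ∧ (∀ e ∈ E, 1 ≤ ∑ a, w (e a)) ∧
      (∀ e, 0 ≤ x e) ∧ (∀ e ∉ E, x e = 0) ∧ (∀ i, load x i ≤ s i) ∧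
      ∑ e, x e = ∑ i, w i * s i := by
  obtain ⟨w, hw0, hwE, hmin⟩ := exists_isMin_cover s hs E
  refine ⟨w, ?_⟩
  set T := ∑ i, w i * s i with hT
  have hT0 : 0 ≤ T := sum_nonneg fun i _ => mul_nonneg (hw0 i) (hs i)
  by_contra! hno
  have hno' : ∀ x : (Fin 3 → κ) → ℝ, (∀ e, 0 ≤ x e) → (∀ e ∉ E, x e = 0) →
      ∑ e, x e = T → ∃ i, s i < load x i := by
    intro x h1 h2 h3
    by_contra! h4
    exact hno x hw0 hwE h1 h2 h4 h3
  set X : Set ((Fin 3 → κ) → ℝ) :=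
    {x | (∀ e, 0 ≤ x e) ∧ (∀ e ∉ E, x e = 0) ∧ ∑ e, x e = T} with hX
  have hXconv : Convex ℝ X := by
    rintro x ⟨hx1, hx2, hx3⟩ y ⟨hy1, hy2, hy3⟩ a b ha hb hab
    refine ⟨fun e => ?_, fun e he => ?_, ?_⟩
    · simp only [Pi.add_apply, Pi.smul_apply, smul_eq_mul]
      exact add_nonneg (mul_nonneg ha (hx1 e)) (mul_nonneg hb (hy1 e))
    · simp [hx2 e he, hy2 e he]
    · simp only [Pi.add_apply, Pi.smul_apply, smul_eq_mul, sum_add_distrib, ← mul_sum, hx3, hy3]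
      rw [← add_mul, hab, one_mul]
  have hXcomp : IsCompact X := by
    have hsub : X ⊆ Set.Icc (0 : (Fin 3 → κ) → ℝ) (fun _ => T) := by
      rintro x ⟨hx1, -, hx3⟩
      exact ⟨hx1, fun e => hx3 ▸ single_le_sum (fun e _ => hx1 e) (mem_univ e)⟩
    refine isCompact_Icc.of_isClosed_subset ?_ hsub
    have : X = (⋂ e, {x | 0 ≤ x e}) ∩ ((⋂ e ∉ E, {x | x e = 0}) ∩ {x | ∑ e, x e = T}) := by
      ext x; simp [hX]
    rw [this]
    refine (isClosed_iInter fun e => isClosed_le (by fun_prop) (by fun_prop)).inter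
      ((isClosed_biInter fun e _ => isClosed_eq (by fun_prop) (by fun_prop)).inter
        (isClosed_eq (by fun_prop) (by fun_prop)))
  have hlin : IsLinearMap ℝ (fun x : (Fin 3 → κ) → ℝ => load x) := by
    constructor
    · intro x y; ext i; simp [load, add_mul, sum_add_distrib]
    · intro r x; ext i; simp [load, mul_assoc, mul_sum]
  have hKconv : Convex ℝ ((fun x => load x) '' X) := hXconv.is_linear_image hlin
  have hKcomp : IsCompact ((fun x : (Fin 3 → κ) → ℝ => load x) '' X) :=
    hXcomp.image (by unfold load; fun_prop)
  have hdisj : Disjoint (Set.Iic s) ((fun x => load x) '' X) := by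
    rw [Set.disjoint_left]
    rintro _ hle ⟨x, ⟨h1, h2, h3⟩, rfl⟩
    obtain ⟨i, hi⟩ := hno' x h1 h2 h3
    exact absurd (hle i) (not_le.2 hi)
  obtain ⟨f, u, v, hfu, huv, hfv⟩ :=
    geometric_hahn_banach_closed_compact (convex_Iic s) isClosed_Iic hKconv hKcomp hdisj
  set g : κ → ℝ := fun i => f (Pi.single i 1) with hg
  have hf : ∀ y : κ → ℝ, f y = ∑ i, g i * y i := by
    intro y
    conv_lhs => rw [← Finset.univ_sum_single y]
    rw [map_sum]
    refine sum_congr rfl fun i _ => ?_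
    have : (Pi.single i (y i) : κ → ℝ) = y i • Pi.single i 1 := by
      rw [← Pi.single_smul]; simp
    rw [this, map_smul, smul_eq_mul, mul_comm]
  have hg0 : ∀ i, 0 ≤ g i := by
    intro i
    by_contra! hneg
    obtain ⟨k, hk⟩ := exists_nat_gt ((u - f s) / (-g i))
    rw [div_lt_iff₀ (by linarith)] at hk
    have := hfu (s - (k : ℝ) • Pi.single i 1) (by
      intro j
      have : 0 ≤ (k : ℝ) * (Pi.single i (1 : ℝ) : κ → ℝ) j :=
        mul_nonneg (by positivity) (by
          by_cases h : j = i
          · subst h; simp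
          · simp [h])
      simpa using this)
    rw [map_sub, map_smul, smul_eq_mul] at this
    change f s - k * g i < u at this
    linarith
  have hu0 : 0 < u := by
    have h1 := hfu s (le_refl s)
    rw [hf] at h1
    exact (sum_nonneg fun i _ => mul_nonneg (hg0 i) (hs i)).trans_lt h1
  have hcov : ∀ e ∈ E, v < T * ∑ a, g (e a) := by
    intro e he
    have := hfv (load (Pi.single e T)) ⟨Pi.single e T, ⟨fun e' => ?_, fun e' he' => ?_, ?_⟩, rfl⟩
    · rw [hf, sum_mul_load, sum_eq_single e] at this
      · simpa using this
      · intro b _ hb; simp [hb]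
      · simp
    · by_cases h : e' = e
      · subst h; simpa using hT0
      · simp [h]
    · have : e' ≠ e := fun h => he' (h ▸ he)
      simp [this]
    · simp
  have hfin := hmin (fun i => T / v * g i)
    (fun i => mul_nonneg (div_nonneg hT0 (hu0.trans huv).le) (hg0 i)) (by
      intro e he
      rw [← mul_sum, div_mul_eq_mul_div, le_div_iff₀ (hu0.trans huv)]
      linarith [hcov e he])
  have hsu := hfu s (le_refl s)
  rw [hf] at hsu
  have hE : ∑ i, T / v * g i * s i = T / v * ∑ i, g i * s i := by
    rw [mul_sum]; exact sum_congr rfl fun i _ => by ring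
  rw [hE, div_mul_eq_mul_div, le_div_iff₀ (hu0.trans huv)] at hfin
  change T * v ≤ _ at hfin
  rcases hT0.eq_or_lt with h0 | h0
  · obtain ⟨i, hi⟩ := hno' 0 (by simp) (by simp) (by simpa using h0)
    simp [load] at hi
    exact absurd (hs i) (not_le.2 hi)
  · have := le_of_mul_le_mul_left hfin h0
    linarith

/-- The number of pairs of positions at which `u` and `v` sum to at least `1`. -/
def heavyPairs (u v : Fin 3 → ℝ) : ℕ :=
  ∑ a, ∑ b, if 1 ≤ u a + v b then 1 else 0

/-- The number of zeros of `u`. -/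
def zeroCount (u : Fin 3 → ℝ) : ℕ :=
  ∑ a, if u a = 0 then 1 else 0

theorem heavyPairs_le_of_monotone {u v : Fin 3 → ℝ} (hu : Monotone u) (hv : Monotone v)
    (hu0 : ∀ a, 0 ≤ u a) (hv0 : ∀ a, 0 ≤ v a) (hu1 : ∑ a, u a ≤ 1) (hv1 : ∑ a, v a ≤ 1) :
    heavyPairs u v ≤ 3 + zeroCount u * zeroCount v ∧ heavyPairs u v ≤ 5 := by
  have hu01 := hu (show (0 : Fin 3) ≤ 1 by decide)
  have hu12 := hu (show (1 : Fin 3) ≤ 2 by decide)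
  have hv01 := hv (show (0 : Fin 3) ≤ 1 by decide)
  have hv12 := hv (show (1 : Fin 3) ≤ 2 by decide)
  have hu00 := hu0 0
  have hv00 := hv0 0
  unfold heavyPairs zeroCount
  simp only [Fin.sum_univ_three] at hu1 hv1 ⊢
  generalize u 0 = u0 at *
  generalize u 1 = u1 at *
  generalize u 2 = u2 at *
  generalize v 0 = v0 at *
  generalize v 1 = v1 at *
  generalize v 2 = v2 at *
  rw [if_neg (show ¬ 1 ≤ u0 + v0 by linarith), if_neg (show ¬ 1 ≤ u0 + v1 by linarith),
    if_neg (show ¬ 1 ≤ u1 + v0 by linarith)]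
  by_cases h11 : 1 ≤ u1 + v1
  · rw [if_pos (show u0 = 0 by linarith), if_pos (show v0 = 0 by linarith),
      if_neg (show ¬ 1 ≤ u0 + v2 by linarith), if_neg (show ¬ 1 ≤ u2 + v0 by linarith),
      if_neg (show ¬ u1 = 0 by intro h; linarith), if_neg (show ¬ u2 = 0 by intro h; linarith),
      if_neg (show ¬ v1 = 0 by intro h; linarith), if_neg (show ¬ v2 = 0 by intro h; linarith)]
    split_ifs <;> simp
  rw [if_neg h11]
  by_cases hA : 1 ≤ u0 + v2 ∧ 1 ≤ u2 + v1
  · obtain ⟨h1, h2⟩ := hA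
    rw [if_pos (show u0 = 0 by linarith), if_pos (show u1 = 0 by linarith),
      if_pos (show v0 = 0 by linarith), if_pos (show v1 = 0 by linarith)]
    split_ifs <;> simp
  by_cases hB : 1 ≤ u2 + v0 ∧ 1 ≤ u1 + v2
  · obtain ⟨h1, h2⟩ := hB
    rw [if_pos (show u0 = 0 by linarith), if_pos (show u1 = 0 by linarith),
      if_pos (show v0 = 0 by linarith), if_pos (show v1 = 0 by linarith)]
    split_ifs <;> simp
  have h3 : (0 + 0 + (if 1 ≤ u0 + v2 then 1 else 0) + (0 + 0 + if 1 ≤ u1 + v2 then 1 else 0) +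
      ((if 1 ≤ u2 + v0 then 1 else 0) + (if 1 ≤ u2 + v1 then 1 else 0) +
        if 1 ≤ u2 + v2 then 1 else 0)) ≤ 3 := by
    by_cases h02 : 1 ≤ u0 + v2
    · have h21 : ¬ 1 ≤ u2 + v1 := fun h => hA ⟨h02, h⟩
      rw [if_neg h21, if_neg (show ¬ 1 ≤ u2 + v0 by linarith)]
      split_ifs <;> simp
    · rw [if_neg h02]
      by_cases h20 : 1 ≤ u2 + v0
      · rw [if_neg (show ¬ 1 ≤ u1 + v2 from fun h => hB ⟨h20, h⟩)]
        split_ifs <;> simp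
      · rw [if_neg h20]
        split_ifs <;> simp
  exact ⟨h3.trans (Nat.le_add_right _ _), h3.trans (by norm_num)⟩

theorem heavyPairs_le {u v : Fin 3 → ℝ} (hu0 : ∀ a, 0 ≤ u a) (hv0 : ∀ a, 0 ≤ v a)
    (hu1 : ∑ a, u a ≤ 1) (hv1 : ∑ a, v a ≤ 1) :
    heavyPairs u v ≤ 3 + zeroCount u * zeroCount v ∧ heavyPairs u v ≤ 5 := by
  have h := heavyPairs_le_of_monotone (Tuple.monotone_sort u) (Tuple.monotone_sort v)
    (fun a => hu0 _) (fun a => hv0 _) ((Equiv.sum_comp (Tuple.sort u) u).trans_le hu1)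
    ((Equiv.sum_comp (Tuple.sort v) v).trans_le hv1)
  have hp : heavyPairs (u ∘ Tuple.sort u) (v ∘ Tuple.sort v) = heavyPairs u v := by
    unfold heavyPairs
    rw [← Equiv.sum_comp (Tuple.sort u) (fun a => ∑ b, if 1 ≤ u a + v b then 1 else 0)]
    refine sum_congr rfl fun a _ => ?_
    exact Equiv.sum_comp (Tuple.sort v) (fun b => if 1 ≤ u (Tuple.sort u a) + v b then 1 else 0)
  have hz : ∀ w : Fin 3 → ℝ, zeroCount (w ∘ Tuple.sort w) = zeroCount w := fun w =>
    Equiv.sum_comp (Tuple.sort w) (fun a => if w a = 0 then 1 else 0)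
  rwa [hp, hz, hz] at h

theorem sum_heavy_pairs_le {κ : Type*} [Fintype κ] {s w : κ → ℝ} {y : (Fin 3 → κ) → ℝ}
    (hy0 : ∀ e, 0 ≤ y e) (hys : ∀ i, load y i = s i) (hw0 : ∀ i, 0 ≤ w i)
    (hyw : ∀ e, y e ≠ 0 → ∑ a, w (e a) ≤ 1) :
    ∑ i, ∑ j, (if 1 ≤ w i + w j then s i * s j else 0) ≤
        (∑ i, s i) ^ 2 / 3 + (∑ i, if w i = 0 then s i else 0) ^ 2 ∧
      ∑ i, ∑ j, (if 1 ≤ w i + w j then s i * s j else 0) ≤ 5 / 9 * (∑ i, s i) ^ 2 := by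
  have htot : ∑ i, s i = 3 * ∑ e, y e := by
    have := sum_mul_load y (fun _ => 1)
    simp only [hys, one_mul] at this
    rw [this, mul_sum]
    exact sum_congr rfl fun e _ => by simp [mul_comm]
  have hzero : (∑ i, if w i = 0 then s i else 0) = ∑ e, y e * zeroCount (w ∘ e) := by
    have := sum_mul_load y (fun i => if w i = 0 then 1 else 0)
    simp only [hys, ite_mul, one_mul, zero_mul] at this
    rw [this]
    exact sum_congr rfl fun e _ => by simp [zeroCount]
  have hpairs : ∑ i, ∑ j, (if 1 ≤ w i + w j then s i * s j else 0) =
      ∑ e, ∑ f, y e * y f * heavyPairs (w ∘ e) (w ∘ f) := by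
    have h1 : ∀ i, ∑ j, (if 1 ≤ w i + w j then s j else 0) =
        ∑ f, y f * ∑ b, if 1 ≤ w i + w (f b) then 1 else 0 := by
      intro i
      have := sum_mul_load y (fun j => if 1 ≤ w i + w j then 1 else 0)
      simpa only [hys, ite_mul, one_mul, zero_mul] using this
    have h2 := sum_mul_load y (fun i => ∑ j, (if 1 ≤ w i + w j then s j else 0))
    simp only [hys] at h2
    calc _ = ∑ i, (∑ j, (if 1 ≤ w i + w j then s j else 0)) * s i := by
          refine sum_congr rfl fun i _ => ?_
          rw [sum_mul]
          exact sum_congr rfl fun j _ => by split_ifs <;> ring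
      _ = _ := by
          rw [h2]
          refine sum_congr rfl fun e _ => ?_
          simp only [h1]
          rw [sum_comm, mul_sum]
          refine sum_congr rfl fun f _ => ?_
          simp [heavyPairs, mul_sum, mul_assoc]
  have hbound : ∀ e f, y e * y f * heavyPairs (w ∘ e) (w ∘ f) ≤
      y e * y f * (3 + zeroCount (w ∘ e) * zeroCount (w ∘ f)) ∧
      y e * y f * heavyPairs (w ∘ e) (w ∘ f) ≤ y e * y f * 5 := by
    intro e f
    by_cases he : y e = 0
    · simp [he]
    by_cases hf : y f = 0
    · simp [hf]
    obtain ⟨h1, h2⟩ := heavyPairs_le (u := w ∘ e) (v := w ∘ f) (fun _ => hw0 _) (fun _ => hw0 _)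
      (hyw e he) (hyw f hf)
    have h := mul_nonneg (hy0 e) (hy0 f)
    exact ⟨mul_le_mul_of_nonneg_left (by exact_mod_cast h1) h,
      mul_le_mul_of_nonneg_left (by exact_mod_cast h2) h⟩
  have hsq : (∑ e, y e) * (∑ f, y f) = ∑ e, ∑ f, y e * y f := sum_mul_sum _ _ _ _
  rw [hpairs, htot, hzero]
  constructor
  · refine (sum_le_sum fun e _ => sum_le_sum fun f _ => (hbound e f).1).trans_eq ?_
    have : (∑ e, y e * (zeroCount (w ∘ e) : ℝ)) ^ 2 =
        ∑ e, ∑ f, y e * y f * (zeroCount (w ∘ e) * zeroCount (w ∘ f)) := by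
      rw [sq, sum_mul_sum]
      exact sum_congr rfl fun e _ => sum_congr rfl fun f _ => by ring
    rw [this, show (3 * ∑ e, y e) ^ 2 / 3 = ((∑ e, y e) * (∑ f, y f)) * 3 by ring, hsq]
    simp only [mul_add, sum_add_distrib, sum_mul]
  · refine (sum_le_sum fun e _ => sum_le_sum fun f _ => (hbound e f).2).trans_eq ?_
    rw [show 5 / 9 * (3 * ∑ e, y e) ^ 2 = ((∑ e, y e) * (∑ f, y f)) * 5 by ring, hsq]
    simp only [sum_mul]

/-- Any fractional matching can be completed by constant triples to meet all capacities. -/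
theorem exists_saturated_extension {κ : Type*} [Fintype κ] {s w : κ → ℝ} {x : (Fin 3 → κ) → ℝ}
    (hx0 : ∀ e, 0 ≤ x e) (hxs : ∀ i, load x i ≤ s i) (hslack : ∀ i, load x i ≠ s i → w i = 0)
    (hxw : ∀ e, x e ≠ 0 → ∑ a, w (e a) ≤ 1) :
    ∃ y : (Fin 3 → κ) → ℝ, (∀ e, 0 ≤ y e) ∧ (∀ i, load y i = s i) ∧
      ∀ e, y e ≠ 0 → ∑ a, w (e a) ≤ 1 := by
  have hr : ∀ i, 0 ≤ (s i - load x i) / 3 := fun i => by have := hxs i; linarith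
  refine ⟨fun e => x e + ∑ i, if e = (fun _ => i) then (s i - load x i) / 3 else 0,
    fun e => add_nonneg (hx0 e) (sum_nonneg fun i _ => by split_ifs; exacts [hr i, le_rfl]),
    fun i => ?_, fun e he => ?_⟩
  · have : ∑ e : Fin 3 → κ, (∑ j, if e = (fun _ => j) then (s j - load x j) / 3 else 0) *
        (∑ a, if e a = i then (1 : ℝ) else 0) = s i - load x i := by
      simp only [sum_mul, ite_mul, zero_mul]
      rw [sum_comm]
      simp only [sum_ite_eq', mem_univ, if_true, sum_const, card_univ, Fintype.card_fin,
        nsmul_eq_mul, mul_ite, mul_one, mul_zero]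
      push_cast
      ring
    change ∑ e : Fin 3 → κ, (_ + _) * _ = _
    simp only [add_mul, sum_add_distrib]
    rw [this]
    exact add_sub_cancel _ _
  · by_cases hx : x e = 0
    · obtain ⟨i, -, hi⟩ := exists_ne_zero_of_sum_ne_zero (show
        ∑ i, (if e = (fun _ => i) then (s i - load x i) / 3 else 0) ≠ 0 by simpa [hx] using he)
      split_ifs at hi with h
      · subst h
        have : w i = 0 := hslack i fun h => hi (by rw [h]; simp)
        simp [this]
      · exact absurd rfl hi
    · exact hxw e hx

/-- A fractional matching on hole-free boxes can be rounded to an integral one. -/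
theorem exists_disjoint_tuples {V κ : Type*} [Fintype V] [Fintype κ] {R : (Fin 3 → V) → Prop}
    {ε : ℝ} (hε1 : ε ≤ 1) (c : V → κ) {x : (Fin 3 → κ) → ℝ} (hx0 : ∀ e, 0 ≤ x e)
    (hxs : ∀ i, load x i ≤ #{v | c v = i}) (hxR : ∀ e, x e ≠ 0 → HoleFree R ε c e) :
    ∃ T : Finset (Fin 3 → V), (∀ τ ∈ T, R τ) ∧
      (∀ τ ∈ T, ∀ τ' ∈ T, ∀ a b, τ a = τ' b → τ = τ') ∧
      (1 - ε) * ∑ e, x e - Fintype.card κ ^ 3 ≤ (#T : ℝ) := by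
  set P : Finset (Fin 3 → V) → Prop := fun T => (∀ τ ∈ T, R τ) ∧
      (∀ τ ∈ T, ∀ τ' ∈ T, ∀ a b, τ a = τ' b → τ = τ') ∧
      ∀ e, (#{τ ∈ T | c ∘ τ = e} : ℝ) ≤ (1 - ε) * x e with hP
  have hne : (univ.filter P).Nonempty :=
    ⟨∅, by simpa [hP] using fun e => mul_nonneg (sub_nonneg.2 hε1) (hx0 e)⟩
  obtain ⟨T, hT, hmax⟩ := exists_max_image (univ.filter P) card hne
  simp only [mem_filter, mem_univ, true_and] at hT hmax
  obtain ⟨hTR, hTd, hTc⟩ := hT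
  refine ⟨T, hTR, hTd, ?_⟩
  have hfull : ∀ e, (1 - ε) * x e - 1 ≤ (#{τ ∈ T | c ∘ τ = e} : ℝ) := by
    intro e
    by_contra! hlt
    have hxe : x e ≠ 0 := by
      intro h
      rw [h] at hlt
      have : (0 : ℝ) ≤ #{τ ∈ T | c ∘ τ = e} := by positivity
      linarith
    set U : Finset V := T.biUnion fun τ => univ.image τ with hU
    have hused : ∀ i, (#{v ∈ U | c v = i} : ℝ) ≤ (1 - ε) * #{v | c v = i} := by
      intro i
      have h1 : #{v ∈ U | c v = i} ≤ ∑ τ ∈ T, ∑ a, if c (τ a) = i then 1 else 0 := by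
        rw [hU, filter_biUnion]
        refine card_biUnion_le.trans (sum_le_sum fun τ _ => ?_)
        rw [filter_image, ← card_filter]
        exact card_image_le
      have h2 : (∑ τ ∈ T, ∑ a, if c (τ a) = i then (1 : ℝ) else 0) =
          ∑ e, (#{τ ∈ T | c ∘ τ = e} : ℝ) * ∑ a, if e a = i then 1 else 0 := by
        rw [← sum_fiberwise T (fun τ => c ∘ τ)]
        refine sum_congr rfl fun e _ => ?_
        rw [← nsmul_eq_mul, ← sum_const]
        refine sum_congr rfl fun τ hτ => ?_
        rw [← (mem_filter.1 hτ).2]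
        rfl
      calc (#{v ∈ U | c v = i} : ℝ) ≤ ∑ τ ∈ T, ∑ a, if c (τ a) = i then (1 : ℝ) else 0 := by
            exact_mod_cast h1
        _ ≤ (1 - ε) * load x i := by
            rw [h2, load, mul_sum]
            refine sum_le_sum fun e _ => ?_
            rw [← mul_assoc]
            exact mul_le_mul_of_nonneg_right (hTc e)
              (sum_nonneg fun a _ => by split_ifs <;> norm_num)
        _ ≤ _ := mul_le_mul_of_nonneg_left (hxs i) (sub_nonneg.2 hε1)
    obtain ⟨τ, hτ, hRτ⟩ := hxR e hxe (fun a => {v | c v = e a ∧ v ∉ U})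
      (fun a v hv => (mem_filter.1 hv).2.1) (fun a => by
        have h1 := hused (e a)
        have h2 : #{v ∈ U | c v = e a} + #{v | c v = e a ∧ v ∉ U} = #{v | c v = e a} := by
          rw [← card_filter_add_card_filter_not (s := {v | c v = e a}) (fun v => v ∈ U)]
          congr 2 <;> ext v <;> simp [and_comm]
        have h3 : (#{v ∈ U | c v = e a} : ℝ) + #{v | c v = e a ∧ v ∉ U} = #{v | c v = e a} := by
          exact_mod_cast h2
        linarith)
    simp only [Fintype.mem_piFinset, mem_filter, mem_univ, true_and] at hτ
    have hnU : ∀ τ' ∈ T, ∀ a b, τ a ≠ τ' b := fun τ' h' a b hab =>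
      (hτ a).2 (mem_biUnion.2 ⟨τ', h', by rw [hab]; exact mem_image_of_mem _ (mem_univ _)⟩)
    have hτT : τ ∉ T := fun h => hnU τ h 0 0 rfl
    have hce : c ∘ τ = e := funext fun a => (hτ a).1
    have hins : P (insert τ T) := by
      refine ⟨fun τ' h' => ?_, fun τ₁ h₁ τ₂ h₂ a b hab => ?_, fun f => ?_⟩
      · rcases mem_insert.1 h' with rfl | h'
        · exact hRτ
        · exact hTR _ h'
      · rcases mem_insert.1 h₁ with e₁ | e₁ <;> rcases mem_insert.1 h₂ with e₂ | e₂
        · rw [e₁, e₂]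
        · exact absurd (e₁ ▸ hab) (hnU _ e₂ a b)
        · exact absurd (e₂ ▸ hab.symm) (hnU _ e₁ b a)
        · exact hTd _ e₁ _ e₂ a b hab
      · rw [filter_insert]
        split_ifs with hf
        · have hef : e = f := hce.symm.trans hf
          subst hef
          rw [card_insert_of_notMem fun h => hτT (mem_filter.1 h).1]
          push_cast
          linarith
        · exact hTc f
    have := hmax _ hins
    rw [card_insert_of_notMem hτT] at this
    omega
  calc (1 - ε) * ∑ e, x e - Fintype.card κ ^ 3 = ∑ e, ((1 - ε) * x e - 1) := by
        rw [sum_sub_distrib, mul_sum]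
        simp
    _ ≤ ∑ e, (#{τ ∈ T | c ∘ τ = e} : ℝ) := sum_le_sum fun e _ => hfull e
    _ = #T := by
        rw [card_eq_sum_card_fiberwise (f := fun τ => c ∘ τ) (t := univ) (s := T)
          (fun _ _ => by simp)]
        push_cast
        rfl

theorem two_mul_deg_le_s8 {n : ℕ} {H : Finset (Finset (Fin n))} (hH : Is3Graph n H) (v : Fin n) :
    2 * deg H v ≤ #{p : Fin n × Fin n | univ.image ![v, p.1, p.2] ∈ H} := by
  have himg : ∀ x y : Fin n, univ.image ![v, x, y] = {v, x, y} := fun x y => by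
    ext z; simp [Fin.exists_fin_succ, eq_comm]
  rw [card_eq_sum_card_fiberwise (f := fun p : Fin n × Fin n => univ.image ![v, p.1, p.2])
      (t := H) (fun p hp => by simpa using hp), deg, card_filter, mul_sum]
  refine sum_le_sum fun e he => ?_
  split_ifs with hve
  · have h2 : #(e.erase v) = 2 := by rw [card_erase_of_mem hve, hH e he]
    obtain ⟨x, y, hxy, hexy⟩ := card_eq_two.1 h2
    have he' : e = {v, x, y} := by rw [← insert_erase hve, hexy]
    rw [mul_one, ← card_pair (show (x, y) ≠ (y, x) by simp [hxy])]
    refine card_le_card fun p hp => ?_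
    simp only [mem_filter, mem_univ, true_and]
    have : univ.image ![v, p.1, p.2] = e := by
      rw [he', himg]
      rcases mem_insert.1 hp with rfl | hp
      · rfl
      · rw [mem_singleton.1 hp, pair_comm]
    exact ⟨this ▸ he, this⟩
  · simp

theorem card_heavy_pairs {V κ : Type*} [Fintype V] [Fintype κ] (c : V → κ) (w : κ → ℝ) :
    (#{p : V × V | 1 ≤ w (c p.1) + w (c p.2)} : ℝ) =
      ∑ i, ∑ j, if 1 ≤ w i + w j then (#{v | c v = i} * #{v | c v = j} : ℝ) else 0 := by
  rw [card_eq_sum_card_fiberwise (f := fun p : V × V => (c p.1, c p.2)) (t := univ)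
    (fun _ _ => by simp), ← univ_product_univ, sum_product]
  push_cast
  refine sum_congr rfl fun i _ => sum_congr rfl fun j _ => ?_
  split_ifs with h
  · rw [← Nat.cast_mul, ← card_product]
    congr 2
    ext ⟨a, b⟩
    simp only [mem_filter, mem_univ, true_and, mem_product, Prod.mk.injEq]
    constructor
    · exact fun h => h.2
    · rintro ⟨rfl, rfl⟩
      exact ⟨h, rfl, rfl⟩
  · rw [Nat.cast_eq_zero, card_eq_zero, filter_eq_empty_iff]
    rintro ⟨a, b⟩ hp hab
    simp only [Prod.mk.injEq] at hab
    simp only [mem_filter, mem_univ, true_and] at hp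
    rw [hab.1, hab.2] at hp
    exact h hp

theorem card_zero_vertices {V κ : Type*} [Fintype V] [Fintype κ] (c : V → κ) (w : κ → ℝ) :
    (#{v | w (c v) = 0} : ℝ) = ∑ i, if w i = 0 then (#{v | c v = i} : ℝ) else 0 := by
  rw [card_eq_sum_card_fiberwise (f := c) (t := univ) (fun _ _ => by simp)]
  push_cast
  refine sum_congr rfl fun i _ => ?_
  split_ifs with h
  · congr 2
    ext v
    simp only [mem_filter, mem_univ, true_and]
    exact ⟨fun h => h.2, fun h' => ⟨h' ▸ h, h'⟩⟩
  · rw [Nat.cast_eq_zero, card_eq_zero, filter_eq_empty_iff]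
    intro v hv hvi
    simp only [mem_filter, mem_univ, true_and] at hv
    exact h (hvi ▸ hv)

/-- Few vertices lie in many exceptional tuples. -/
theorem card_exceptional_le {V : Type*} [Fintype V] (B : Finset (Fin 3 → V)) {ρ : ℝ} (hρ : 0 < ρ)
    (hB : (#B : ℝ) ≤ ρ ^ 2 * Fintype.card V ^ 3) :
    (#{v : V | ρ * Fintype.card V ^ 2 < #{p : V × V | ![v, p.1, p.2] ∈ B}} : ℝ) ≤
      ρ * Fintype.card V := by
  set n := Fintype.card V
  set S : Finset V := {v : V | ρ * n ^ 2 < #{p : V × V | ![v, p.1, p.2] ∈ B}}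
  rcases Nat.eq_zero_or_pos n with hn | hn
  · have := card_le_univ S
    have h0 : #S = 0 := by omega
    rw [h0, hn]; simp
  have hsum : ∑ v : V, #{p : V × V | ![v, p.1, p.2] ∈ B} ≤ #B := by
    rw [← card_sigma]
    refine card_le_card_of_injOn (fun q => ![q.1, q.2.1, q.2.2]) (fun q hq => ?_) ?_
    · simpa using hq
    · rintro ⟨v, a, b⟩ - ⟨v', a', b'⟩ - h
      have h0 := congrFun h 0
      have h1 := congrFun h 1
      have h2 := congrFun h 2
      simp at h0 h1 h2
      subst h0 h1 h2
      rfl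
  have h1 : #S * (ρ * n ^ 2) ≤ (#B : ℝ) := by
    calc #S * (ρ * n ^ 2) = ∑ v ∈ S, ρ * (n : ℝ) ^ 2 := by simp
      _ ≤ ∑ v ∈ S, (#{p : V × V | ![v, p.1, p.2] ∈ B} : ℝ) :=
          sum_le_sum fun v hv => (mem_filter.1 hv).2.le
      _ ≤ ∑ v : V, (#{p : V × V | ![v, p.1, p.2] ∈ B} : ℝ) :=
          sum_le_sum_of_subset_of_nonneg (subset_univ _) fun _ _ _ => by positivity
      _ ≤ #B := by exact_mod_cast hsum
  have h2 : (#S : ℝ) * (ρ * n ^ 2) ≤ (ρ * n) * (ρ * n ^ 2) := by linarith [h1.trans hB]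
  exact le_of_mul_le_mul_right h2 (by positivity)

/-- A nonempty set of `m` vertices contains one whose position in the ordering is at least `m`. -/
theorem exists_card_le_position {n : ℕ} (σ : Fin n ≃ Fin n) {S : Finset (Fin n)}
    (hS : S.Nonempty) : ∃ i : Fin n, σ i ∈ S ∧ #S ≤ (i : ℕ) + 1 := by
  obtain ⟨v, hv, hmax⟩ := exists_max_image S (fun v => (σ.symm v : ℕ)) hS
  refine ⟨σ.symm v, by simpa using hv, ?_⟩
  rw [← card_range ((σ.symm v : ℕ) + 1)]
  refine card_le_card_of_injOn (fun v => (σ.symm v : ℕ)) (fun u hu => ?_) fun a _ b _ h => ?_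
  · have := hmax u hu
    simp only [coe_range, Set.mem_Iio]
    omega
  · exact σ.symm.injective (Fin.ext h)

/-- The degree condition rules out a deficient fractional cover with few exceptional tuples. -/
theorem DegSeq4.not_deficient {n t : ℕ} {γ ρ : ℝ} {H : Finset (Finset (Fin n))}
    {σ : Fin n ≃ Fin n} (hσ : DegSeq4 γ t H σ) (hρ0 : 0 < ρ) (hρ1 : ρ ≤ 1) (hργ : 5 * ρ ≤ γ)
    (hγ : γ ≤ 1) (hn : 10 < γ * n) {N z : ℝ} (hN : N ≤ n ^ 2 / 3 + z ^ 2) (hN' : N ≤ 5 / 9 * n ^ 2)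
    (hz0 : 0 ≤ z) {S : Finset (Fin n)} (hS : S.Nonempty) (hSz : z - ρ * n ≤ #S)
    (hdeg : ∀ v ∈ S, 2 * (deg H v : ℝ) ≤ N + ρ * n ^ 2) : False := by
  obtain ⟨i, hiS, hi⟩ := exists_card_le_position σ hS
  have hd := hdeg _ hiS
  obtain ⟨h1, h2, h3⟩ := hσ.2 i
  rw [Nat.cast_choose_two] at h1 h2 h3
  have hzi : z ≤ ((i : ℕ) + 1 : ℝ) + ρ * n := by
    have : (#S : ℝ) ≤ (i : ℕ) + 1 := by exact_mod_cast hi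
    linarith
  have hin : ((i : ℕ) + 1 : ℝ) ≤ n := by exact_mod_cast i.2
  have hi0 : (0 : ℝ) ≤ (i : ℕ) + 1 := by positivity
  have hn0 : (0 : ℝ) ≤ n := by positivity
  have hIt : ((i : ℕ) + 1 : ℕ) ≤ t → ((i : ℕ) + 1 : ℝ) ≤ t := fun h => by exact_mod_cast h
  have hIn : 3 * ((i : ℕ) + 1 : ℕ) ≤ n → 3 * ((i : ℕ) + 1 : ℝ) ≤ n := fun h => by exact_mod_cast h
  generalize ((i : ℕ) + 1 : ℝ) = I at *
  have hγn : 10 * n ≤ γ * n ^ 2 := by nlinarith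
  have hρn : 5 * (ρ * n ^ 2) ≤ γ * n ^ 2 := by nlinarith [sq_nonneg (n : ℝ)]
  have hγ' : γ * n ≤ n := by nlinarith
  have hnpos : 0 < (n : ℝ) := by nlinarith
  have hγ0 : 0 < γ := by linarith
  have hz2 : z ^ 2 ≤ (I + ρ * n) ^ 2 := pow_le_pow_left₀ hz0 hzi 2
  have hρI : ρ * n * I ≤ ρ * n ^ 2 := by
    nlinarith [mul_le_mul_of_nonneg_left hin (mul_nonneg hρ0.le hn0)]
  have hρ2 : (ρ * n) ^ 2 ≤ ρ * n ^ 2 := by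
    nlinarith [mul_le_mul_of_nonneg_right hρ1 (mul_nonneg hρ0.le (sq_nonneg (n : ℝ)))]
  have hγ2 : 0 < γ * n ^ 2 := by positivity
  by_cases hc : (i : ℕ) + 1 ≤ t
  · have hII : I * I ≤ I * t := mul_le_mul_of_nonneg_left (hIt hc) hi0
    nlinarith [h1 hc]
  · by_cases hc' : 3 * ((i : ℕ) + 1) ≤ n
    · have hI2 : I ^ 2 ≤ (n / 3) ^ 2 := pow_le_pow_left₀ hi0 (by linarith [hIn hc']) 2
      nlinarith [h2 (by omega) hc']
    · nlinarith [h3 (by omega)]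

/-- Pairwise disjoint ordered edges form a matching. -/
theorem exists_matching_of_tuples {n : ℕ} {H : Finset (Finset (Fin n))} {T : Finset (Fin 3 → Fin n)}
    (hTH : ∀ τ ∈ T, univ.image τ ∈ H)
    (hT : ∀ τ ∈ T, ∀ τ' ∈ T, ∀ a b, τ a = τ' b → τ = τ') :
    ∃ M, IsMatching H M ∧ #M = #T := by
  refine ⟨T.image fun τ => univ.image τ, ⟨fun e he => ?_, ?_⟩, card_image_of_injOn ?_⟩
  · obtain ⟨τ, hτ, rfl⟩ := mem_image.1 he
    exact hTH τ hτ
  · simp only [mem_image]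
    rintro _ ⟨τ, hτ, rfl⟩ _ ⟨τ', hτ', rfl⟩ hne
    rw [disjoint_left]
    intro v hv hv'
    obtain ⟨a, -, ha⟩ := mem_image.1 hv
    obtain ⟨b, -, hb⟩ := mem_image.1 hv'
    exact hne (by rw [hT τ hτ τ' hτ' a b (ha.trans hb.symm)])
  · intro τ hτ τ' hτ' h
    have : τ 0 ∈ univ.image τ' := by
      rw [← show univ.image τ = univ.image τ' from h]
      exact mem_image_of_mem _ (mem_univ _)
    obtain ⟨b, -, hb⟩ := mem_image.1 this
    exact hT τ hτ τ' hτ' 0 b hb.symm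

theorem complementary_slackness {κ : Type*} [Fintype κ] {s w : κ → ℝ} {x : (Fin 3 → κ) → ℝ}
    (hw0 : ∀ i, 0 ≤ w i) (hx0 : ∀ e, 0 ≤ x e) (hxw : ∀ e, x e ≠ 0 → 1 ≤ ∑ a, w (e a))
    (hxs : ∀ i, load x i ≤ s i) (hsum : ∑ e, x e = ∑ i, w i * s i) :
    (∀ e, x e ≠ 0 → ∑ a, w (e a) ≤ 1) ∧ ∀ i, load x i ≠ s i → w i = 0 := by
  have h1 : ∀ e ∈ univ, x e ≤ x e * ∑ a, w (e a) := fun e _ => by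
    rcases eq_or_ne (x e) 0 with h | h
    · simp [h]
    · exact le_mul_of_one_le_right (hx0 e) (hxw e h)
  have h2 : ∀ i ∈ univ, w i * load x i ≤ w i * s i := fun i _ =>
    mul_le_mul_of_nonneg_left (hxs i) (hw0 i)
  have h3 := sum_mul_load x w
  have h4 := sum_le_sum h1
  have h5 := sum_le_sum h2
  have h1' := (sum_eq_sum_iff_of_le h1).1 (by linarith)
  have h2' := (sum_eq_sum_iff_of_le h2).1 (by linarith)
  refine ⟨fun e he => ?_, fun i hi => ?_⟩
  · exact (mul_left_cancel₀ he ((h1' e (mem_univ e)).symm.trans (mul_one _).symm)).le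
  · by_contra hw
    exact hi (mul_left_cancel₀ hw (h2' i (mem_univ i)))

/-- If the hole-free cells carry no nearly perfect fractional matching, there is a heavy-pair count
`N` and a set `S` of more than `z - ρ n` vertices whose degrees are at most `N + ρ n ^ 2`. -/
theorem exists_low_degree_vertices {n : ℕ} {κ : Type*} [Fintype κ] {H : Finset (Finset (Fin n))}
    (hH : Is3Graph n H) {ε η ρ : ℝ} (hρ0 : 0 < ρ) (hρη : ρ < η) (hn : 0 < n) (c : Fin n → κ)
    (hc : (#(holeTuples (fun τ => univ.image τ ∈ H) ε c) : ℝ) ≤ ρ ^ 2 * n ^ 3)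
    {w : κ → ℝ} {x : (Fin 3 → κ) → ℝ} (hw0 : ∀ i, 0 ≤ w i)
    (hw : ∀ e, HoleFree (fun τ => univ.image τ ∈ H) ε c e → 1 ≤ ∑ a, w (e a))
    (hx0 : ∀ e, 0 ≤ x e) (hxE : ∀ e, x e ≠ 0 → HoleFree (fun τ => univ.image τ ∈ H) ε c e)
    (hxs : ∀ i, load x i ≤ #{v | c v = i}) (hsum : ∑ e, x e = ∑ i, w i * #{v | c v = i})
    (hlt : ∑ e, x e < (1 - η) * n / 3) :
    ∃ N z : ℝ, N ≤ n ^ 2 / 3 + z ^ 2 ∧ N ≤ 5 / 9 * n ^ 2 ∧ 0 ≤ z ∧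
      ∃ S : Finset (Fin n), S.Nonempty ∧ z - ρ * n ≤ #S ∧
        ∀ v ∈ S, 2 * (deg H v : ℝ) ≤ N + ρ * n ^ 2 := by
  have hn' : (0 : ℝ) < n := by exact_mod_cast hn
  have htot : ∑ i, (#{v | c v = i} : ℝ) = n := by
    have := card_eq_sum_card_fiberwise (f := c) (s := univ) (t := univ) fun _ _ => by simp
    rw [card_univ, Fintype.card_fin] at this
    exact_mod_cast this.symm
  obtain ⟨hxw, hslack⟩ := complementary_slackness hw0 hx0 (fun e he => hw e (hxE e he)) hxs hsum
  obtain ⟨y, hy0, hys, hyw⟩ := exists_saturated_extension hx0 hxs hslack hxw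
  obtain ⟨hN1, hN2⟩ := sum_heavy_pairs_le hy0 hys hw0 hyw
  rw [htot, ← card_heavy_pairs, ← card_zero_vertices] at hN1
  rw [htot, ← card_heavy_pairs] at hN2
  have hz : η * n < (#{v | w (c v) = 0} : ℝ) := by
    have h1 := sum_mul_load x fun _ => 1
    simp only [one_mul, sum_const, card_univ, Fintype.card_fin, nsmul_eq_mul, mul_one,
      ← sum_mul] at h1
    have h2 : ∑ i, ((#{v | c v = i} : ℝ) - load x i) ≤
        ∑ i, if w i = 0 then (#{v | c v = i} : ℝ) else 0 := by
      refine sum_le_sum fun i _ => ?_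
      split_ifs with h
      · have : 0 ≤ load x i := sum_nonneg fun e _ => mul_nonneg (hx0 e) <|
          sum_nonneg fun a _ => by split_ifs <;> norm_num
        linarith
      · have := not_imp_comm.1 (hslack i) h
        linarith
    rw [sum_sub_distrib, htot, h1, ← card_zero_vertices] at h2
    push_cast at h2
    linarith
  set B : Finset (Fin 3 → Fin n) := {τ | univ.image τ ∈ H ∧
    ¬ HoleFree (fun τ => univ.image τ ∈ H) ε c (c ∘ τ)} with hB
  have hBcard : (#B : ℝ) ≤ ρ ^ 2 * Fintype.card (Fin n) ^ 3 := by
    rw [Fintype.card_fin]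
    refine le_trans (Nat.cast_le.2 (card_le_card fun τ hτ => ?_)) hc
    rw [hB, mem_filter] at hτ
    exact mem_holeTuples.2 ⟨⟨τ, rfl, hτ.2.1⟩, hτ.2.2⟩
  set X : Finset (Fin n) := {v | ρ * n ^ 2 < (#{p : Fin n × Fin n | ![v, p.1, p.2] ∈ B} : ℝ)}
    with hXdef
  have hX : (#X : ℝ) ≤ ρ * n := by
    convert card_exceptional_le B hρ0 hBcard <;> simp
  set Z : Finset (Fin n) := {v | w (c v) = 0} with hZ
  have hS : (#Z : ℝ) - ρ * n ≤ #(Z \ X) := by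
    have : (#Z : ℝ) ≤ #(Z \ X) + #X := by
      exact_mod_cast Nat.sub_le_iff_le_add.1 (le_card_sdiff X Z)
    linarith
  refine ⟨_, #Z, hN1, hN2, by positivity, Z \ X, ?_, hS, fun v hv => ?_⟩
  · rw [← card_pos]
    have : ρ * n < η * n := by gcongr
    have : (0 : ℝ) < #(Z \ X) := by linarith
    exact_mod_cast this
  · obtain ⟨hvZ, hvX⟩ := mem_sdiff.1 hv
    rw [hZ, mem_filter] at hvZ
    have hvX' : (#{p : Fin n × Fin n | ![v, p.1, p.2] ∈ B} : ℝ) ≤ ρ * n ^ 2 := by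
      by_contra h
      exact hvX (mem_filter.2 ⟨mem_univ _, not_le.1 h⟩)
    have hsub : ({p | univ.image ![v, p.1, p.2] ∈ H} : Finset (Fin n × Fin n)) ⊆
        ({p | 1 ≤ w (c p.1) + w (c p.2)} : Finset (Fin n × Fin n)) ∪
          ({p | ![v, p.1, p.2] ∈ B} : Finset (Fin n × Fin n)) := by
      intro p hp
      rw [mem_filter] at hp
      rw [mem_union, mem_filter, mem_filter, hB, mem_filter]
      by_cases hf : HoleFree (fun τ => univ.image τ ∈ H) ε c (c ∘ ![v, p.1, p.2])
      · have := hw _ hf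
        simp only [Fin.sum_univ_three, Function.comp_apply] at this
        change 1 ≤ w (c v) + w (c p.1) + w (c p.2) at this
        rw [hvZ.2, zero_add] at this
        exact Or.inl ⟨mem_univ _, this⟩
      · exact Or.inr ⟨mem_univ _, mem_univ _, hp.2, hf⟩
    have h1 : (2 * deg H v : ℝ) ≤ (#{p : Fin n × Fin n | 1 ≤ w (c p.1) + w (c p.2)} : ℝ) +
        #{p : Fin n × Fin n | ![v, p.1, p.2] ∈ B} := by
      exact_mod_cast (two_mul_deg_le_s8 hH v).trans ((card_le_card hsub).trans (card_union_le _ _))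
    linarith

/-- Large hypergraphs satisfying the degree condition have nearly perfect matchings. -/
theorem exists_large_matching {γ : ℝ} (hγ0 : 0 < γ) (hγ1 : γ ≤ 1) :
    ∃ n₀ : ℕ, ∀ n : ℕ, n₀ ≤ n → ∀ (t : ℕ) (H : Finset (Finset (Fin n))), Is3Graph n H →
      (∃ σ : Fin n ≃ Fin n, DegSeq4 γ t H σ) →
      ∃ M, IsMatching H M ∧ (1 - γ / 2) * n / 3 ≤ #M := by
  obtain ⟨K, hK⟩ := exists_regular_coloring (ε := γ / 8) (δ := (γ / 16) ^ 2) (by positivity)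
    (by positivity)
  obtain ⟨n₀, hn₀⟩ := exists_nat_gt ((12 * (K : ℝ) ^ 3 + 10) / γ)
  refine ⟨n₀, fun n hn t H hH ⟨σ, hσ⟩ => ?_⟩
  have hnγ : 12 * (K : ℝ) ^ 3 + 10 < γ * n := by
    have : (n₀ : ℝ) ≤ n := by exact_mod_cast hn
    rw [div_lt_iff₀ hγ0] at hn₀
    nlinarith
  have hK0 : (0 : ℝ) ≤ (K : ℝ) ^ 3 := by positivity
  have hnpos : 0 < n := by
    rcases Nat.eq_zero_or_pos n with rfl | h
    · norm_num at hnγ; linarith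
    · exact h
  obtain ⟨κ, _, c, hcard, hc⟩ := hK (Fin n) fun τ => univ.image τ ∈ H
  rw [Fintype.card_fin] at hc
  obtain ⟨w, x, hw0, hw, hx0, hxE, hxs, hsum⟩ :=
    exists_fractional_matching_cover (fun i => (#{v | c v = i} : ℝ)) (fun i => by positivity)
      {e | HoleFree (fun τ => univ.image τ ∈ H) (γ / 8) c e}
  have hxE' : ∀ e, x e ≠ 0 → HoleFree (fun τ => univ.image τ ∈ H) (γ / 8) c e := fun e he => by
    by_contra h
    exact he (hxE e (by simpa using h))
  rcases le_or_gt ((1 - γ / 8) * n / 3) (∑ e, x e) with h | h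
  · obtain ⟨T, hTR, hTd, hTcard⟩ := exists_disjoint_tuples (by linarith) c hx0 hxs hxE'
    obtain ⟨M, hM, hMT⟩ := exists_matching_of_tuples hTR hTd
    refine ⟨M, hM, ?_⟩
    rw [hMT]
    have h1 : (1 - γ / 8) * ((1 - γ / 8) * n / 3) ≤ (1 - γ / 8) * ∑ e, x e :=
      mul_le_mul_of_nonneg_left h (by linarith)
    have h2 : (Fintype.card κ : ℝ) ^ 3 ≤ (K : ℝ) ^ 3 := by gcongr
    have h3 : 0 ≤ γ ^ 2 * n := by positivity
    nlinarith
  · obtain ⟨N, z, hN1, hN2, hz, S, hS, hSz, hdeg⟩ := exists_low_degree_vertices hH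
      (ρ := γ / 16) (by positivity) (by linarith) hnpos c hc hw0
      (fun e he => hw e (by simpa using he)) hx0 hxE' hxs hsum h
    exact (hσ.not_deficient (ρ := γ / 16) (by positivity) (by linarith) (by linarith) hγ1
      (by linarith) hN1 hN2 hz hS hSz hdeg).elim

/-- Few vertices fail to be big. -/
theorem DegSeq4.card_compl_V59_le {n t : ℕ} {γ : ℝ} {H : Finset (Finset (Fin n))}
    {σ : Fin n ≃ Fin n} (hσ : DegSeq4 γ t H σ) (hγ : 0 ≤ γ) : 3 * #(univ \ V59 γ H) ≤ n := by
  rcases (univ \ V59 γ H).eq_empty_or_nonempty with h | h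
  · simp [h]
  · obtain ⟨i, hi, hle⟩ := exists_card_le_position σ h
    by_contra hlt
    refine (mem_sdiff.1 hi).2 (mem_filter.2 ⟨mem_univ _, le_trans ?_ ((hσ.2 i).2.2 (by omega))⟩)
    gcongr
    linarith

/-- The degree condition is only satisfiable for small error terms. -/
theorem DegSeq4.le_one_sixth {n t : ℕ} {γ : ℝ} {H : Finset (Finset (Fin n))} (hH : Is3Graph n H)
    {σ : Fin n ≃ Fin n} (hσ : DegSeq4 γ t H σ) (hn : 10 ≤ n) : γ ≤ 1 / 6 := by
  have h1 := (hσ.2 ⟨n - 1, by omega⟩).2.2 (by simp only; omega)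
  rw [Nat.cast_choose_two] at h1
  have h2 : 2 * deg H (σ ⟨n - 1, by omega⟩) ≤ n * n :=
    (two_mul_deg_le_s8 hH _).trans ((card_le_univ _).trans_eq (by simp))
  have h3 : 2 * (deg H (σ ⟨n - 1, by omega⟩) : ℝ) ≤ n * n := by exact_mod_cast h2
  have h4 : (10 : ℝ) ≤ n := by exact_mod_cast hn
  by_contra! h
  have h5 : (5 / 9 + 4 * (1 / 6)) * ((n : ℝ) * (n - 1)) ≤ (5 / 9 + 4 * γ) * (n * (n - 1)) := by
    have : (0 : ℝ) ≤ n * (n - 1) := mul_nonneg (by linarith) (by linarith)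
    gcongr
  nlinarith

/-- Deleting edges of a matching that meet the set `W` frees many vertices of `W`. -/
theorem exists_submatching {n : ℕ} {H M : Finset (Finset (Fin n))} (hH : Is3Graph n H)
    (hM : IsMatching H M) (W : Finset (Fin n)) {m : ℕ} (hm : m ≤ #M)
    (hW : #(univ \ W) ≤ 3 * m) :
    ∃ M', IsMatching H M' ∧ #M' = m ∧ #M ≤ m + #(leave M' ∩ W) := by
  set A : Finset (Finset (Fin n)) := {e ∈ M | Disjoint e W} with hA
  have hAM : A ⊆ M := filter_subset _ _
  have hAcard : #A ≤ m := by
    have h1 : #(A.biUnion id) = ∑ e ∈ A, #e :=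
      card_biUnion fun e he f hf hef => hM.2 e (hAM he) f (hAM hf) hef
    rw [sum_congr rfl fun e he => hH e (hM.1 (hAM he))] at h1
    have h2 : A.biUnion id ⊆ univ \ W := fun v hv => by
      obtain ⟨e, he, hve⟩ := mem_biUnion.1 hv
      exact mem_sdiff.2 ⟨mem_univ _, disjoint_left.1 (mem_filter.1 he).2 hve⟩
    have h3 := card_le_card h2
    simp only [sum_const, smul_eq_mul] at h1
    omega
  obtain ⟨M', hAM', hM'M, hM'⟩ := exists_subsuperset_card_eq hAM hAcard hm
  refine ⟨M', ⟨hM'M.trans hM.1, fun e he f hf => hM.2 e (hM'M he) f (hM'M hf)⟩, hM', ?_⟩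
  have h1 : #((M \ M').biUnion fun e => e ∩ W) = ∑ e ∈ M \ M', #(e ∩ W) :=
    card_biUnion fun e he f hf hef =>
      (hM.2 e (mem_sdiff.1 he).1 f (mem_sdiff.1 hf).1 hef).mono inter_subset_left inter_subset_left
  have h2 : #(M \ M') ≤ ∑ e ∈ M \ M', #(e ∩ W) := by
    rw [card_eq_sum_ones]
    refine sum_le_sum fun e he => card_pos.2 ?_
    rw [← not_disjoint_iff_nonempty_inter]
    exact fun h => (mem_sdiff.1 he).2 (hAM' (mem_filter.2 ⟨(mem_sdiff.1 he).1, h⟩))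
  have h3 : ((M \ M').biUnion fun e => e ∩ W) ⊆ leave M' ∩ W := fun v hv => by
    obtain ⟨e, he, hve⟩ := mem_biUnion.1 hv
    obtain ⟨heM, heM'⟩ := mem_sdiff.1 he
    obtain ⟨hve, hvW⟩ := mem_inter.1 hve
    refine mem_inter.2 ⟨mem_sdiff.2 ⟨mem_univ _, fun hc => ?_⟩, hvW⟩
    obtain ⟨f, hf, hvf⟩ := mem_biUnion.1 hc
    exact disjoint_left.1 (hM.2 e heM f (hM'M hf) fun h => heM' (h ▸ hf)) hve hvf
  have h4 := card_le_card h3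
  have h5 := card_sdiff_add_card_eq_card hM'M
  omega

/-- Corollary `betterdegreecor`: for `γ > 0` and `n` sufficiently large, every `3`-graph
`H` on `n` vertices satisfying the degree sequence condition (for some `t` with
`1 ≤ t ≤ n/(3√2)`) contains a matching `M*` with `|M*| = ⌊(n − γn)/3⌋` and
`|L(M*) ∩ V_{5/9}| > 2γn/75`. -/
theorem better_degree_cor (γ : ℝ) (hγ : 0 < γ) :
    ∃ n₀ : ℕ, ∀ n : ℕ, n₀ ≤ n →
      ∀ t : ℕ, 1 ≤ t → (t : ℝ) ≤ (n : ℝ) / (3 * Real.sqrt 2) →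
      ∀ H : Finset (Finset (Fin n)), Is3Graph n H →
      (∃ σ : Fin n ≃ Fin n, DegSeq4 γ t H σ) →
      ∃ Mstar, IsMatching H Mstar ∧ Mstar.card = ⌊((n : ℝ) - γ * n) / 3⌋₊ ∧
        2 * γ * n / 75 < ((leave Mstar ∩ V59 γ H).card : ℝ) := by
  by_cases hγ1 : γ ≤ 1
  · obtain ⟨n₀, hn₀⟩ := exists_large_matching hγ hγ1
    refine ⟨max n₀ 10, fun n hn t _ _ H hH ⟨σ, hσ⟩ => ?_⟩
    have hn10 : 10 ≤ n := le_of_max_le_right hn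
    have hn10' : (10 : ℝ) ≤ n := by exact_mod_cast hn10
    have hγ6 := hσ.le_one_sixth hH hn10
    obtain ⟨M, hM, hMcard⟩ := hn₀ n (le_of_max_le_left hn) t H hH ⟨σ, hσ⟩
    have hγn : γ * n ≤ 1 / 6 * n := by gcongr
    have hγn0 : 0 < γ * n := by positivity
    have hfloor := Nat.floor_le (show 0 ≤ ((n : ℝ) - γ * n) / 3 by linarith)
    have hfloor' := Nat.lt_floor_add_one (((n : ℝ) - γ * n) / 3)
    set m := ⌊((n : ℝ) - γ * n) / 3⌋₊
    have hm : m ≤ #M := by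
      have : (m : ℝ) ≤ #M := by linarith
      exact_mod_cast this
    have hW : #(univ \ V59 γ H) ≤ 3 * m := by
      have h1 : 3 * (#(univ \ V59 γ H) : ℝ) ≤ n := by
        exact_mod_cast hσ.card_compl_V59_le hγ.le
      have h2 : (#(univ \ V59 γ H) : ℝ) ≤ 3 * m := by linarith
      exact_mod_cast h2
    obtain ⟨M', hM', hM'card, hleave⟩ := exists_submatching hH hM (V59 γ H) hm hW
    refine ⟨M', hM', hM'card, ?_⟩
    have : (#M : ℝ) ≤ m + #(leave M' ∩ V59 γ H) := by exact_mod_cast hleave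
    linarith
  · refine ⟨10, fun n hn t _ _ H hH ⟨σ, hσ⟩ => ?_⟩
    have := hσ.le_one_sixth hH hn
    linarith
end
end

section
/- Let H be a 3-graph and let e, f be disjoint 3-element subsets of V(H). Let x, y ∈ V(H) \ (e ∪ f) with x ≠ y, and suppose |E(L_x(e,f))| ≥ 4 and |E(L_y(e,f))| ≥ 4. Then {e,f} has an {x,y}-matching. -/
open Finset
open scoped Classical

noncomputable section

/-- The number of edges of the `3`-tuple link graph `L_v(e,f)` for disjoint `3`-sets
`e, f`: the number of pairs `(u, w) ∈ e × f` such that `{v, u, w}` is an edge of `H`. -/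
def linkCount {n : ℕ} (H : Finset (Finset (Fin n))) (v : Fin n)
    (e f : Finset (Fin n)) : ℕ :=
  ((e ×ˢ f).filter fun p => ({v, p.1, p.2} : Finset (Fin n)) ∈ H).card

/-- `{e,f}` has an `{x,y}`-matching: there are distinct `e₁, e₂ ∈ e` and distinct
`f₁, f₂ ∈ f` with `{x,e₁,f₁} ∈ E(H)` and `{y,e₂,f₂} ∈ E(H)`. -/
def HasXYMatching {n : ℕ} (H : Finset (Finset (Fin n))) (x y : Fin n)
    (e f : Finset (Fin n)) : Prop :=
  ∃ e₁ ∈ e, ∃ e₂ ∈ e, ∃ f₁ ∈ f, ∃ f₂ ∈ f, e₁ ≠ e₂ ∧ f₁ ≠ f₂ ∧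
    ({x, e₁, f₁} : Finset (Fin n)) ∈ H ∧ ({y, e₂, f₂} : Finset (Fin n)) ∈ H

/-- A set of more than `k` cells in a grid with sides at most `k` contains two cells lying in
different rows and different columns. -/
theorem exists_fst_ne_snd_ne_of_lt_card {α β : Type*} {s : Finset α} {t : Finset β}
    {A : Finset (α × β)} {k : ℕ} (hA : A ⊆ s ×ˢ t) (hs : s.card ≤ k) (ht : t.card ≤ k)
    (hk : k < A.card) : ∃ p ∈ A, ∃ q ∈ A, p.1 ≠ q.1 ∧ p.2 ≠ q.2 := by
  obtain ⟨a, ha⟩ : A.Nonempty := card_pos.mp (by omega)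
  obtain ⟨b, hb, hb1⟩ : ∃ b ∈ A, b.1 ≠ a.1 := by
    by_contra! h
    have := card_le_card_of_injOn (t := t) Prod.snd
      (fun p hp => (mem_product.mp (hA hp)).2)
      (fun p hp q hq hpq => Prod.ext ((h p hp).trans (h q hq).symm) hpq)
    omega
  obtain ⟨c, hc, hc2⟩ : ∃ c ∈ A, c.2 ≠ a.2 := by
    by_contra! h
    have := card_le_card_of_injOn (t := s) Prod.fst
      (fun p hp => (mem_product.mp (hA hp)).1)
      (fun p hp q hq hpq => Prod.ext hpq ((h p hp).trans (h q hq).symm))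
    omega
  grind

/-- If every cell of `B` shares a row or a column with each of two cells `p`, `q` in general
position, then `B` has at most two cells. -/
theorem card_le_two_of_fst_eq_or_snd_eq {α β : Type*} {B : Finset (α × β)} {p q : α × β}
    (h1 : p.1 ≠ q.1) (h2 : p.2 ≠ q.2) (hp : ∀ b ∈ B, p.1 = b.1 ∨ p.2 = b.2)
    (hq : ∀ b ∈ B, q.1 = b.1 ∨ q.2 = b.2) : B.card ≤ 2 := by
  have hB : B ⊆ {(p.1, q.2), (q.1, p.2)} := by
    intro b hb
    have := hp b hb
    have := hq b hb
    simp only [mem_insert, mem_singleton, Prod.ext_iff]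
    grind
  exact (card_le_card hB).trans card_le_two

/-- Fact: if `e, f` are disjoint `3`-element subsets, `x ≠ y` are vertices outside
`e ∪ f`, and both link graphs `L_x(e,f)`, `L_y(e,f)` have at least `4` edges, then
`{e,f}` has an `{x,y}`-matching. -/
theorem xy_matching_fact (n : ℕ) (H : Finset (Finset (Fin n))) (hH : Is3Graph n H)
    (e f : Finset (Fin n)) (he : e.card = 3) (hf : f.card = 3) (hef : Disjoint e f)
    (x y : Fin n) (hx : x ∉ e ∪ f) (hy : y ∉ e ∪ f) (hxy : x ≠ y)
    (h4x : 4 ≤ linkCount H x e f) (h4y : 4 ≤ linkCount H y e f) :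
    HasXYMatching H x y e f := by
  obtain ⟨p, hp, q, hq, h1, h2⟩ := exists_fst_ne_snd_ne_of_lt_card
    (filter_subset _ _) he.le hf.le (Nat.lt_of_succ_le h4x)
  by_contra hno
  have key : ∀ a ∈ (e ×ˢ f).filter (fun p => ({x, p.1, p.2} : Finset (Fin n)) ∈ H),
      ∀ b ∈ (e ×ˢ f).filter (fun p => ({y, p.1, p.2} : Finset (Fin n)) ∈ H),
      a.1 = b.1 ∨ a.2 = b.2 := by
    intro a ha b hb
    by_contra! hab
    simp only [mem_filter, mem_product] at ha hb
    exact hno ⟨a.1, ha.1.1, b.1, hb.1.1, a.2, ha.1.2, b.2, hb.1.2, hab.1, hab.2, ha.2, hb.2⟩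
  have := h4y.trans (card_le_two_of_fst_eq_or_snd_eq h1 h2 (key p hp) (key q hq))
  omega
end
end

section
/- Let γ > 0 and let H be a 3-graph on n vertices (n sufficiently large in terms of γ) with degree sequence d₁ ≤ … ≤ dₙ such that, for some t with 1 ≤ t ≤ n/(3√2), dᵢ ≥ (1/3 + 4γ)·C(n,2) + i·t for 1 ≤ i ≤ t, dᵢ ≥ (4/9 + 4γ)·C(n,2) for t < i ≤ n/3, and dᵢ ≥ (5/9 + 4γ)·C(n,2) for i > n/3. Let M be a phantom matching in H, let x, y ∈ L(M), and let {e,f} ∈ (M choose 2). Suppose there exists i ∈ {4,5,6,7} such that {e,f} ∈ S^i_M and |E(L_x(e,f))| ≥ i and |E(L_y(e,f))| ≥ i. Then {x,y} is a 5/9th swapping pair for {e,f}. -/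
open Finset
open scoped Classical

noncomputable section

/-- `M` is a maximum matching in `H`. -/
def IsMaximumMatching {n : ℕ} (H M : Finset (Finset (Fin n))) : Prop :=
  IsMatching H M ∧ ∀ N, IsMatching H N → N.card ≤ M.card

/-- `v` is not-small: `deg v ≥ (4/9 + γ)·C(n,2)` (i.e. `v ∈ V_{4/9} ∪ V_{5/9}`);
its negation says `v` is a small (3/9th) vertex. -/
def notSmall {n : ℕ} (γ : ℝ) (H : Finset (Finset (Fin n))) (v : Fin n) : Prop :=
  ((4 : ℝ)/9 + γ) * (n.choose 2) ≤ (deg H v : ℝ)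

/-- `M` is a phantom matching in `H` (w.r.t. `γ`): a collection of pairwise disjoint
`3`-element subsets of `V(H)` with `|M| = ⌊(n − γn)/3⌋` such that some maximum matching
`M'` of `H` satisfies `M' ⊆ M` or `M ⊆ M'`. -/
def IsPhantomMatching {n : ℕ} (γ : ℝ) (H M : Finset (Finset (Fin n))) : Prop :=
  (∀ e ∈ M, e.card = 3) ∧
  (∀ e ∈ M, ∀ f ∈ M, e ≠ f → Disjoint e f) ∧
  M.card = ⌊((n : ℝ) - γ * n) / 3⌋₊ ∧
  ∃ M', IsMaximumMatching H M' ∧ (M' ⊆ M ∨ M ⊆ M')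

/-- The index `I_H(v)` of a vertex under the degree ordering `σ` (0-based;
only order comparisons are used). -/
def idx {n : ℕ} (σ : Fin n ≃ Fin n) (v : Fin n) : ℕ :=
  (σ.symm v : ℕ)

/-- `b(e)`: the number of big (5/9th) vertices in the `3`-tuple `e`. -/
def bcount {n : ℕ} (γ : ℝ) (H : Finset (Finset (Fin n))) (e : Finset (Fin n)) : ℕ :=
  (e.filter fun v => big γ H v).card

/-- `{e,f} ∈ S^i_M`, where the partition of pairs of `3`-tuples of `M` is:
`S^4` = pairs with `max(b(e),b(f)) = 3`; `S^5` = remaining pairs with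
`min(b(e),b(f)) ≥ 1` and `max(b(e),b(f)) ≥ 2`; `S^6` = remaining pairs with
`min(b(e),b(f)) ≥ 1`; `S^7` = remaining pairs with `max(b(e),b(f)) ≥ 1`;
any other `i` denotes `S^10`, the remaining pairs. -/
def Smem {n : ℕ} (γ : ℝ) (H : Finset (Finset (Fin n))) (i : ℕ)
    (e f : Finset (Fin n)) : Prop :=
  match i with
  | 4 => max (bcount γ H e) (bcount γ H f) = 3
  | 5 => ¬ (max (bcount γ H e) (bcount γ H f) = 3) ∧
         (1 ≤ min (bcount γ H e) (bcount γ H f) ∧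
          2 ≤ max (bcount γ H e) (bcount γ H f))
  | 6 => ¬ (max (bcount γ H e) (bcount γ H f) = 3) ∧
         ¬ (1 ≤ min (bcount γ H e) (bcount γ H f) ∧
            2 ≤ max (bcount γ H e) (bcount γ H f)) ∧
         1 ≤ min (bcount γ H e) (bcount γ H f)
  | 7 => ¬ (max (bcount γ H e) (bcount γ H f) = 3) ∧
         ¬ (1 ≤ min (bcount γ H e) (bcount γ H f) ∧
            2 ≤ max (bcount γ H e) (bcount γ H f)) ∧
         ¬ (1 ≤ min (bcount γ H e) (bcount γ H f)) ∧
         1 ≤ max (bcount γ H e) (bcount γ H f)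
  | _ => ¬ (max (bcount γ H e) (bcount γ H f) = 3) ∧
         ¬ (1 ≤ min (bcount γ H e) (bcount γ H f) ∧
            2 ≤ max (bcount γ H e) (bcount γ H f)) ∧
         ¬ (1 ≤ min (bcount γ H e) (bcount γ H f)) ∧
         ¬ (1 ≤ max (bcount γ H e) (bcount γ H f))

/-- `{x,y}` is a 5/9th swapping pair for `{e,f}`: there is an `{x,y}`-matching
`{x,e₁,f₁}, {y,e₂,f₂}` such that one of the remaining vertices `e₃ ∈ e`, `f₃ ∈ f`
is big. -/
def Is59SwappingPair {n : ℕ} (γ : ℝ) (H : Finset (Finset (Fin n)))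
    (x y : Fin n) (e f : Finset (Fin n)) : Prop :=
  ∃ e₁ e₂ e₃ f₁ f₂ f₃ : Fin n,
    e = {e₁, e₂, e₃} ∧ f = {f₁, f₂, f₃} ∧
    e₁ ≠ e₂ ∧ e₁ ≠ e₃ ∧ e₂ ≠ e₃ ∧ f₁ ≠ f₂ ∧ f₁ ≠ f₃ ∧ f₂ ≠ f₃ ∧
    ({x, e₁, f₁} : Finset (Fin n)) ∈ H ∧ ({y, e₂, f₂} : Finset (Fin n)) ∈ H ∧
    (big γ H e₃ ∨ big γ H f₃)

/-- Cells `p, q` of the `3 × 3` grid lie in distinct rows and columns, and the row they miss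
is among the first `a` or the column they miss is among the first `b`. The index of `Fin 3`
other than `i ≠ j` is `-(i + j)`. -/
abbrev Swappable (a b : ℕ) (p q : Fin 3 × Fin 3) : Prop :=
  p.1 ≠ q.1 ∧ p.2 ≠ q.2 ∧ ((-(p.1 + q.1)).val < a ∨ (-(p.2 + q.2)).val < b)

/-- `m` edges in each of two bipartite graphs on `3 + 3` vertices force a swappable pair
when the first `a` rows and `b` columns are big. -/
def ForcesSwap (a b m : ℕ) : Prop :=
  ∀ G : Finset (Fin 3 × Fin 3), m ≤ #G →
    #{q : Fin 3 × Fin 3 | ∀ p ∈ G, ¬ Swappable a b p q} < m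

theorem forcesSwap_three_zero : ForcesSwap 3 0 4 := by unfold ForcesSwap; decide +kernel

theorem forcesSwap_one_two : ForcesSwap 1 2 5 := by unfold ForcesSwap; decide +kernel

theorem forcesSwap_one_one : ForcesSwap 1 1 6 := by unfold ForcesSwap; decide +kernel

theorem forcesSwap_one_zero : ForcesSwap 1 0 7 := by unfold ForcesSwap; decide +kernel

theorem ForcesSwap.exists_swappable {a b m : ℕ} (h : ForcesSwap a b m)
    {G K : Finset (Fin 3 × Fin 3)} (hG : m ≤ #G) (hK : m ≤ #K) :
    ∃ p ∈ G, ∃ q ∈ K, Swappable a b p q := by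
  by_contra! hne
  have hsub : K ⊆ univ.filter fun q => ∀ p ∈ G, ¬ Swappable a b p q := fun q hq =>
    mem_filter.2 ⟨mem_univ q, fun p hp => hne p hp q hq⟩
  exact absurd (h G hG) (not_lt.2 (hK.trans (card_le_card hsub)))

/-- A `3`-set can be enumerated with elements satisfying `P` coming first. -/
theorem exists_enumeration_of_card_eq_three {α : Type*} [DecidableEq α] {e : Finset α} (he : #e = 3)
    (P : α → Prop) {k : ℕ} (hk : k ≤ #{v ∈ e | P v}) :
    ∃ u : Fin 3 → α, Function.Injective u ∧ univ.image u = e ∧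
      ∀ i : Fin 3, i.val < k → P (u i) := by
  set l := {v ∈ e | P v}.toList ++ {v ∈ e | ¬ P v}.toList with hl
  have hlen : l.length = 3 := by
    rw [hl, List.length_append, length_toList, length_toList, card_filter_add_card_filter_not, he]
  have hnodup : l.Nodup := by
    refine List.Nodup.append (nodup_toList _) (nodup_toList _) fun v hv hv' => ?_
    simp only [mem_toList, mem_filter] at hv hv'
    exact hv'.2 hv.2
  have hinj : Function.Injective fun i : Fin 3 => l.get (i.cast hlen.symm) :=
    (List.nodup_iff_injective_get.1 hnodup).comp (Fin.cast_injective _)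
  refine ⟨fun i => l.get (i.cast hlen.symm), hinj, ?_, fun i hi => ?_⟩
  · refine eq_of_subset_of_card_le (fun v hv => ?_) ?_
    · obtain ⟨i, -, rfl⟩ := mem_image.1 hv
      have hle : ∀ v ∈ l, v ∈ e := fun v hv => by
        rw [hl, List.mem_append, mem_toList, mem_toList, mem_filter, mem_filter] at hv
        exact hv.elim And.left And.left
      exact hle _ (List.get_mem l _)
    · rw [card_image_of_injective _ hinj, he, card_univ, Fintype.card_fin]
  · have hi' : i.val < {v ∈ e | P v}.toList.length := by
      rw [length_toList]; exact hi.trans_le hk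
    have hmem := List.getElem_mem hi'
    rw [mem_toList, mem_filter] at hmem
    simpa [hl, List.getElem_append_left hi'] using hmem.2

theorem linkCount_image {n : ℕ} (H : Finset (Finset (Fin n))) (x : Fin n) {u w : Fin 3 → Fin n}
    (hu : Function.Injective u) (hw : Function.Injective w) :
    linkCount H x (univ.image u) (univ.image w) =
      #{p : Fin 3 × Fin 3 | {x, u p.1, w p.2} ∈ H} := by
  rw [linkCount, ← card_image_of_injective _ (hu.prodMap hw)]
  congr 1
  ext ⟨a, b⟩
  simp only [mem_filter, mem_product, mem_image, mem_univ, true_and, Prod.exists, Prod.map,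
    Prod.mk.injEq]
  grind

theorem linkCount_comm {n : ℕ} (H : Finset (Finset (Fin n))) (x : Fin n)
    (e f : Finset (Fin n)) : linkCount H x e f = linkCount H x f e := by
  refine card_bij' (fun p _ => p.swap) (fun p _ => p.swap) ?_ ?_ (by simp) (by simp) <;>
  · rintro ⟨a, b⟩ h
    simp only [mem_filter, mem_product, Prod.swap] at h ⊢
    exact ⟨h.1.symm, by rw [pair_comm]; exact h.2⟩

theorem Is59SwappingPair.symm {n : ℕ} {γ : ℝ} {H : Finset (Finset (Fin n))} {x y : Fin n}
    {e f : Finset (Fin n)} (h : Is59SwappingPair γ H x y e f) :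
    Is59SwappingPair γ H x y f e := by
  obtain ⟨e₁, e₂, e₃, f₁, f₂, f₃, he, hf, h₁, h₂, h₃, h₄, h₅, h₆, hx, hy, hbig⟩ := h
  exact ⟨f₁, f₂, f₃, e₁, e₂, e₃, hf, he, h₄, h₅, h₆, h₁, h₂, h₃, by rwa [pair_comm f₁],
    by rwa [pair_comm f₂], hbig.symm⟩

theorem image_univ_eq_triple {α : Type*} [DecidableEq α] (u : Fin 3 → α) {i j : Fin 3} (hij : i ≠ j) :
    univ.image u = {u i, u j, u (-(i + j))} := by
  have huniv : (univ : Finset (Fin 3)) = {i, j, -(i + j)} := by decide +revert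
  rw [huniv, image_insert, image_insert, image_singleton]

theorem is59SwappingPair_of_forcesSwap {n : ℕ} {γ : ℝ} {H : Finset (Finset (Fin n))}
    {x y : Fin n} {e f : Finset (Fin n)} {a b m : ℕ} (h : ForcesSwap a b m)
    (he : #e = 3) (hf : #f = 3) (ha : a ≤ bcount γ H e) (hb : b ≤ bcount γ H f)
    (hx : m ≤ linkCount H x e f) (hy : m ≤ linkCount H y e f) :
    Is59SwappingPair γ H x y e f := by
  obtain ⟨u, hu, rfl, hubig⟩ := exists_enumeration_of_card_eq_three he _ ha
  obtain ⟨w, hw, rfl, hwbig⟩ := exists_enumeration_of_card_eq_three hf _ hb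
  rw [linkCount_image H _ hu hw] at hx hy
  obtain ⟨p, hp, q, hq, hrow, hcol, hthird⟩ := h.exists_swappable hx hy
  have hne : ∀ {i j : Fin 3}, i ≠ j → i ≠ -(i + j) ∧ j ≠ -(i + j) := by decide
  exact ⟨u p.1, u q.1, _, w p.2, w q.2, _, image_univ_eq_triple u hrow,
    image_univ_eq_triple w hcol, hu.ne hrow, hu.ne (hne hrow).1, hu.ne (hne hrow).2,
    hw.ne hcol, hw.ne (hne hcol).1, hw.ne (hne hcol).2, (mem_filter.1 hp).2, (mem_filter.1 hq).2,
    hthird.imp (hubig _) (hwbig _)⟩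

/-- Lemma `4/9thsswappinglem`: for `γ > 0` and `n` sufficiently large, let `H` be a
`3`-graph on `n` vertices satisfying the degree sequence condition `DegSeq4` (for some
`t` with `1 ≤ t ≤ n/(3√2)`).  Let `M` be a phantom matching in `H`, let `x, y ∈ L(M)`,
and let `{e,f}` be a pair of distinct tuples of `M`.  If there is `i ∈ {4,5,6,7}` with
`{e,f} ∈ S^i_M` and `|E(L_x(e,f))|, |E(L_y(e,f))| ≥ i`, then `{x,y}` is a 5/9th
swapping pair for `{e,f}`. -/
theorem medium_vertices_swapping (γ : ℝ) (hγ : 0 < γ) :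
    ∃ n₀ : ℕ, ∀ n : ℕ, n₀ ≤ n →
      ∀ t : ℕ, 1 ≤ t → (t : ℝ) ≤ (n : ℝ) / (3 * Real.sqrt 2) →
      ∀ H : Finset (Finset (Fin n)), Is3Graph n H →
      (∃ σ : Fin n ≃ Fin n, DegSeq4 γ t H σ) →
      ∀ M : Finset (Finset (Fin n)), IsPhantomMatching γ H M →
      ∀ x y : Fin n, x ∈ leave M → y ∈ leave M →
      ∀ e ∈ M, ∀ f ∈ M, e ≠ f →
      (∃ i ∈ ({4,5,6,7} : Finset ℕ), Smem γ H i e f ∧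
        i ≤ linkCount H x e f ∧ i ≤ linkCount H y e f) →
      Is59SwappingPair γ H x y e f := by
  refine ⟨0, ?_⟩
  intro n _ t _ _ H _ _ M hM x y _ _ e heM f hfM _ ⟨i, hi, hS, hx, hy⟩
  have he := hM.1 e heM
  have hf := hM.1 f hfM
  have hx' := hx
  have hy' := hy
  rw [linkCount_comm] at hx' hy'
  have key : ∀ {a b : ℕ}, ForcesSwap a b i →
      (a ≤ bcount γ H e ∧ b ≤ bcount γ H f) ∨ (a ≤ bcount γ H f ∧ b ≤ bcount γ H e) →
      Is59SwappingPair γ H x y e f := fun h hab =>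
    hab.elim (fun hab => is59SwappingPair_of_forcesSwap h he hf hab.1 hab.2 hx hy)
      fun hab => (is59SwappingPair_of_forcesSwap h hf he hab.1 hab.2 hx' hy').symm
  simp only [mem_insert, mem_singleton] at hi
  obtain rfl | rfl | rfl | rfl := hi <;> simp only [Smem] at hS
  · exact key forcesSwap_three_zero (by omega)
  · exact key forcesSwap_one_two (by omega)
  · exact key forcesSwap_one_one (by omega)
  · exact key forcesSwap_one_zero (by omega)
end
end
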